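/- arXiv:2411.03674 — 4 statements merged into one kernel-verified Lean document; each statement's English description precedes it below -/
import Mathlib

section
/- Let k ≥ 4 and n ≥ 3k−2 be integers, and let ℱ ⊆ ([n] choose k) be an intersecting family which is not a star, not isomorphic to a subfamily of ℋℳ(n,k), not isomorphic to a subfamily of 𝒥₂(n,k), and, when k = 4, not isomorphic to a subfamily of 𝒢₂(n,4) or 𝒢₃(n,4). Then |ℱ| ≤ C(n−1,k−1) − C(n−k−1,k−1) − C(n−k−2,k−2) − C(n−k−3,k−3) + 3. Moreover, for k = 4 or k ≥ 6 equality holds if and only if ℱ is isomorphic to 𝒥₃(n,k); for k = 5 equality holds if and only if ℱ is isomorphic to 𝒥₃(n,5) or 𝒢₄(n,5). -/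
open Finset

/-- `ℋℳ(n,k) = {F ∈ ([n] choose k) : 1 ∈ F, F ∩ [2,k+1] ≠ ∅} ∪ {[2,k+1]}`. -/
def HMfam (n k : ℕ) : Finset (Finset ℕ) :=
  insert (Icc 2 (k + 1))
    ((powersetCard k (Icc 1 n)).filter fun A => 1 ∈ A ∧ (A ∩ Icc 2 (k + 1)).Nonempty)

/-- `𝒥ᵢ(n,k)` with the canonical choice `x₀ = 1`, `E = [2,k]`, `Jᵢ = [k+1,k+i]`. -/
def Jfam (n k i : ℕ) : Finset (Finset ℕ) :=
  ((powersetCard k (Icc 1 n)).filter fun A =>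
      1 ∈ A ∧ ∀ j ∈ Icc (k + 1) (k + i), (A ∩ insert j (Icc 2 k)).Nonempty)
    ∪ (Icc (k + 1) (k + i)).image fun j => insert j (Icc 2 k)

/-- `𝒢ᵢ(n,k)` with the canonical choice `E = [1,i]`, `x₀ = i+1`. -/
def Gfam (n k i : ℕ) : Finset (Finset ℕ) :=
  ((powersetCard k (Icc 1 n)).filter fun A => Icc 1 i ⊆ A)
    ∪ ((powersetCard k (Icc 1 n)).filter fun A => i + 1 ∈ A ∧ (A ∩ Icc 1 i).Nonempty)

/-- `𝒜` is isomorphic to `ℬ`: some permutation of `[n]` maps `𝒜` onto `ℬ`. -/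
def IsoTo (n : ℕ) (A B : Finset (Finset ℕ)) : Prop :=
  ∃ σ : Equiv.Perm ℕ, (∀ x ∈ Icc 1 n, σ x ∈ Icc 1 n) ∧
    A.image (fun s => s.image fun x => σ x) = B

/-- `𝒜` is isomorphic to a subfamily of `ℬ`. -/
def SubIsoTo (n : ℕ) (A B : Finset (Finset ℕ)) : Prop :=
  ∃ σ : Equiv.Perm ℕ, (∀ x ∈ Icc 1 n, σ x ∈ Icc 1 n) ∧
    A.image (fun s => s.image fun x => σ x) ⊆ B

/-- The members of `F` containing `x`, with `x` removed. -/
def linkAt (x : ℕ) (F : Finset (Finset ℕ)) : Finset (Finset ℕ) :=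
  (F.filter fun A => x ∈ A).image fun A => A.erase x

/-- The members of `F` not containing `x`. -/
def avoidAt (x : ℕ) (F : Finset (Finset ℕ)) : Finset (Finset ℕ) :=
  F.filter fun A => x ∉ A

/-- Any member of `A` meets any member of `B`. -/
def CrossInt (A B : Finset (Finset ℕ)) : Prop :=
  ∀ a ∈ A, ∀ b ∈ B, (a ∩ b).Nonempty

lemma mem_linkAt {x : ℕ} {F : Finset (Finset ℕ)} {R : Finset ℕ} :
    R ∈ linkAt x F ↔ x ∉ R ∧ insert x R ∈ F := by
  simp only [linkAt, mem_image, mem_filter]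
  constructor
  · rintro ⟨A, ⟨hA, hx⟩, rfl⟩
    exact ⟨notMem_erase x A, by rwa [insert_erase hx]⟩
  · rintro ⟨hx, hR⟩
    exact ⟨_, ⟨hR, mem_insert_self x R⟩, erase_insert hx⟩

lemma mem_avoidAt {x : ℕ} {F : Finset (Finset ℕ)} {R : Finset ℕ} :
    R ∈ avoidAt x F ↔ R ∈ F ∧ x ∉ R := by
  simp [avoidAt]

lemma card_linkAt (x : ℕ) (F : Finset (Finset ℕ)) :
    (linkAt x F).card = (F.filter fun A => x ∈ A).card := by
  refine card_image_of_injOn fun A hA B hB h => ?_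
  simp only [coe_filter, Set.mem_ofPred_eq] at hA hB
  rw [← insert_erase hA.2, ← insert_erase hB.2]
  exact congrArg _ h

lemma card_linkAt_add_card_avoidAt (x : ℕ) (F : Finset (Finset ℕ)) :
    (linkAt x F).card + (avoidAt x F).card = F.card := by
  rw [card_linkAt]
  exact card_filter_add_card_filter_not (s := F) fun A => x ∈ A

lemma linkAt_subset {x k : ℕ} {V : Finset ℕ} {F : Finset (Finset ℕ)}
    (hF : F ⊆ powersetCard k V) : linkAt x F ⊆ powersetCard (k - 1) (V.erase x) := by
  intro R hR
  rw [mem_linkAt] at hR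
  have h := mem_powersetCard.1 (hF hR.2)
  rw [card_insert_of_notMem hR.1] at h
  refine mem_powersetCard.2 ⟨fun y hy => mem_erase.2 ⟨?_, h.1 (mem_insert_of_mem hy)⟩, by omega⟩
  rintro rfl
  exact hR.1 hy

lemma avoidAt_subset {x k : ℕ} {V : Finset ℕ} {F : Finset (Finset ℕ)}
    (hF : F ⊆ powersetCard k V) : avoidAt x F ⊆ powersetCard k (V.erase x) := by
  intro R hR
  rw [mem_avoidAt] at hR
  have h := mem_powersetCard.1 (hF hR.1)
  refine mem_powersetCard.2 ⟨fun y hy => mem_erase.2 ⟨?_, h.1 hy⟩, h.2⟩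
  rintro rfl
  exact hR.2 hy

/-- The `l`-subsets of `V` that contain `Z` and are disjoint from `Y`. -/
def between (V : Finset ℕ) (l : ℕ) (Y Z : Finset ℕ) : Finset (Finset ℕ) :=
  (powersetCard l V).filter fun R => Z ⊆ R ∧ Disjoint R Y

lemma mem_between {V : Finset ℕ} {l : ℕ} {Y Z R : Finset ℕ} :
    R ∈ between V l Y Z ↔ R ∈ powersetCard l V ∧ Z ⊆ R ∧ Disjoint R Y := by
  simp [between]

lemma between_subset (V : Finset ℕ) (l : ℕ) (Y Z : Finset ℕ) :
    between V l Y Z ⊆ powersetCard l V := filter_subset _ _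

lemma card_between {V Y Z : Finset ℕ} {l : ℕ} (hY : Y ⊆ V) (hZ : Z ⊆ V) (hYZ : Disjoint Y Z)
    (hl : Z.card ≤ l) :
    (between V l Y Z).card = (V.card - Y.card - Z.card).choose (l - Z.card) := by
  have h1 : between V l Y Z = (powersetCard (l - Z.card) ((V \ Y) \ Z)).image fun R => R ∪ Z := by
    ext R
    simp only [mem_between, mem_image, mem_powersetCard]
    constructor
    · rintro ⟨⟨h1, h2⟩, h3, h4⟩
      refine ⟨R \ Z, ⟨fun y hy => ?_, ?_⟩, sdiff_union_of_subset h3⟩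
      · simp only [mem_sdiff] at hy ⊢
        exact ⟨⟨h1 hy.1, disjoint_left.1 h4 hy.1⟩, hy.2⟩
      · rw [card_sdiff_of_subset h3, h2]
    · rintro ⟨R, ⟨h1, h2⟩, rfl⟩
      have hd : Disjoint R Z := disjoint_left.2 fun y hy => (mem_sdiff.1 (h1 hy)).2
      refine ⟨⟨union_subset (fun y hy => ?_) hZ, ?_⟩, subset_union_right, ?_⟩
      · exact (mem_sdiff.1 (mem_sdiff.1 (h1 hy)).1).1
      · rw [card_union_of_disjoint hd]; omega
      · refine disjoint_union_left.2 ⟨disjoint_left.2 fun y hy => ?_, hYZ.symm⟩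
        exact (mem_sdiff.1 (mem_sdiff.1 (h1 hy)).1).2
  rw [h1, card_image_of_injOn, card_powersetCard, card_sdiff_of_subset, card_sdiff_of_subset hY]
  · intro z hz
    exact mem_sdiff.2 ⟨hZ hz, disjoint_right.1 hYZ hz⟩
  · intro R hR S hS h
    simp only [mem_coe, mem_powersetCard] at hR hS
    have hd : ∀ R, R ⊆ (V \ Y) \ Z → (R ∪ Z) \ Z = R := fun R hR =>
      union_sdiff_cancel_right (disjoint_left.2 fun y hy => (mem_sdiff.1 (hR hy)).2)
    rw [← hd R hR.1, ← hd S hS.1]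
    exact congrArg (· \ Z) h

lemma disjoint_between {V Y Z Y' Z' : Finset ℕ} {l l' : ℕ} {z : ℕ} (h1 : z ∈ Z) (h2 : z ∈ Y') :
    Disjoint (between V l Y Z) (between V l' Y' Z') := by
  refine disjoint_left.2 fun R hR hR' => ?_
  exact disjoint_left.1 (mem_between.1 hR').2.2 ((mem_between.1 hR).2.1 h1) h2

lemma disjoint_between_of_meets {V Y Z b : Finset ℕ} {l : ℕ} {A : Finset (Finset ℕ)}
    (hA : ∀ a ∈ A, (a ∩ b).Nonempty) (hb : b ⊆ Y) : Disjoint A (between V l Y Z) := by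
  refine disjoint_left.2 fun R hR hR' => ?_
  obtain ⟨z, hz⟩ := hA R hR
  exact disjoint_left.1 (mem_between.1 hR').2.2 (mem_inter.1 hz).1 (hb (mem_inter.1 hz).2)

lemma card_add_le_of_disjoint {A K U : Finset (Finset ℕ)} (hA : A ⊆ U) (hK : K ⊆ U)
    (h : Disjoint A K) : A.card + K.card ≤ U.card := by
  rw [← card_union_of_disjoint h]
  exact card_le_card (union_subset hA hK)

/-- Sets meeting all of `E ∪ {y t}`, `t < s`: counting lower bound on the number of
`l`-sets that miss one of them. -/
lemma card_add_sum_le {V E : Finset ℕ} {k l s : ℕ} {y : ℕ → ℕ} (hE : E ⊆ V)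
    (hk : E.card + 1 = k) (hy : ∀ t < s, y t ∈ V ∧ y t ∉ E)
    (hinj : ∀ t < s, ∀ u < s, y t = y u → t = u) (hs : s ≤ l + 1)
    {A : Finset (Finset ℕ)} (hA : A ⊆ powersetCard l V)
    (hmeet : ∀ a ∈ A, ∀ t < s, (a ∩ insert (y t) E).Nonempty) :
    A.card + ∑ t ∈ range s, (V.card - k - t).choose (l - t) ≤ V.card.choose l := by
  induction s generalizing A with
  | zero => simpa using card_le_card hA
  | succ s ih =>
    set Z := (range s).image y with hZ
    have hcZ : Z.card = s := by
      rw [hZ, card_image_of_injOn, card_range]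
      intro t ht u hu h
      simp only [coe_range, Set.mem_Iio] at ht hu
      exact hinj t (by omega) u (by omega) h
    have hys := hy s (by omega)
    have hcY : (insert (y s) E).card = k := by rw [card_insert_of_notMem hys.2, hk]
    have hZV : Z ⊆ V := by
      intro z hz
      obtain ⟨t, ht, rfl⟩ := mem_image.1 hz
      exact (hy t (by have := mem_range.1 ht; omega)).1
    have hd : Disjoint (insert (y s) E) Z := by
      refine disjoint_right.2 fun z hz hz' => ?_
      obtain ⟨t, ht, rfl⟩ := mem_image.1 hz
      have ht := mem_range.1 ht
      rcases mem_insert.1 hz' with h | h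
      · have := hinj t (by omega) s (by omega) h
        omega
      · exact (hy t (by omega)).2 h
    have hcard := card_between (l := l) (insert_subset hys.1 hE) hZV hd (by omega)
    rw [hcY, hcZ] at hcard
    have hdis : Disjoint A (between V l (insert (y s) E) Z) :=
      disjoint_between_of_meets (fun a ha => hmeet a ha s (by omega)) subset_rfl
    have := ih (fun t ht => hy t (by omega)) (fun t ht u hu => hinj t (by omega) u (by omega))
      (by omega) (A := A ∪ between V l (insert (y s) E) Z)
      (union_subset hA (between_subset _ _ _ _)) ?_
    · rw [card_union_of_disjoint hdis, hcard] at this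
      rw [sum_range_succ]
      omega
    · intro a ha t ht
      rcases mem_union.1 ha with ha | ha
      · exact hmeet a ha t (by omega)
      · exact ⟨y t, mem_inter.2 ⟨(mem_between.1 ha).2.1 (mem_image_of_mem y (mem_range.2 ht)),
          mem_insert_self _ _⟩⟩

lemma exists_perm_image_eq (U s t : Finset ℕ) (hs : s ⊆ U) (ht : t ⊆ U) (hc : s.card = t.card) :
    ∃ σ : Equiv.Perm ℕ, (s.image fun x => σ x) = t ∧ ∀ x ∉ U, σ x = x := by
  induction h : (s \ t).card generalizing s with
  | zero =>
    have hst : s ⊆ t := sdiff_eq_empty_iff_subset.1 (card_eq_zero.1 h)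
    exact ⟨1, by simpa using eq_of_subset_of_card_le hst hc.ge, fun _ _ => rfl⟩
  | succ d ih =>
    obtain ⟨a, ha⟩ : (s \ t).Nonempty := card_pos.1 (by omega)
    have h' : (t \ s).card = (s \ t).card := by
      have h1 := card_sdiff_add_card_inter s t
      have h2 := card_sdiff_add_card_inter t s
      rw [inter_comm] at h2
      omega
    obtain ⟨b, hb⟩ : (t \ s).Nonempty := card_pos.1 (by omega)
    rw [mem_sdiff] at ha hb
    have hab : a ≠ b := by rintro rfl; exact hb.2 ha.1
    have him : (s.image fun x => Equiv.swap a b x) = insert b (s.erase a) := by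
      ext z
      simp only [mem_image, mem_insert, mem_erase]
      constructor
      · rintro ⟨w, hw, rfl⟩
        by_cases h1 : w = a
        · left; simp [h1]
        · have h2 : w ≠ b := by rintro rfl; exact hb.2 hw
          right; rw [Equiv.swap_apply_of_ne_of_ne h1 h2]; exact ⟨h1, hw⟩
      · rintro (rfl | ⟨h1, h2⟩)
        · exact ⟨a, ha.1, by simp⟩
        · have h3 : z ≠ b := by rintro rfl; exact hb.2 h2
          exact ⟨z, h2, Equiv.swap_apply_of_ne_of_ne h1 h3⟩
    obtain ⟨σ, h1, h2⟩ := ih (insert b (s.erase a))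
      (insert_subset (ht hb.1) ((erase_subset _ _).trans hs))
      (by rw [card_insert_of_notMem (by simp [hb.2]), card_erase_of_mem ha.1, ← hc]
          have := card_pos.2 ⟨a, ha.1⟩; omega)
      (by
        have : insert b (s.erase a) \ t = (s \ t).erase a := by
          ext z
          simp only [mem_sdiff, mem_insert, mem_erase]
          constructor
          · rintro ⟨rfl | h, h'⟩
            · exact absurd hb.1 h'
            · exact ⟨h.1, h.2, h'⟩
          · rintro ⟨h, h', h''⟩
            exact ⟨Or.inr ⟨h, h'⟩, h''⟩
        rw [this, card_erase_of_mem (mem_sdiff.2 ha)]; omega)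
    refine ⟨σ * Equiv.swap a b, ?_, fun x hx => ?_⟩
    · rw [← h1, ← him, image_image]; rfl
    · have hxa : x ≠ a := by rintro rfl; exact hx (hs ha.1)
      have hxb : x ≠ b := by rintro rfl; exact hx (ht hb.1)
      rw [Equiv.Perm.mul_apply, Equiv.swap_apply_of_ne_of_ne hxa hxb, h2 x hx]

/-- `A` is stable under replacing an element of `[m]` by a smaller one. -/
def ShiftedOn (m : ℕ) (A : Finset (Finset ℕ)) : Prop :=
  ∀ R ∈ A, ∀ i j, 1 ≤ i → i < j → j ≤ m → j ∈ R → i ∉ R → insert i (R.erase j) ∈ A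

lemma ShiftedOn.mem_of_dominated {m l : ℕ} {A : Finset (Finset ℕ)} (hsh : ShiftedOn m A)
    (hA : A ⊆ powersetCard l (Icc 1 m)) {R S : Finset ℕ} (hR : R ∈ A)
    (hS : S ∈ powersetCard l (Icc 1 m))
    (hdom : ∀ t, (R.filter (· ≤ t)).card ≤ (S.filter (· ≤ t)).card) : S ∈ A := by
  induction h : (R \ S).card generalizing R with
  | zero =>
    have hRS : R ⊆ S := sdiff_eq_empty_iff_subset.1 (card_eq_zero.1 h)
    have h1 := (mem_powersetCard.1 (hA hR)).2
    have h2 := (mem_powersetCard.1 hS).2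
    rwa [← eq_of_subset_of_card_le hRS (by omega)]
  | succ d ih =>
    have hR' := mem_powersetCard.1 (hA hR)
    have hS' := mem_powersetCard.1 hS
    have hne : (R \ S).Nonempty := card_pos.1 (by omega)
    have hne' : (S \ R).Nonempty := by
      have h1 := card_sdiff_add_card_inter R S
      have h2 := card_sdiff_add_card_inter S R
      rw [inter_comm] at h2
      exact card_pos.1 (by omega)
    set x := (R \ S).min' hne with hx
    set y := (S \ R).min' hne' with hy
    have hxm : x ∈ R \ S := min'_mem _ _
    have hym : y ∈ S \ R := min'_mem _ _
    have hxl : ∀ z ∈ R \ S, x ≤ z := fun z hz => min'_le _ _ hz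
    have hyl : ∀ z ∈ S \ R, y ≤ z := fun z hz => min'_le _ _ hz
    clear_value x y
    rw [mem_sdiff] at hxm hym
    have hsub : ∀ t, t < x → R.filter (· ≤ t) ⊆ S.filter (· ≤ t) := by
      intro t ht z hz
      rw [mem_filter] at hz ⊢
      refine ⟨by_contra fun hzS => ?_, hz.2⟩
      have := hxl z (mem_sdiff.2 ⟨hz.1, hzS⟩)
      omega
    have hyx : y < x := by
      by_contra hcon
      have hlt : (S.filter (· ≤ x)).card < (R.filter (· ≤ x)).card := by
        refine card_lt_card ⟨fun z hz => ?_, fun hcon' => ?_⟩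
        · rw [mem_filter] at hz ⊢
          refine ⟨by_contra fun hzR => ?_, hz.2⟩
          have := hyl z (mem_sdiff.2 ⟨hz.1, hzR⟩)
          have : z ≠ x := by rintro rfl; exact hxm.2 hz.1
          omega
        · exact hxm.2 (mem_filter.1 (hcon' (mem_filter.2 ⟨hxm.1, le_rfl⟩))).1
      exact absurd (hdom x) (by omega)
    have hy1 := mem_Icc.1 (hS'.1 hym.1)
    have hx1 := mem_Icc.1 (hR'.1 hxm.1)
    refine ih (hsh R hR y x hy1.1 hyx hx1.2 hxm.1 hym.2) (fun t => ?_) ?_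
    · by_cases ht : t < x
      · refine card_le_card fun z hz => ?_
        rw [mem_filter, mem_insert, mem_erase] at hz
        rcases hz with ⟨rfl | hz, hzt⟩
        · exact mem_filter.2 ⟨hym.1, hzt⟩
        · exact hsub t ht (mem_filter.2 ⟨hz.2, hzt⟩)
      · refine le_trans ?_ (hdom t)
        have h1 : (insert y (R.erase x)).filter (· ≤ t) =
            insert y ((R.filter (· ≤ t)).erase x) := by
          ext z
          simp only [mem_filter, mem_insert, mem_erase]
          constructor
          · rintro ⟨rfl | h, h'⟩
            · exact Or.inl rfl
            · exact Or.inr ⟨h.1, h.2, h'⟩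
          · rintro (rfl | h)
            · exact ⟨Or.inl rfl, by omega⟩
            · exact ⟨Or.inr ⟨h.1, h.2.1⟩, h.2.2⟩
        rw [h1]
        refine (card_insert_le _ _).trans ?_
        rw [card_erase_add_one (mem_filter.2 ⟨hxm.1, by omega⟩)]
    · have : insert y (R.erase x) \ S = (R \ S).erase x := by
        ext z
        simp only [mem_sdiff, mem_insert, mem_erase]
        constructor
        · rintro ⟨rfl | h, h'⟩
          · exact absurd hym.1 h'
          · exact ⟨h.1, h.2, h'⟩
        · rintro ⟨h, h', h''⟩
          exact ⟨Or.inr ⟨h, h'⟩, h''⟩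
      rw [this, card_erase_of_mem (mem_sdiff.2 hxm)]
      omega

lemma card_filter_le_le {m t : ℕ} {R : Finset ℕ} (hR : R ⊆ Icc 1 m) :
    (R.filter (· ≤ t)).card ≤ t := by
  calc _ ≤ (Icc 1 t).card := card_le_card fun z hz => by
        rw [mem_filter] at hz
        exact mem_Icc.2 ⟨(mem_Icc.1 (hR hz.1)).1, hz.2⟩
    _ = t := by simp

lemma le_card_filter_le {p t : ℕ} {S : Finset ℕ} (hS : Icc 1 p ⊆ S) (ht : t ≤ p) :
    t ≤ (S.filter (· ≤ t)).card := by
  calc t = (Icc 1 t).card := by simp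
    _ ≤ _ := card_le_card fun z hz => by
        rw [mem_Icc] at hz
        exact mem_filter.2 ⟨hS (mem_Icc.2 ⟨hz.1, by omega⟩), hz.2⟩

lemma le_card_filter_le' {p t : ℕ} {S : Finset ℕ} (hS : Icc 1 p ⊆ S) (ht : p ≤ t) :
    p ≤ (S.filter (· ≤ t)).card :=
  (le_card_filter_le hS le_rfl).trans (card_le_card fun z hz => by
    rw [mem_filter] at hz ⊢; exact ⟨hz.1, hz.2.trans ht⟩)

/-- A member reaching beyond `q` forces `[1, l - 1] ∪ {q}` into a shifted family. -/
lemma ShiftedOn.insert_mem {m l q z : ℕ} {A : Finset (Finset ℕ)} (hsh : ShiftedOn m A)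
    (hA : A ⊆ powersetCard l (Icc 1 m)) {R : Finset ℕ} (hR : R ∈ A) (hz : z ∈ R) (hqz : q ≤ z)
    (hl : l ≤ q) (hl1 : 1 ≤ l) : insert q (Icc 1 (l - 1)) ∈ A := by
  have hR' := mem_powersetCard.1 (hA hR)
  have hzm := mem_Icc.1 (hR'.1 hz)
  have hq : q ∉ Icc 1 (l - 1) := by rw [mem_Icc]; omega
  have hcard : (insert q (Icc 1 (l - 1))).card = l := by
    rw [card_insert_of_notMem hq, Nat.card_Icc]; omega
  refine hsh.mem_of_dominated hA hR (mem_powersetCard.2 ⟨?_, hcard⟩) fun t => ?_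
  · refine insert_subset (mem_Icc.2 (by omega)) (Icc_subset_Icc le_rfl (by omega))
  · by_cases h1 : t ≤ l - 1
    · exact (card_filter_le_le hR'.1).trans (le_card_filter_le (subset_insert _ _) h1)
    · by_cases h2 : q ≤ t
      · rw [(filter_eq_self (s := insert q _) (p := (· ≤ t))).2, hcard, ← hR'.2]
        · exact card_filter_le _ _
        · intro w hw
          rcases mem_insert.1 hw with rfl | hw
          · exact h2
          · have := mem_Icc.1 hw; omega
      · refine le_trans ?_ (le_card_filter_le' (p := l - 1) (subset_insert _ _) (by omega))
        have : (R.filter (· ≤ t)).card < R.card := by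
          refine card_lt_card (filter_ssubset.2 ⟨z, hz, by omega⟩)
        omega

lemma ShiftedOn.Icc_mem {m l : ℕ} {A : Finset (Finset ℕ)} (hsh : ShiftedOn m A)
    (hA : A ⊆ powersetCard l (Icc 1 m)) (hl1 : 1 ≤ l) (hne : A.Nonempty) : Icc 1 l ∈ A := by
  obtain ⟨R, hR⟩ := hne
  have hR' := mem_powersetCard.1 (hA hR)
  obtain ⟨z, hz, hlz⟩ : ∃ z ∈ R, l ≤ z := by
    by_contra! hcon
    have : R ⊆ Icc 1 (l - 1) := fun z hz =>
      mem_Icc.2 ⟨(mem_Icc.1 (hR'.1 hz)).1, by have := hcon z hz; omega⟩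
    have := card_le_card this
    rw [Nat.card_Icc] at this
    omega
  have h := hsh.insert_mem hA hR hz hlz le_rfl hl1
  have h2 : insert l (Icc 1 (l - 1)) = Icc 1 l := by
    ext z; simp only [mem_insert, mem_Icc]; omega
  rwa [h2] at h

lemma ShiftedOn.insert_mem_of_two_le {m l : ℕ} {A : Finset (Finset ℕ)} (hsh : ShiftedOn m A)
    (hA : A ⊆ powersetCard l (Icc 1 m)) (hl1 : 1 ≤ l) (h2 : 2 ≤ A.card) :
    insert (l + 1) (Icc 1 (l - 1)) ∈ A := by
  obtain ⟨R, hR, hne⟩ : ∃ R ∈ A, R ≠ Icc 1 l := by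
    by_contra! hcon
    have : A ⊆ {Icc 1 l} := fun R hR => mem_singleton.2 (hcon R hR)
    have := card_le_card this
    rw [card_singleton] at this
    omega
  have hR' := mem_powersetCard.1 (hA hR)
  obtain ⟨z, hz, hlz⟩ : ∃ z ∈ R, l + 1 ≤ z := by
    by_contra! hcon
    refine hne (eq_of_subset_of_card_le (fun z hz =>
      mem_Icc.2 ⟨(mem_Icc.1 (hR'.1 hz)).1, by have := hcon z hz; omega⟩) ?_)
    rw [Nat.card_Icc, hR'.2]; omega
  exact hsh.insert_mem hA hR hz hlz (by omega) hl1

/-- The set `[1, k - 2] ∪ {k, k + 1}`. -/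
def skipSet (k : ℕ) : Finset ℕ := insert k (insert (k + 1) (Icc 1 (k - 2)))

lemma mem_skipSet {k z : ℕ} : z ∈ skipSet k ↔ z = k ∨ z = k + 1 ∨ (1 ≤ z ∧ z ≤ k - 2) := by
  simp [skipSet]

lemma card_skipSet {k : ℕ} (hk : 2 ≤ k) : (skipSet k).card = k := by
  rw [skipSet, card_insert_of_notMem, card_insert_of_notMem, Nat.card_Icc]
  · omega
  · rw [mem_Icc]; omega
  · rw [mem_insert, mem_Icc]; omega

/-- A member missing an element of `[1, k - 1]` forces `skipSet k` into a shifted family. -/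
lemma ShiftedOn.skipSet_mem {m k z : ℕ} {B : Finset (Finset ℕ)} {R : Finset ℕ}
    (hsh : ShiftedOn m B) (hB : B ⊆ powersetCard k (Icc 1 m)) (hk : 2 ≤ k) (hkm : k + 1 ≤ m)
    (hR : R ∈ B) (hz : z ∈ Icc 1 (k - 1)) (hlz : z ∉ R) : skipSet k ∈ B := by
  have hR' := mem_powersetCard.1 (hB hR)
  have hz' := mem_Icc.1 hz
  have hcard := card_skipSet hk
  have hsub : Icc 1 (k - 2) ⊆ skipSet k := fun w hw => by
    rw [mem_skipSet]; rw [mem_Icc] at hw; omega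
  have key : ∀ t, k - 1 ≤ t → (R.filter (· ≤ t)).card ≤ t - 1 := by
    intro t ht
    calc _ ≤ ((Icc 1 t).erase z).card := card_le_card fun w hw => by
          rw [mem_filter] at hw
          refine mem_erase.2 ⟨?_, mem_Icc.2 ⟨(mem_Icc.1 (hR'.1 hw.1)).1, hw.2⟩⟩
          rintro rfl; exact hlz hw.1
      _ = _ := by rw [card_erase_of_mem (mem_Icc.2 (by omega)), Nat.card_Icc]; simp
  refine hsh.mem_of_dominated hB hR (mem_powersetCard.2 ⟨fun w hw => ?_, hcard⟩) fun t => ?_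
  · rw [mem_skipSet] at hw; rw [mem_Icc]; omega
  · rcases (by omega : t ≤ k - 2 ∨ t = k - 1 ∨ t = k ∨ k + 1 ≤ t) with h | rfl | rfl | h
    · exact (card_filter_le_le hR'.1).trans (le_card_filter_le hsub h)
    · exact (key _ le_rfl).trans (le_card_filter_le' hsub (by omega))
    · refine (key _ (by omega)).trans ?_
      calc t - 1 = (insert t (Icc 1 (t - 2))).card := by
            rw [card_insert_of_notMem (by rw [mem_Icc]; omega), Nat.card_Icc]; omega
        _ ≤ _ := card_le_card fun w hw => by
            rw [mem_insert, mem_Icc] at hw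
            rw [mem_filter, mem_skipSet]; omega
    · rw [(filter_eq_self (s := skipSet k) (p := (· ≤ t))).2, hcard, ← hR'.2]
      · exact card_filter_le _ _
      · intro w hw
        rw [mem_skipSet] at hw; omega

lemma ShiftedOn.mem_of_large {m k : ℕ} {B : Finset (Finset ℕ)} (hsh : ShiftedOn m B)
    (hB : B ⊆ powersetCard k (Icc 1 m)) (hk : 2 ≤ k) (hkm : 2 * k ≤ m)
    (hc : m - k + 2 ≤ B.card) :
    insert (k + 2) (Icc 1 (k - 1)) ∈ B ∧ skipSet k ∈ B := by
  constructor
  · obtain ⟨R, hR, z, hz, hlz⟩ : ∃ R ∈ B, ∃ z ∈ R, k + 2 ≤ z := by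
      by_contra! hcon
      have : B ⊆ powersetCard k (Icc 1 (k + 1)) := fun R hR => by
        have hR' := mem_powersetCard.1 (hB hR)
        refine mem_powersetCard.2 ⟨fun z hz => mem_Icc.2 ⟨(mem_Icc.1 (hR'.1 hz)).1, ?_⟩, hR'.2⟩
        have := hcon R hR z hz
        omega
      have := card_le_card this
      rw [card_powersetCard, Nat.card_Icc, Nat.add_sub_cancel, Nat.choose_succ_self_right] at this
      omega
    exact hsh.insert_mem hB hR hz hlz (by omega) (by omega)
  · obtain ⟨R, hR, z, hz, hlz⟩ : ∃ R ∈ B, ∃ z ∈ Icc 1 (k - 1), z ∉ R := by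
      by_contra! hcon
      have : B ⊆ (Icc k m).image fun y => insert y (Icc 1 (k - 1)) := fun R hR => by
        have hR' := mem_powersetCard.1 (hB hR)
        have hsub : Icc 1 (k - 1) ⊆ R := hcon R hR
        have hcd := card_sdiff_of_subset hsub
        rw [hR'.2, Nat.card_Icc] at hcd
        obtain ⟨y, hy⟩ := card_eq_one.1 (show (R \ Icc 1 (k - 1)).card = 1 by omega)
        have hyR : y ∈ R \ Icc 1 (k - 1) := by rw [hy]; exact mem_singleton_self y
        rw [mem_sdiff, mem_Icc] at hyR
        have := mem_Icc.1 (hR'.1 hyR.1)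
        refine mem_image.2 ⟨y, mem_Icc.2 (by omega), ?_⟩
        rw [insert_eq, ← hy, sdiff_union_of_subset hsub]
      have := (card_le_card this).trans card_image_le
      rw [Nat.card_Icc] at this
      omega
    exact hsh.skipSet_mem hB hk (by omega) hR hz hlz

lemma choose_eq_sum_add (N p s : ℕ) (hp : s ≤ p) (hN : s ≤ N + 1) :
    (N + 1).choose p = ∑ t ∈ range s, (N - t).choose (p - t) + (N + 1 - s).choose (p - s) := by
  induction s with
  | zero => simp
  | succ s ih =>
    rw [ih (by omega) (by omega), sum_range_succ, add_assoc]
    congr 1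
    obtain ⟨a, ha⟩ : ∃ a, N = a + s := ⟨N - s, by omega⟩
    obtain ⟨b, hb⟩ : ∃ b, p = b + s + 1 := ⟨p - s - 1, by omega⟩
    subst ha hb
    rw [show a + s + 1 - s = a + 1 by omega, show b + s + 1 - s = b + 1 by omega,
      show a + s - s = a by omega,
      show a + s + 1 - (s + 1) = a by omega, show b + s + 1 - (s + 1) = b by omega,
      Nat.choose_succ_succ, add_comm]

lemma Icc_erase_last (m : ℕ) : (Icc 1 (m + 1)).erase (m + 1) = Icc 1 m := by
  ext z; simp only [mem_erase, mem_Icc]; omega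

lemma linkAt_subset_last {m l : ℕ} {A : Finset (Finset ℕ)}
    (hA : A ⊆ powersetCard l (Icc 1 (m + 1))) :
    linkAt (m + 1) A ⊆ powersetCard (l - 1) (Icc 1 m) := by
  have := linkAt_subset (x := m + 1) hA
  rwa [Icc_erase_last] at this

lemma avoidAt_subset_last {m l : ℕ} {A : Finset (Finset ℕ)}
    (hA : A ⊆ powersetCard l (Icc 1 (m + 1))) :
    avoidAt (m + 1) A ⊆ powersetCard l (Icc 1 m) := by
  have := avoidAt_subset (x := m + 1) hA
  rwa [Icc_erase_last] at this

lemma ShiftedOn.avoidAt {m : ℕ} {A : Finset (Finset ℕ)} (h : ShiftedOn (m + 1) A) :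
    ShiftedOn m (avoidAt (m + 1) A) := by
  intro R hR i j hi hij hj hjR hiR
  rw [mem_avoidAt] at hR ⊢
  refine ⟨h R hR.1 i j hi hij (by omega) hjR hiR, ?_⟩
  rw [mem_insert, mem_erase]
  rintro (h | h)
  · omega
  · exact hR.2 h.2

lemma ShiftedOn.linkAt {m : ℕ} {A : Finset (Finset ℕ)} (h : ShiftedOn (m + 1) A) :
    ShiftedOn m (linkAt (m + 1) A) := by
  intro R hR i j hi hij hj hjR hiR
  rw [mem_linkAt] at hR ⊢
  refine ⟨?_, ?_⟩
  · rw [mem_insert, mem_erase]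
    rintro (h | h)
    · omega
    · exact hR.1 h.2
  · have := h _ hR.2 i j hi hij (by omega) (mem_insert_of_mem hjR)
      (by rw [mem_insert]; rintro (h | h); · omega
          · exact hiR h)
    rw [Finset.insert_comm, ← erase_insert_of_ne (by omega)]
    exact this

lemma CrossInt.linkAt_last {m k l : ℕ} {A B : Finset (Finset ℕ)} (hc : CrossInt A B)
    (hA : A ⊆ powersetCard l (Icc 1 (m + 1))) (hB : B ⊆ powersetCard k (Icc 1 (m + 1)))
    (sB : ShiftedOn (m + 1) B) (hm : k + l ≤ m + 1) (hl : 1 ≤ l) (hk : 1 ≤ k) :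
    CrossInt (linkAt (m + 1) A) (linkAt (m + 1) B) := by
  intro a ha b hb
  have ha' := mem_powersetCard.1 (linkAt_subset_last hA ha)
  have hb' := mem_powersetCard.1 (linkAt_subset_last hB hb)
  rw [mem_linkAt] at ha hb
  by_contra hcon
  rw [not_nonempty_iff_eq_empty] at hcon
  have hcu := card_union_add_card_inter a b
  rw [hcon, card_empty, ha'.2, hb'.2] at hcu
  obtain ⟨z, hz⟩ : (Icc 1 m \ (a ∪ b)).Nonempty := by
    rw [← card_pos, card_sdiff_of_subset (union_subset ha'.1 hb'.1), Nat.card_Icc]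
    omega
  rw [mem_sdiff, mem_union, mem_Icc] at hz
  have hne : z ≠ m + 1 := by omega
  have h1 := sB _ hb.2 z (m + 1) hz.1.1 (by omega) le_rfl (mem_insert_self _ _)
    (by rw [mem_insert]; tauto)
  rw [erase_insert hb.1] at h1
  obtain ⟨w, hw⟩ := hc _ ha.2 _ h1
  rw [mem_inter, mem_insert, mem_insert] at hw
  rcases hw with ⟨rfl | hw, rfl | hw'⟩
  · exact hne rfl
  · exact hb.1 hw'
  · tauto
  · have : w ∈ a ∩ b := mem_inter.2 ⟨hw, hw'⟩
    rw [hcon] at this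
    exact notMem_empty _ this

lemma card_add_card_le_of_complement {m k l : ℕ} (hm : m = k + l) {A B : Finset (Finset ℕ)}
    (hA : A ⊆ powersetCard l (Icc 1 m)) (hB : B ⊆ powersetCard k (Icc 1 m))
    (hc : CrossInt A B) : A.card + B.card ≤ m.choose l := by
  have hinj : Set.InjOn (fun b => Icc 1 m \ b) (B : Set (Finset ℕ)) := by
    intro b hb c hc h
    have h1 := (mem_powersetCard.1 (hB hb)).1
    have h2 := (mem_powersetCard.1 (hB hc)).1
    have h3 : Icc 1 m \ b = Icc 1 m \ c := h
    rw [← Finset.sdiff_sdiff_eq_self h1, h3, Finset.sdiff_sdiff_eq_self h2]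
  have := card_add_le_of_disjoint (A := A) (K := B.image fun b => Icc 1 m \ b)
    (U := powersetCard l (Icc 1 m)) hA ?_ ?_
  · rwa [card_image_of_injOn hinj, card_powersetCard, Nat.card_Icc, Nat.add_sub_cancel] at this
  · intro R hR
    obtain ⟨b, hb, rfl⟩ := mem_image.1 hR
    have h1 := mem_powersetCard.1 (hB hb)
    refine mem_powersetCard.2 ⟨sdiff_subset, ?_⟩
    rw [card_sdiff_of_subset h1.1, Nat.card_Icc]
    omega
  · refine disjoint_left.2 fun R hR hR' => ?_
    obtain ⟨b, hb, rfl⟩ := mem_image.1 hR'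
    obtain ⟨z, hz⟩ := hc _ hR b hb
    rw [mem_inter, mem_sdiff] at hz
    exact hz.1.2 hz.2

/-- Common hypotheses of the counting lemmas for shifted cross-intersecting pairs. -/
structure ShiftedPair (m k l : ℕ) (A B : Finset (Finset ℕ)) : Prop where
  subA : A ⊆ powersetCard l (Icc 1 m)
  subB : B ⊆ powersetCard k (Icc 1 m)
  shA : ShiftedOn m A
  shB : ShiftedOn m B
  cross : CrossInt A B
  closed : ∀ b ∈ B, ∀ a ⊆ b, a.card = l → a ∈ A

lemma ShiftedPair.avoid {m k l : ℕ} {A B : Finset (Finset ℕ)} (h : ShiftedPair (m + 1) k l A B) :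
    ShiftedPair m k l (avoidAt (m + 1) A) (avoidAt (m + 1) B) where
  subA := avoidAt_subset_last h.subA
  subB := avoidAt_subset_last h.subB
  shA := h.shA.avoidAt
  shB := h.shB.avoidAt
  cross a ha b hb := h.cross a (mem_avoidAt.1 ha).1 b (mem_avoidAt.1 hb).1
  closed b hb a ha hc := mem_avoidAt.2
    ⟨h.closed b (mem_avoidAt.1 hb).1 a ha hc, fun hm => (mem_avoidAt.1 hb).2 (ha hm)⟩

lemma ShiftedPair.link {m k l : ℕ} {A B : Finset (Finset ℕ)} (h : ShiftedPair (m + 1) k l A B)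
    (hm : k + l ≤ m + 1) (hl : 1 ≤ l) (hk : 1 ≤ k) :
    ShiftedPair m (k - 1) (l - 1) (linkAt (m + 1) A) (linkAt (m + 1) B) where
  subA := linkAt_subset_last h.subA
  subB := linkAt_subset_last h.subB
  shA := h.shA.linkAt
  shB := h.shB.linkAt
  cross := h.cross.linkAt_last h.subA h.subB h.shB hm hl hk
  closed b hb a ha hc := by
    rw [mem_linkAt] at hb ⊢
    have ha' : m + 1 ∉ a := fun hm => hb.1 (ha hm)
    refine ⟨ha', h.closed _ hb.2 _ (insert_subset_insert _ ha) ?_⟩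
    rw [card_insert_of_notMem ha']
    omega

/-- A member of `A` through `m + 1` meets each member of `B` below `m + 1` elsewhere. -/
lemma ShiftedPair.linkAt_meets {m k l : ℕ} {A B : Finset (Finset ℕ)}
    (h : ShiftedPair (m + 1) k l A B) {a b : Finset ℕ} (ha : a ∈ linkAt (m + 1) A)
    (hb : b ∈ B) (hbm : m + 1 ∉ b) : (a ∩ b).Nonempty := by
  rw [mem_linkAt] at ha
  obtain ⟨z, hz⟩ := h.cross _ ha.2 b hb
  rw [mem_inter, mem_insert] at hz
  rcases hz.1 with rfl | hz'
  · exact absurd hz.2 hbm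
  · exact ⟨z, mem_inter.2 ⟨hz', hz.2⟩⟩

lemma Icc_insert_last {k : ℕ} (hk : 1 ≤ k) : insert k (Icc 1 (k - 1)) = Icc 1 k := by
  ext z; simp only [mem_insert, mem_Icc]; omega

lemma ShiftedPair.one_le_of_mem {m k l : ℕ} {A B : Finset (Finset ℕ)}
    (h : ShiftedPair m k l A B) {b : Finset ℕ} (hb : b ∈ B) : 1 ≤ l := by
  by_contra hl
  have hl0 : l = 0 := by omega
  subst hl0
  have := h.closed b hb ∅ (empty_subset _) card_empty
  obtain ⟨z, hz⟩ := h.cross _ this b hb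
  simp at hz

lemma ShiftedPair.mem_of_last {m k l s : ℕ} {A B : Finset (Finset ℕ)}
    (h : ShiftedPair m k l A B) (hk : 1 ≤ k) (hs : 1 ≤ s)
    (hb : insert (k + s - 1) (Icc 1 (k - 1)) ∈ B) {t : ℕ} (ht : t < s) :
    insert (k + t) (Icc 1 (k - 1)) ∈ B :=
  h.shB.insert_mem h.subB hb (mem_insert_self _ _) (by omega) (by omega) hk

lemma ShiftedPair.card_link_of_empty {m k l s : ℕ} {A B : Finset (Finset ℕ)}
    (h : ShiftedPair (m + 1) k l A B) (hk : 1 ≤ k) (hm : k + s ≤ m + 1)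
    (hb : insert (k + s - 1) (Icc 1 (k - 1)) ∈ B) (hs : 1 ≤ s) (hsl : s ≤ l)
    {K : Finset (Finset ℕ)} (hKs : K ⊆ powersetCard (l - 1) (Icc 1 m))
    (hKm : ∀ a ∈ K, ∀ t < s, (a ∩ insert (k + t) (Icc 1 (k - 1))).Nonempty) :
    (linkAt (m + 1) A ∪ K).card + ∑ t ∈ range s, (m - k - t).choose (l - 1 - t) ≤
      m.choose (l - 1) := by
  have := card_add_sum_le (V := Icc 1 m) (E := Icc 1 (k - 1)) (k := k) (l := l - 1) (s := s)
    (y := fun t => k + t) (A := linkAt (m + 1) A ∪ K) (Icc_subset_Icc le_rfl (by omega))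
    (by rw [Nat.card_Icc]; omega) (fun t ht => by simp only [mem_Icc]; omega)
    (fun t _ u _ h => by simpa using h) (by omega)
    (union_subset (linkAt_subset_last h.subA) hKs)
    (fun a ha t ht => by
      rcases mem_union.1 ha with ha | ha
      · refine h.linkAt_meets ha (h.mem_of_last hk hs hb ht) ?_
        rw [mem_insert, mem_Icc]; omega
      · exact hKm a ha t ht)
  simpa using this

lemma sum_choose_succ {m k l s : ℕ} (hs : s ≤ l) (hsm : k + s ≤ m + 1) :
    ∑ t ∈ range s, (m + 1 - k - t).choose (l - t) =
      ∑ t ∈ range s, (m - k - t).choose (l - t) +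
        ∑ t ∈ range s, (m - k - t).choose (l - 1 - t) := by
  rw [← sum_add_distrib]
  refine sum_congr rfl fun t ht => ?_
  have := mem_range.1 ht
  obtain ⟨a, ha⟩ : ∃ a, m = k + t + a := ⟨m - k - t, by omega⟩
  obtain ⟨b, hb⟩ : ∃ b, l = t + b + 1 := ⟨l - t - 1, by omega⟩
  subst ha hb
  rw [show k + t + a + 1 - k - t = a + 1 by omega, show t + b + 1 - t = b + 1 by omega,
    show k + t + a - k - t = a by omega, show t + b + 1 - 1 - t = b by omega,
    Nat.choose_succ_succ, add_comm]

theorem ShiftedPair.card_add_card_le {m k l s : ℕ} {A B : Finset (Finset ℕ)}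
    (h : ShiftedPair m k l A B) (hlk : l ≤ k) (hm : k + l ≤ m) (hs : 1 ≤ s)
    (hsl : s + 1 ≤ l ∨ s = 1) (hb : insert (k + s - 1) (Icc 1 (k - 1)) ∈ B) :
    A.card + B.card + ∑ t ∈ range s, (m - k - t).choose (l - t) ≤ m.choose l + s := by
  induction m generalizing k l s A B with
  | zero => have := h.one_le_of_mem hb; omega
  | succ m ih =>
    have hl := h.one_le_of_mem hb
    rcases Nat.lt_or_eq_of_le hm with hm | hm
    · rw [sum_choose_succ (by omega) (by omega), ← card_linkAt_add_card_avoidAt (m + 1) A,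
        ← card_linkAt_add_card_avoidAt (m + 1) B]
      have h1 := ih h.avoid hlk (by omega) hs hsl (mem_avoidAt.2 ⟨hb, by
        rw [mem_insert, mem_Icc]; omega⟩)
      have hP : (m + 1).choose l = m.choose l + m.choose (l - 1) := by
        obtain ⟨p, rfl⟩ : ∃ p, l = p + 1 := ⟨l - 1, by omega⟩
        rw [Nat.choose_succ_succ, add_comm, Nat.add_sub_cancel]
      rw [hP]
      suffices (linkAt (m + 1) A).card + (linkAt (m + 1) B).card +
          ∑ t ∈ range s, (m - k - t).choose (l - 1 - t) ≤ m.choose (l - 1) by omega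
      rcases (linkAt (m + 1) B).eq_empty_or_nonempty with hB1 | hB1
      · have := h.card_link_of_empty (s := s) (K := ∅) (by omega) (by omega) hb hs (by omega)
          (empty_subset _) (by simp)
        rw [union_empty] at this
        rw [hB1, card_empty]
        omega
      · have hlink := h.link (by omega) hl (by omega)
        obtain ⟨b, hb1⟩ := hB1
        have hl2 := hlink.one_le_of_mem hb1
        have hmem := hlink.shB.Icc_mem hlink.subB (by omega) ⟨b, hb1⟩
        have := ih (s := 1) hlink (by omega) (by omega) le_rfl (Or.inr rfl)
          (by rw [Nat.add_sub_cancel, Icc_insert_last (by omega)]; exact hmem)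
        rw [sum_range_one, Nat.sub_zero, Nat.sub_zero, show m - (k - 1) = m - k + 1 by omega,
          choose_eq_sum_add (m - k) (l - 1) s (by omega) (by omega)] at this
        have hpos : 0 < (m - k + 1 - s).choose (l - 1 - s) := Nat.choose_pos (by omega)
        omega
    · have h1 := card_add_card_le_of_complement (m := m + 1) (by omega) h.subA h.subB h.cross
      have h2 : ∑ t ∈ range s, (m + 1 - k - t).choose (l - t) = s := by
        rw [← hm]
        simp
      omega

theorem ShiftedPair.card_add_card_lt {m k l : ℕ} {A B : Finset (Finset ℕ)}
    (h : ShiftedPair m k l A B) (hlk : l ≤ k) (hm : k + l < m) (hl4 : 4 ≤ l)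
    (hb : insert (k + 2) (Icc 1 (k - 1)) ∈ B) (hb' : skipSet k ∈ B) :
    A.card + B.card + ∑ t ∈ range 3, (m - k - t).choose (l - t) < m.choose l + 3 := by
  obtain ⟨m, rfl⟩ : ∃ m', m = m' + 1 := ⟨m - 1, by omega⟩
  rw [sum_choose_succ (by omega) (by omega), ← card_linkAt_add_card_avoidAt (m + 1) A,
    ← card_linkAt_add_card_avoidAt (m + 1) B]
  have h1 := h.avoid.card_add_card_le (s := 3) hlk (by omega) (by omega) (Or.inl (by omega))
    (mem_avoidAt.2 ⟨hb, by rw [mem_insert, mem_Icc]; omega⟩)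
  have hP : (m + 1).choose l = m.choose l + m.choose (l - 1) := by
    obtain ⟨p, rfl⟩ : ∃ p, l = p + 1 := ⟨l - 1, by omega⟩
    rw [Nat.choose_succ_succ, add_comm, Nat.add_sub_cancel]
  rw [hP]
  suffices (linkAt (m + 1) A).card + (linkAt (m + 1) B).card +
      ∑ t ∈ range 3, (m - k - t).choose (l - 1 - t) < m.choose (l - 1) by omega
  have hlink := h.link (by omega) (by omega) (by omega)
  have hN : m - (k - 1) = m - k + 1 := by omega
  have hpos : 0 < (m - k + 1 - 3).choose (l - 1 - 3) := Nat.choose_pos (by omega)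
  rcases (by omega : (linkAt (m + 1) B).card = 0 ∨ (linkAt (m + 1) B).card = 1 ∨
    2 ≤ (linkAt (m + 1) B).card) with hB1 | hB1 | hB1
  · have hsk : skipSet k ⊆ Icc 1 m := fun w hw => by
      rw [mem_skipSet] at hw; rw [mem_Icc]; omega
    have hK := card_between (V := Icc 1 m) (Y := skipSet k) (Z := {k - 1}) (l := l - 1) hsk
      (by rw [singleton_subset_iff, mem_Icc]; omega)
      (by rw [disjoint_singleton_right, mem_skipSet]; omega) (by rw [card_singleton]; omega)
    have := h.card_link_of_empty (s := 3) (K := between (Icc 1 m) (l - 1) (skipSet k) {k - 1})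
      (by omega) (by omega) hb (by omega) (by omega) (between_subset _ _ _ _)
      (fun a ha t _ => ⟨k - 1, mem_inter.2 ⟨(mem_between.1 ha).2.1 (mem_singleton_self _), by
        rw [mem_insert, mem_Icc]; omega⟩⟩)
    rw [card_union_of_disjoint (disjoint_between_of_meets (fun a ha => h.linkAt_meets ha hb'
      (by rw [mem_skipSet]; omega)) subset_rfl), hK, card_skipSet (by omega), card_singleton,
      Nat.card_Icc] at this
    have hpos : 0 < (m + 1 - 1 - k - 1).choose (l - 1 - 1) := Nat.choose_pos (by omega)
    omega
  · have hmem := hlink.shB.Icc_mem hlink.subB (by omega) (card_pos.1 (by omega))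
    have hI : Icc 1 (k - 1) ⊆ Icc 1 m := Icc_subset_Icc le_rfl (by omega)
    have hsk : skipSet k ⊆ Icc 1 m := fun w hw => by
      rw [mem_skipSet] at hw; rw [mem_Icc]; omega
    have hK1 := card_between (V := Icc 1 m) (Y := skipSet k) (Z := {k - 1}) (l := l - 1) hsk
      (by rw [singleton_subset_iff, mem_Icc]; omega)
      (by rw [disjoint_singleton_right, mem_skipSet]; omega) (by rw [card_singleton]; omega)
    have hK2 := card_between (V := Icc 1 m) (Y := Icc 1 (k - 1)) (Z := ∅) (l := l - 1) hI
      (empty_subset _) (disjoint_empty_right _) (by rw [card_empty]; omega)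
    have hpos' : 0 < (m + 1 - 1 - k - 1).choose (l - 1 - 1) := Nat.choose_pos (by omega)
    have hd1 : Disjoint (linkAt (m + 1) A) (between (Icc 1 m) (l - 1) (skipSet k) {k - 1}) :=
      disjoint_between_of_meets (fun a ha => h.linkAt_meets ha hb'
        (by rw [mem_skipSet]; omega)) subset_rfl
    have hd2 : Disjoint (linkAt (m + 1) A ∪ between (Icc 1 m) (l - 1) (skipSet k) {k - 1})
        (between (Icc 1 m) (l - 1) (Icc 1 (k - 1)) ∅) := by
      refine disjoint_union_left.2 ⟨disjoint_between_of_meets (fun a ha =>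
        hlink.cross a ha _ hmem) subset_rfl, disjoint_between (z := k - 1)
          (mem_singleton_self _) (by rw [mem_Icc]; omega)⟩
    have := card_add_le_of_disjoint (union_subset hlink.subA (between_subset _ _ _ _))
      (between_subset _ _ _ _) hd2
    rw [card_union_of_disjoint hd1, hK1, hK2, card_powersetCard, card_skipSet (by omega),
      card_singleton, card_empty, Nat.card_Icc, Nat.card_Icc,
      show m + 1 - 1 - (k - 1 + 1 - 1) - 0 = m - k + 1 by omega, Nat.sub_zero,
      choose_eq_sum_add (m - k) (l - 1) 3 (by omega) (by omega),
      show m + 1 - 1 = m by omega] at this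
    rw [Nat.add_sub_cancel] at hpos'
    omega
  · have hmem := hlink.shB.insert_mem_of_two_le hlink.subB (by omega) hB1
    have := hlink.card_add_card_le (s := 2) (by omega) (by omega) (by omega) (Or.inl (by omega))
      (by rwa [show k - 1 + 2 - 1 = k - 1 + 1 by omega])
    rw [sum_range_succ, sum_range_one, Nat.sub_zero, Nat.sub_zero, hN,
      choose_eq_sum_add (m - k) (l - 1) 3 (by omega) (by omega), Nat.add_sub_cancel] at this
    have h2 : 2 ≤ (m - k).choose (l - 1 - 1) := by
      obtain ⟨p, hp⟩ : ∃ p, m - k = p + 1 := ⟨m - k - 1, by omega⟩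
      obtain ⟨q, hq⟩ : ∃ q, l - 1 - 1 = q + 1 := ⟨l - 3, by omega⟩
      rw [hp, hq, Nat.choose_succ_succ]
      have h3 : 0 < p.choose q := Nat.choose_pos (by omega)
      have h4 : 0 < p.choose (q + 1) := Nat.choose_pos (by omega)
      rw [Nat.succ_eq_add_one]
      omega
    omega

theorem ShiftedPair.card_add_card_le_of_three {m k : ℕ} {A B : Finset (Finset ℕ)}
    (h : ShiftedPair m k 3 A B) (hk3 : 3 ≤ k) (hk4 : k ≤ 4) (hm : k + 3 ≤ m)
    (hb : skipSet k ∈ B) (ha : {k - 1, k, k + 1} ∈ A) :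
    A.card + B.card + ∑ t ∈ range 3, (m - k - t).choose (3 - t) + (m - k - 3) ≤
      m.choose 3 + 3 := by
  induction m generalizing A B with
  | zero => omega
  | succ m ih =>
    rcases Nat.lt_or_eq_of_le hm with hm | hm
    · rw [sum_choose_succ (by omega) (by omega), ← card_linkAt_add_card_avoidAt (m + 1) A,
        ← card_linkAt_add_card_avoidAt (m + 1) B]
      have h1 := ih h.avoid (by omega) (mem_avoidAt.2 ⟨hb, by rw [mem_skipSet]; omega⟩)
        (mem_avoidAt.2 ⟨ha, by simp only [mem_insert, mem_singleton]; omega⟩)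
      have hP : (m + 1).choose 3 = m.choose 3 + m.choose 2 := by
        rw [Nat.choose_succ_succ, add_comm]
      have hlink := h.link (by omega) (by omega) (by omega)
      have hS : ∑ t ∈ range 3, (m - k - t).choose (3 - 1 - t) + 4 ≤ (m - (k - 2)).choose 2 := by
        obtain ⟨a, ha⟩ : ∃ a, m = k + a + 3 := ⟨m - k - 3, by omega⟩
        rw [show m - (k - 2) = a + 3 + 1 + 1 by omega, show m - k = a + 3 by omega]
        simp only [sum_range_succ, sum_range_zero, Nat.choose_succ_succ _ 1, Nat.choose_one_right]
        simp [Nat.choose_succ_succ]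
        omega
      suffices (linkAt (m + 1) A).card + (linkAt (m + 1) B).card + (m - (k - 2)).choose 2 ≤
          m.choose 2 + 3 by rw [hP]; omega
      have hmA := fun a ha b hb hbm => h.linkAt_meets (a := a) (b := b) ha hb hbm
      have hAm : ∀ a ∈ linkAt (m + 1) A, insert (m + 1) a ∈ A := fun a ha => (mem_linkAt.1 ha).2
      have hmB : ∀ b ∈ linkAt (m + 1) B, (({k - 1, k, k + 1} : Finset ℕ) ∩ b).Nonempty := by
        intro b hb'
        obtain ⟨z, hz⟩ := h.cross _ ha _ (mem_linkAt.1 hb').2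
        rw [mem_inter] at hz
        rcases mem_insert.1 hz.2 with rfl | hz2
        · have := hz.1
          simp only [mem_insert, mem_singleton] at this
          omega
        · exact ⟨z, mem_inter.2 ⟨hz.1, hz2⟩⟩
      generalize linkAt (m + 1) A = A1 at *
      generalize linkAt (m + 1) B = B1 at *
      set D := Icc 1 (k - 2) with hD
      have hDV : D ⊆ Icc 1 m := Icc_subset_Icc le_rfl (by omega)
      have hcD : D.card = k - 2 := by rw [hD, Nat.card_Icc]; omega
      set X := A1.filter fun a => Disjoint a D with hX
      set A1' := A1.filter fun a => ¬ Disjoint a D with hA1'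
      have hsplit : A1.card = X.card + A1'.card :=
        (card_filter_add_card_filter_not (s := A1) fun a => Disjoint a D).symm
      have hXsub : ∀ a ∈ X, a ∈ ({{k - 1, k}, {k - 1, k + 1}, {k, k + 1}} :
          Finset (Finset ℕ)) := by
        intro a haX
        rw [hX, mem_filter] at haX
        have ha' := mem_powersetCard.1 (hlink.subA haX.1)
        have hge : ∀ z ∈ a, k - 1 ≤ z := fun z hz => by
          have h2 := disjoint_left.1 haX.2 hz
          have h3 := mem_Icc.1 (ha'.1 hz)
          rw [hD, mem_Icc] at h2
          omega
        have hle : ∀ q ∈ a, q ≤ k + 1 := by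
          intro q hq
          by_contra hcon
          have hqm := mem_Icc.1 (ha'.1 hq)
          have hpair : {k - 1, q} ∈ A1 := by
            obtain ⟨p, hp⟩ := card_eq_one.1
              (show (a.erase q).card = 1 by rw [card_erase_of_mem hq, ha'.2])
            have hpa : p ∈ a.erase q := by rw [hp]; exact mem_singleton_self p
            have haq : a = {p, q} := by rw [← insert_erase hq, hp, pair_comm]
            rw [mem_erase] at hpa
            by_cases hpk : p = k - 1
            · rw [← hpk, ← haq]; exact haX.1
            · have := hge p hpa.2
              have hpm := mem_Icc.1 (ha'.1 hpa.2)
              have h2 := hlink.shA a haX.1 (k - 1) p (by omega) (by omega) hpm.2 hpa.2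
                (by rw [haq, mem_insert, mem_singleton]; omega)
              rwa [haq, erase_insert (by rw [mem_singleton]; exact hpa.1)] at h2
          obtain ⟨z, hz⟩ := hmA _ hpair _ hb (by rw [mem_skipSet]; omega)
          rw [mem_inter, mem_skipSet, mem_insert, mem_singleton] at hz
          omega
        obtain ⟨p, q, hpq, rfl⟩ := card_eq_two.1 ha'.2
        have hp1 := hge p (by simp)
        have hp2 := hle p (by simp)
        have hq1 := hge q (by simp)
        have hq2 := hle q (by simp)
        have hpo : p = k - 1 ∨ p = k ∨ p = k + 1 := by omega
        have hqo : q = k - 1 ∨ q = k ∨ q = k + 1 := by omega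
        simp only [mem_insert, mem_singleton]
        rcases hpo with rfl | rfl | rfl <;> rcases hqo with rfl | rfl | rfl <;>
          first
          | exact absurd rfl hpq
          | exact Or.inl rfl
          | exact Or.inr (Or.inl rfl)
          | exact Or.inr (Or.inr rfl)
          | exact Or.inl (pair_comm _ _)
          | exact Or.inr (Or.inl (pair_comm _ _))
          | exact Or.inr (Or.inr (pair_comm _ _))
      have hK1 := card_between (V := Icc 1 m) (Y := D) (Z := ∅) (l := 2) hDV
        (empty_subset _) (disjoint_empty_right _) (by rw [card_empty]; omega)
      rw [card_empty, hcD, Nat.card_Icc, Nat.sub_zero, Nat.add_sub_cancel, Nat.sub_zero] at hK1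
      have hmeetD : ∀ a ∈ A1', (a ∩ D).Nonempty := fun a ha =>
        not_disjoint_iff_nonempty_inter.1 (mem_filter.1 ha).2
      have hA1's : A1' ⊆ powersetCard 2 (Icc 1 m) := (filter_subset _ _).trans hlink.subA
      rcases B1.eq_empty_or_nonempty with hB1 | hB1
      · have := card_add_le_of_disjoint hA1's (between_subset _ _ _ _)
          (disjoint_between_of_meets (Z := ∅) (V := Icc 1 m) (l := 2) hmeetD subset_rfl)
        rw [hK1, card_powersetCard, Nat.card_Icc, Nat.add_sub_cancel] at this
        have h3 := (card_le_card hXsub).trans (card_le_three)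
        rw [hB1, card_empty]
        omega
      · have hmem := hlink.shB.Icc_mem hlink.subB (by omega) hB1
        have hXsub2 : ∀ a ∈ X, a = {k - 1, k} ∨ a = {k - 1, k + 1} := by
          intro a ha
          have h1 := hXsub a ha
          simp only [mem_insert, mem_singleton] at h1
          rcases h1 with h1 | h1 | h1
          · exact Or.inl h1
          · exact Or.inr h1
          · obtain ⟨z, hz⟩ := hlink.cross a (mem_filter.1 ha).1 _ hmem
            rw [h1, mem_inter, mem_Icc] at hz
            simp only [mem_insert, mem_singleton] at hz
            omega
        have hX2 : X.card ≤ 2 := by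
          refine (card_le_card (t := {{k - 1, k}, {k - 1, k + 1}}) fun a ha => ?_).trans
            card_le_two
          simpa using hXsub2 a ha
        by_cases hall : ∀ b ∈ B1, D ⊆ b
        · have := card_add_le_of_disjoint hA1's (between_subset _ _ _ _)
            (disjoint_between_of_meets (Z := ∅) (V := Icc 1 m) (l := 2) hmeetD subset_rfl)
          rw [hK1, card_powersetCard, Nat.card_Icc, Nat.add_sub_cancel] at this
          suffices X.card + B1.card ≤ 3 by omega
          have hBsub : ∀ b ∈ B1, b = insert (k - 1) D ∨ b = insert k D ∨ b = insert (k + 1) D := by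
            intro b hb1
            have hDb := hall b hb1
            obtain ⟨z, hz⟩ := hmB b hb1
            rw [mem_inter] at hz
            have hzD : z ∉ D := by
              rw [hD, mem_Icc]
              have := hz.1
              simp only [mem_insert, mem_singleton] at this
              omega
            have hins : insert z D = b := eq_of_subset_of_card_le (insert_subset hz.2 hDb) (by
              rw [card_insert_of_notMem hzD, hcD, (mem_powersetCard.1 (hlink.subB hb1)).2]; omega)
            have := hz.1
            simp only [mem_insert, mem_singleton] at this
            rw [← hins]
            rcases this with rfl | rfl | rfl <;> simp
          have hdisj : ∀ p q, q ∉ D → q ≠ k - 1 → q ≠ p → insert q D ∈ B1 → p ∉ D →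
              {k - 1, p} ∉ X := by
            intro p q hqD hq1 hqp hq hpD hp
            obtain ⟨z, hz⟩ := hlink.cross _ (mem_filter.1 hp).1 _ hq
            simp only [mem_inter, mem_insert, mem_singleton] at hz
            rcases hz with ⟨rfl | rfl, rfl | hz⟩
            · exact hq1 rfl
            · rw [hD, mem_Icc] at hz; omega
            · exact hqp rfl
            · exact hpD hz
          have hkD : k ∉ D := by rw [hD, mem_Icc]; omega
          have hkD' : k + 1 ∉ D := by rw [hD, mem_Icc]; omega
          have hd1 := hdisj (k + 1) k hkD (by omega) (by omega)
          have hd2 := hdisj k (k + 1) hkD' (by omega) (by omega)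
          by_cases c1 : insert k D ∈ B1 <;> by_cases c2 : insert (k + 1) D ∈ B1
          · have hx : X = ∅ := eq_empty_of_forall_notMem fun a ha => by
              rcases hXsub2 a ha with rfl | rfl
              · exact hd2 c2 hkD ha
              · exact hd1 c1 hkD' ha
            have := (card_le_card (s := B1) (t := {insert (k - 1) D, insert k D,
              insert (k + 1) D}) fun b hb => by simpa using hBsub b hb).trans card_le_three
            rw [hx, card_empty]; omega
          · have hx := card_le_card (s := X) (t := {{k - 1, k}}) fun a ha => by
              rcases hXsub2 a ha with rfl | rfl
              · simp
              · exact absurd ha (hd1 c1 hkD')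
            have := (card_le_card (s := B1) (t := {insert (k - 1) D, insert k D}) fun b hb => by
              rcases hBsub b hb with rfl | rfl | rfl
              · simp
              · simp
              · exact absurd hb c2).trans card_le_two
            rw [card_singleton] at hx; omega
          · have hx := card_le_card (s := X) (t := {{k - 1, k + 1}}) fun a ha => by
              rcases hXsub2 a ha with rfl | rfl
              · exact absurd ha (hd2 c2 hkD)
              · simp
            have := (card_le_card (s := B1) (t := {insert (k - 1) D, insert (k + 1) D})
              fun b hb => by
              rcases hBsub b hb with rfl | rfl | rfl
              · simp
              · exact absurd hb c1
              · simp).trans card_le_two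
            rw [card_singleton] at hx; omega
          · have := card_le_card (s := B1) (t := {insert (k - 1) D}) fun b hb => by
              rcases hBsub b hb with rfl | rfl | rfl
              · simp
              · exact absurd hb c1
              · exact absurd hb c2
            rw [card_singleton] at this; omega
        · push Not at hall
          obtain ⟨b, hb1, hnb⟩ := hall
          obtain ⟨z, hz, hzb⟩ := not_subset.1 hnb
          have hc := hlink.shB.skipSet_mem hlink.subB (by omega) (by omega) hb1 (z := z)
            (by rw [hD, mem_Icc] at hz; rw [mem_Icc]; omega) hzb
          have hK2 := card_between (V := Icc 1 m) (Y := skipSet (k - 1)) (Z := {k - 2}) (l := 2)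
            (fun w hw => by rw [mem_skipSet] at hw; rw [mem_Icc]; omega)
            (by rw [singleton_subset_iff, mem_Icc]; omega)
            (by rw [disjoint_singleton_right, mem_skipSet]; omega) (by rw [card_singleton]; omega)
          rw [card_singleton, card_skipSet (by omega), Nat.card_Icc, Nat.choose_one_right] at hK2
          have hd1 : Disjoint A1' (between (Icc 1 m) 2 (skipSet (k - 1)) {k - 2}) :=
            disjoint_between_of_meets (fun a ha => hlink.cross a (mem_filter.1 ha).1 _ hc)
              subset_rfl
          have hd2 : Disjoint (A1' ∪ between (Icc 1 m) 2 (skipSet (k - 1)) {k - 2})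
              (between (Icc 1 m) 2 D ∅) :=
            disjoint_union_left.2 ⟨disjoint_between_of_meets hmeetD subset_rfl,
              disjoint_between (z := k - 2) (mem_singleton_self _) (by rw [hD, mem_Icc]; omega)⟩
          have := card_add_le_of_disjoint (union_subset hA1's (between_subset _ _ _ _))
            (between_subset _ _ _ _) hd2
          rw [card_union_of_disjoint hd1, hK1, hK2, card_powersetCard, Nat.card_Icc,
            Nat.add_sub_cancel] at this
          have hBk : B1 ⊆ powersetCard (k - 1) (Icc 1 k) := by
            intro b' hb'
            have hb'' := mem_powersetCard.1 (hlink.subB hb')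
            refine mem_powersetCard.2 ⟨fun w hw => ?_, hb''.2⟩
            by_contra hcon
            have hw1 := mem_Icc.1 (hb''.1 hw)
            rw [mem_Icc] at hcon
            have h2 := hlink.shB.insert_mem hlink.subB hb' hw (q := k + 1) (by omega) (by omega)
              (by omega)
            have h3 := hlink.closed _ hc {k - 1, k} (fun w hw => by
              simp only [mem_insert, mem_singleton] at hw
              rw [mem_skipSet]; omega) (card_pair (by omega))
            obtain ⟨z, hz⟩ := hlink.cross _ h3 _ h2
            simp only [mem_inter, mem_insert, mem_singleton, mem_Icc] at hz
            omega
          have hBc := card_le_card hBk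
          have hkk : k.choose (k - 1) = k := by
            obtain ⟨p, rfl⟩ : ∃ p, k = p + 1 := ⟨k - 1, by omega⟩
            simp
          rw [card_powersetCard, Nat.card_Icc, Nat.add_sub_cancel, hkk] at hBc
          omega
    · have h1 := card_add_card_le_of_complement (m := m + 1) (by omega) h.subA h.subB h.cross
      have h2 : ∑ t ∈ range 3, (m + 1 - k - t).choose (3 - t) = 3 := by
        rw [← hm]
        simp
      omega

/-- The members of `F` that the shift replacing `j` by `i` moves. -/
def movable (i j : ℕ) (F : Finset (Finset ℕ)) : Finset (Finset ℕ) :=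
  F.filter fun A => j ∈ A ∧ i ∉ A ∧ insert i (A.erase j) ∉ F

/-- The shift replacing `j` by `i`. -/
def shift (i j : ℕ) (F : Finset (Finset ℕ)) : Finset (Finset ℕ) :=
  (F \ movable i j F) ∪ (movable i j F).image fun A => insert i (A.erase j)

lemma mem_movable {i j : ℕ} {F : Finset (Finset ℕ)} {A : Finset ℕ} :
    A ∈ movable i j F ↔ A ∈ F ∧ j ∈ A ∧ i ∉ A ∧ insert i (A.erase j) ∉ F := by
  simp [movable]

lemma insert_erase_insert_erase {i j : ℕ} {A : Finset ℕ} (hj : j ∈ A) (hi : i ∉ A) :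
    insert j ((insert i (A.erase j)).erase i) = A := by
  rw [erase_insert (fun h => hi (mem_of_mem_erase h)), insert_erase hj]

lemma mem_shift {i j : ℕ} {F : Finset (Finset ℕ)} {A : Finset ℕ} :
    A ∈ shift i j F ↔ (A ∈ F ∧ (j ∈ A → i ∉ A → insert i (A.erase j) ∈ F)) ∨
      (i ∈ A ∧ j ∉ A ∧ A ∉ F ∧ insert j (A.erase i) ∈ F) := by
  rw [shift, mem_union, mem_sdiff, mem_movable, mem_image]
  constructor
  · rintro (h | ⟨B, hB, rfl⟩)
    · exact Or.inl ⟨h.1, fun h1 h2 => by_contra fun h3 => h.2 ⟨h.1, h1, h2, h3⟩⟩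
    · rw [mem_movable] at hB
      refine Or.inr ⟨mem_insert_self _ _, ?_, hB.2.2.2, ?_⟩
      · rw [mem_insert]
        rintro (h | h)
        · exact hB.2.2.1 (h ▸ hB.2.1)
        · exact notMem_erase _ _ h
      · rw [insert_erase_insert_erase hB.2.1 hB.2.2.1]; exact hB.1
  · rintro (h | ⟨hi, hj, hA, h⟩)
    · exact Or.inl ⟨h.1, fun h1 => h1.2.2.2 (h.2 h1.2.1 h1.2.2.1)⟩
    · have hA' := insert_erase_insert_erase hi hj
      refine Or.inr ⟨_, mem_movable.2 ⟨h, mem_insert_self _ _, ?_, by rwa [hA']⟩, hA'⟩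
      rw [mem_insert]
      rintro (h | h)
      · exact hj (h ▸ hi)
      · exact notMem_erase _ _ h

lemma injOn_shift (i j : ℕ) (F : Finset (Finset ℕ)) :
    Set.InjOn (fun A : Finset ℕ => insert i (A.erase j)) (movable i j F : Set (Finset ℕ)) := by
  intro A hA B hB h
  rw [mem_coe, mem_movable] at hA hB
  rw [← insert_erase_insert_erase hA.2.1 hA.2.2.1, ← insert_erase_insert_erase hB.2.1 hB.2.2.1]
  exact congrArg (fun C : Finset ℕ => insert j (C.erase i)) h

lemma disjoint_shift (i j : ℕ) (F : Finset (Finset ℕ)) :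
    Disjoint (F \ movable i j F) ((movable i j F).image fun A => insert i (A.erase j)) := by
  refine disjoint_left.2 fun A hA hA' => ?_
  obtain ⟨B, hB, rfl⟩ := mem_image.1 hA'
  exact (mem_movable.1 hB).2.2.2 (mem_sdiff.1 hA).1

lemma card_shift (i j : ℕ) (F : Finset (Finset ℕ)) : (shift i j F).card = F.card := by
  rw [shift, card_union_of_disjoint (disjoint_shift i j F), card_image_of_injOn (injOn_shift i j F),
    card_sdiff_add_card_eq_card (show movable i j F ⊆ F from filter_subset _ _)]

lemma shift_subset {i j k : ℕ} {V : Finset ℕ} {F : Finset (Finset ℕ)} (hi : i ∈ V)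
    (hF : F ⊆ powersetCard k V) : shift i j F ⊆ powersetCard k V := by
  intro A hA
  rcases mem_shift.1 hA with h | ⟨h1, h2, -, h4⟩
  · exact hF h.1
  · have h5 := mem_powersetCard.1 (hF h4)
    have hc : (insert j (A.erase i)).card = A.card := by
      rw [card_insert_of_notMem (fun h => h2 (mem_of_mem_erase h)), card_erase_add_one h1]
    refine mem_powersetCard.2 ⟨fun z hz => ?_, by rw [← hc]; exact h5.2⟩
    by_cases hzi : z = i
    · rwa [hzi]
    · exact h5.1 (mem_insert_of_mem (mem_erase.2 ⟨hzi, hz⟩))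

lemma CrossInt.symm {P Q : Finset (Finset ℕ)} (h : CrossInt P Q) : CrossInt Q P :=
  fun a ha b hb => by rw [inter_comm]; exact h b hb a ha

lemma crossInt_shift {i j : ℕ} {P Q : Finset (Finset ℕ)} (h : CrossInt P Q) :
    CrossInt (shift i j P) (shift i j Q) := by
  have key : ∀ P Q : Finset (Finset ℕ), CrossInt P Q → ∀ A B : Finset ℕ, i ∈ A → j ∉ A →
      insert j (A.erase i) ∈ P → B ∈ Q → (j ∈ B → i ∉ B → insert i (B.erase j) ∈ Q) →
      (A ∩ B).Nonempty := by
    intro P Q h A B hi hj hA hB hB'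
    by_cases hiB : i ∈ B
    · exact ⟨i, mem_inter.2 ⟨hi, hiB⟩⟩
    · by_cases hjB : j ∈ B
      · obtain ⟨z, hz⟩ := h _ hA _ (hB' hjB hiB)
        simp only [mem_inter, mem_insert, mem_erase] at hz
        refine ⟨z, mem_inter.2 ?_⟩
        rcases hz with ⟨rfl | hz1, rfl | hz2⟩
        · exact absurd hi hj
        · exact absurd rfl hz2.1
        · exact absurd rfl hz1.1
        · exact ⟨hz1.2, hz2.2⟩
      · obtain ⟨z, hz⟩ := h _ hA _ hB
        simp only [mem_inter, mem_insert, mem_erase] at hz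
        refine ⟨z, mem_inter.2 ⟨?_, hz.2⟩⟩
        rcases hz.1 with rfl | hz1
        · exact absurd hz.2 hjB
        · exact hz1.2
  intro A hA B hB
  rcases mem_shift.1 hA with hA | ⟨h1, h2, -, h4⟩
  · rcases mem_shift.1 hB with hB | ⟨h5, h6, -, h8⟩
    · exact h A hA.1 B hB.1
    · rw [inter_comm]
      exact key Q P h.symm B A h5 h6 h8 hA.1 hA.2
  · rcases mem_shift.1 hB with hB | ⟨h5, h6, -, h8⟩
    · exact key P Q h A B h1 h2 h4 hB.1 hB.2
    · exact ⟨i, mem_inter.2 ⟨h1, h5⟩⟩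

/-- The sum of all elements of all members. -/
def weight (F : Finset (Finset ℕ)) : ℕ := ∑ A ∈ F, ∑ a ∈ A, a

lemma weight_shift_le {i j : ℕ} (hij : i < j) (F : Finset (Finset ℕ)) :
    weight (shift i j F) + (movable i j F).card ≤ weight F := by
  rw [weight, shift, sum_union (disjoint_shift i j F), sum_image (injOn_shift i j F), weight,
    ← sum_sdiff (filter_subset _ _ : movable i j F ⊆ F), add_assoc, card_eq_sum_ones,
    ← sum_add_distrib]
  refine Nat.add_le_add_left (sum_le_sum fun A hA => ?_) _
  rw [mem_movable] at hA
  rw [sum_insert (fun h => hA.2.2.1 (mem_of_mem_erase h)), ← add_sum_erase A (fun a => a) hA.2.1]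
  omega

lemma shift_eq_self {i j : ℕ} {F : Finset (Finset ℕ)} (h : (movable i j F).card = 0) :
    shift i j F = F := by
  rw [shift, card_eq_zero.1 h]; simp

lemma mem_of_shift_eq_self {i j : ℕ} {F : Finset (Finset ℕ)} (h : shift i j F = F) {A : Finset ℕ}
    (hA : A ∈ F) (hj : j ∈ A) (hi : i ∉ A) : insert i (A.erase j) ∈ F := by
  rw [← h, mem_shift] at hA
  rcases hA with h1 | h1
  · exact h1.2 hj hi
  · exact absurd hj h1.2.1

lemma shiftedOn_of_shift_eq_self {m : ℕ} {F : Finset (Finset ℕ)}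
    (h : ∀ i j, 1 ≤ i → i < j → j ≤ m → shift i j F = F) : ShiftedOn m F :=
  fun _ hR i j h1 h2 h3 hj hi => mem_of_shift_eq_self (h i j h1 h2 h3) hR hj hi

/-- Repeated simultaneous shifting inside a class of pairs of families ends at a pair which
every shift either fixes or takes out of the class. -/
lemma exists_shift_stable (φ : Finset (Finset ℕ) → Finset (Finset ℕ) → Prop)
    {P Q : Finset (Finset ℕ)} (h : φ P Q) : ∃ P' Q', φ P' Q' ∧ ∀ i j, i < j →
      φ (shift i j P') (shift i j Q') → shift i j P' = P' ∧ shift i j Q' = Q' := by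
  induction hw : weight P + weight Q using Nat.strong_induction_on generalizing P Q with
  | _ w ih =>
    by_cases hst : ∀ i j, i < j →
      φ (shift i j P) (shift i j Q) → shift i j P = P ∧ shift i j Q = Q
    · exact ⟨P, Q, h, hst⟩
    · push Not at hst
      obtain ⟨i, j, hij, hφ, hne⟩ := hst
      have h1 := weight_shift_le hij P
      have h2 := weight_shift_le hij Q
      refine ih _ ?_ hφ rfl
      by_contra hcon
      exact hne (shift_eq_self (by omega)) (shift_eq_self (by omega))

lemma exists_perm_image_eq_Icc (V : Finset ℕ) :
    ∃ σ : Equiv.Perm ℕ, (V.image fun x => σ x) = Icc 1 V.card := by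
  obtain ⟨σ, h, -⟩ := exists_perm_image_eq (V ∪ Icc 1 V.card) V (Icc 1 V.card)
    subset_union_left subset_union_right (by simp)
  exact ⟨σ, h⟩

/-- Apply a permutation to all members of a family. -/
def permute (σ : Equiv.Perm ℕ) (F : Finset (Finset ℕ)) : Finset (Finset ℕ) :=
  F.image fun s => s.image fun x => σ x

lemma image_perm_injective (σ : Equiv.Perm ℕ) :
    Function.Injective fun s : Finset ℕ => s.image fun x => σ x :=
  image_injective σ.injective

lemma card_permute (σ : Equiv.Perm ℕ) (F : Finset (Finset ℕ)) :
    (permute σ F).card = F.card := card_image_of_injective _ (image_perm_injective σ)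

lemma image_mem_permute {σ : Equiv.Perm ℕ} {F : Finset (Finset ℕ)} {A : Finset ℕ} :
    (A.image fun x => σ x) ∈ permute σ F ↔ A ∈ F :=
  (image_perm_injective σ).mem_finset_image

lemma crossInt_permute {P Q : Finset (Finset ℕ)} (h : CrossInt P Q) (σ : Equiv.Perm ℕ) :
    CrossInt (permute σ P) (permute σ Q) := by
  intro a ha b hb
  obtain ⟨a, ha', rfl⟩ := mem_image.1 ha
  obtain ⟨b, hb', rfl⟩ := mem_image.1 hb
  rw [← image_inter _ _ σ.injective]
  exact (h a ha' b hb').image _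

lemma permute_subset {k : ℕ} {V : Finset ℕ} {F : Finset (Finset ℕ)}
    (hF : F ⊆ powersetCard k V) (σ : Equiv.Perm ℕ) :
    permute σ F ⊆ powersetCard k (V.image fun x => σ x) := by
  intro a ha
  obtain ⟨a, ha', rfl⟩ := mem_image.1 ha
  have := mem_powersetCard.1 (hF ha')
  exact mem_powersetCard.2 ⟨image_subset_image this.1, by
    rw [card_image_of_injective _ σ.injective, this.2]⟩

lemma ShiftedPair.of_crossInt {m r : ℕ} {P Q : Finset (Finset ℕ)}
    (hP : P ⊆ powersetCard r (Icc 1 m)) (hQ : Q ⊆ powersetCard r (Icc 1 m))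
    (hc : CrossInt P Q) (sP : ShiftedOn m P) (sQ : ShiftedOn m Q) :
    ShiftedPair m r r (P ∪ Q) (P ∩ Q) where
  subA := union_subset hP hQ
  subB := inter_subset_left.trans hP
  shA := fun R hR i j h1 h2 h3 h4 h5 => by
    rcases mem_union.1 hR with h | h
    · exact mem_union_left _ (sP R h i j h1 h2 h3 h4 h5)
    · exact mem_union_right _ (sQ R h i j h1 h2 h3 h4 h5)
  shB := fun R hR i j h1 h2 h3 h4 h5 => mem_inter.2
    ⟨sP R (mem_inter.1 hR).1 i j h1 h2 h3 h4 h5, sQ R (mem_inter.1 hR).2 i j h1 h2 h3 h4 h5⟩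
  cross := fun a ha b hb => by
    rcases mem_union.1 ha with h | h
    · exact hc a h b (mem_inter.1 hb).2
    · exact hc.symm a h b (mem_inter.1 hb).1
  closed := fun b hb a hab ha => by
    rw [eq_of_subset_of_card_le hab
      (by rw [ha, (mem_powersetCard.1 (hP (mem_inter.1 hb).1)).2])]
    exact mem_union_left _ (mem_inter.1 hb).1

/-- Cross-intersecting `r`-uniform families can be shifted simultaneously. -/
lemma CrossInt.exists_shifted {r : ℕ} {V : Finset ℕ} {P Q : Finset (Finset ℕ)}
    (hc : CrossInt P Q) (hP : P ⊆ powersetCard r V) (hQ : Q ⊆ powersetCard r V) :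
    ∃ P' Q', P' ⊆ powersetCard r (Icc 1 V.card) ∧ Q' ⊆ powersetCard r (Icc 1 V.card) ∧
      CrossInt P' Q' ∧ ShiftedOn V.card P' ∧ ShiftedOn V.card Q' ∧ P'.card = P.card ∧
      Q'.card = Q.card := by
  obtain ⟨σ, hσ⟩ := exists_perm_image_eq_Icc V
  obtain ⟨P', Q', ⟨h1, h2, h3, h4, h5⟩, hst⟩ := exists_shift_stable (fun P' Q' =>
    P' ⊆ powersetCard r (Icc 1 V.card) ∧ Q' ⊆ powersetCard r (Icc 1 V.card) ∧
      CrossInt P' Q' ∧ P'.card = P.card ∧ Q'.card = Q.card) (P := permute σ P) (Q := permute σ Q)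
    ⟨hσ ▸ permute_subset hP σ, hσ ▸ permute_subset hQ σ, crossInt_permute hc σ, card_permute _ _,
      card_permute _ _⟩
  have hst' : ∀ i j, 1 ≤ i → i < j → j ≤ V.card → shift i j P' = P' ∧ shift i j Q' = Q' :=
    fun i j hi hij hj => by
      have hiV : i ∈ Icc 1 V.card := mem_Icc.2 (by omega)
      exact hst i j hij ⟨shift_subset hiV h1, shift_subset hiV h2, crossInt_shift h3,
        by rw [card_shift, h4], by rw [card_shift, h5]⟩
  exact ⟨P', Q', h1, h2, h3,
    shiftedOn_of_shift_eq_self fun i j hi hij hj => (hst' i j hi hij hj).1,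
    shiftedOn_of_shift_eq_self fun i j hi hij hj => (hst' i j hi hij hj).2, h4, h5⟩

theorem CrossInt.card_add_card_le {r s : ℕ} {V : Finset ℕ} {P Q : Finset (Finset ℕ)}
    (hc : CrossInt P Q) (hP : P ⊆ powersetCard r V) (hQ : Q ⊆ powersetCard r V) (hr : 1 ≤ r)
    (hV : 2 * r ≤ V.card) (hs : s = 1 ∨ s = 2 ∧ 3 ≤ r) (hsP : s ≤ P.card) (hsQ : s ≤ Q.card) :
    P.card + Q.card + ∑ t ∈ range s, (V.card - r - t).choose (r - t) ≤ V.card.choose r + s := by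
  obtain ⟨P', Q', h1, h2, h3, h4, h5, h6, h7⟩ := hc.exists_shifted hP hQ
  have hp := ShiftedPair.of_crossInt h1 h2 h3 h4 h5
  rw [← h6, ← h7, ← card_union_add_card_inter]
  refine hp.card_add_card_le le_rfl (by omega) (by omega) (by omega) ?_
  rcases hs with rfl | ⟨rfl, hr⟩
  · rw [Nat.add_sub_cancel, Icc_insert_last hr, mem_inter]
    exact ⟨h4.Icc_mem h1 hr (card_pos.1 (by omega)), h5.Icc_mem h2 hr (card_pos.1 (by omega))⟩
  · rw [show r + 2 - 1 = r + 1 by omega, mem_inter]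
    exact ⟨h4.insert_mem_of_two_le h1 (by omega) (by omega),
      h5.insert_mem_of_two_le h2 (by omega) (by omega)⟩

lemma card_eq_add_four_parts (i j : ℕ) (F : Finset (Finset ℕ)) :
    F.card = (linkAt j (linkAt i F)).card + (avoidAt j (linkAt i F)).card +
      (linkAt j (avoidAt i F)).card + (avoidAt j (avoidAt i F)).card := by
  rw [← card_linkAt_add_card_avoidAt i F, ← card_linkAt_add_card_avoidAt j (linkAt i F),
    ← card_linkAt_add_card_avoidAt j (avoidAt i F)]
  ring

lemma mem_avoidAt_linkAt {i j : ℕ} {F : Finset (Finset ℕ)} {R : Finset ℕ} :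
    R ∈ avoidAt j (linkAt i F) ↔ insert i R ∈ F ∧ i ∉ R ∧ j ∉ R := by
  rw [mem_avoidAt, mem_linkAt]; tauto

lemma mem_linkAt_avoidAt {i j : ℕ} (hij : i ≠ j) {F : Finset (Finset ℕ)} {R : Finset ℕ} :
    R ∈ linkAt j (avoidAt i F) ↔ insert j R ∈ F ∧ i ∉ R ∧ j ∉ R := by
  rw [mem_linkAt, mem_avoidAt, mem_insert]; tauto

lemma mem_avoidAt_avoidAt {i j : ℕ} {F : Finset (Finset ℕ)} {R : Finset ℕ} :
    R ∈ avoidAt j (avoidAt i F) ↔ R ∈ F ∧ i ∉ R ∧ j ∉ R := by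
  rw [mem_avoidAt, mem_avoidAt]; tauto

lemma crossInt_links {i j : ℕ} (hij : i ≠ j) {P Q : Finset (Finset ℕ)} (h : CrossInt P Q) :
    CrossInt (avoidAt j (linkAt i P)) (linkAt j (avoidAt i Q)) := by
  intro a ha b hb
  rw [mem_avoidAt_linkAt] at ha
  rw [mem_linkAt_avoidAt hij] at hb
  obtain ⟨z, hz⟩ := h _ ha.1 _ hb.1
  simp only [mem_inter, mem_insert] at hz
  refine ⟨z, mem_inter.2 ?_⟩
  rcases hz with ⟨rfl | h1, rfl | h2⟩
  · exact absurd rfl hij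
  · exact absurd h2 hb.2.1
  · exact absurd h1 ha.2.2
  · exact ⟨h1, h2⟩

lemma linkAt_linkAt_subset {i j k : ℕ} {V : Finset ℕ} {F : Finset (Finset ℕ)}
    (hF : F ⊆ powersetCard k V) :
    linkAt j (linkAt i F) ⊆ powersetCard (k - 2) ((V.erase i).erase j) :=
  linkAt_subset (linkAt_subset hF)

lemma avoidAt_linkAt_subset {i j k : ℕ} {V : Finset ℕ} {F : Finset (Finset ℕ)}
    (hF : F ⊆ powersetCard k V) :
    avoidAt j (linkAt i F) ⊆ powersetCard (k - 1) ((V.erase i).erase j) :=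
  avoidAt_subset (linkAt_subset hF)

lemma linkAt_avoidAt_subset {i j k : ℕ} {V : Finset ℕ} {F : Finset (Finset ℕ)}
    (hF : F ⊆ powersetCard k V) :
    linkAt j (avoidAt i F) ⊆ powersetCard (k - 1) ((V.erase i).erase j) :=
  linkAt_subset (avoidAt_subset hF)

/-- A common element of a shifted family outside `{i, j}` is common to the family. -/
lemma mem_of_forall_mem_shift {i j z : ℕ} {P : Finset (Finset ℕ)} (hi : z ≠ i)
    (h : ∀ A ∈ shift i j P, z ∈ A) {A : Finset ℕ} (hA : A ∈ P) : z ∈ A := by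
  by_cases hm : A ∈ shift i j P
  · exact h A hm
  · have : A ∈ movable i j P := by
      by_contra hcon
      exact hm (mem_union_left _ (mem_sdiff.2 ⟨hA, hcon⟩))
    have := h _ (mem_union_right _ (mem_image_of_mem _ this))
    rw [mem_insert, mem_erase] at this
    tauto

lemma mem_shift_of_notMem {i j : ℕ} {P : Finset (Finset ℕ)} {A : Finset ℕ} (hA : A ∈ P)
    (hj : j ∉ A) : A ∈ shift i j P :=
  mem_shift.2 (Or.inl ⟨hA, fun h => absurd h hj⟩)

/-- Cross-intersecting graphs: either one is empty or their sizes are jointly small. -/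
lemma card_pairs_le {W : Finset ℕ} {P Q : Finset (Finset ℕ)} (hW : 4 ≤ W.card)
    (hc : CrossInt P Q) (hP : P ⊆ powersetCard 2 W) (hQ : Q ⊆ powersetCard 2 W) :
    P.card + Q.card ≤ W.card.choose 2 ∧
      (P.Nonempty → Q.Nonempty → P.card + Q.card + (W.card - 2).choose 2 ≤
        W.card.choose 2 + 1) := by
  have h1 : P.Nonempty → Q.Nonempty → P.card + Q.card + (W.card - 2).choose 2 ≤
      W.card.choose 2 + 1 := fun hp hq => by
    have := hc.card_add_card_le (s := 1) hP hQ (by omega) (by omega) (Or.inl rfl)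
      (card_pos.2 hp) (card_pos.2 hq)
    simpa using this
  refine ⟨?_, h1⟩
  have hp := card_le_card hP
  have hq := card_le_card hQ
  rw [card_powersetCard] at hp hq
  rcases P.eq_empty_or_nonempty with rfl | hP'
  · simpa using hq
  rcases Q.eq_empty_or_nonempty with rfl | hQ'
  · simpa using hp
  have := h1 hP' hQ'
  have hpos : 0 < (W.card - 2).choose 2 := Nat.choose_pos (by omega)
  omega

/-- Sets of size three all of which meet the pair `{i, j}`. -/
lemma card_add_card_lt_of_meet_pair {m i j : ℕ} {V : Finset ℕ} {P Q : Finset (Finset ℕ)}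
    (hV : V.card = m) (hc : CrossInt P Q) (hP : P ⊆ powersetCard 3 V) (hQ : Q ⊆ powersetCard 3 V)
    (hm : 8 ≤ m) (hi : i ∈ V) (hj : j ∈ V) (hij : i ≠ j) (hPc : m - 1 ≤ P.card)
    (hQc : m - 1 ≤ Q.card) (hz : ∀ z ∈ V, ∃ R ∈ P ∪ Q, z ∉ R)
    (hmeet : ∀ R ∈ P ∪ Q, i ∈ R ∨ j ∈ R) :
    P.card + Q.card + ∑ t ∈ range 3, (m - 3 - t).choose (3 - t) < m.choose 3 + 3 := by
  set W := (V.erase i).erase j with hW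
  have hcW : W.card = m - 2 := by
    rw [hW, card_erase_of_mem (mem_erase.2 ⟨hij.symm, hj⟩), card_erase_of_mem hi, hV]; omega
  have hemp : ∀ R ⊆ P ∪ Q, avoidAt j (avoidAt i R) = ∅ := fun R hR =>
    eq_empty_of_forall_notMem fun A hA => by
      rw [mem_avoidAt_avoidAt] at hA
      have := hmeet A (hR hA.1)
      tauto
  have dP := card_eq_add_four_parts i j P
  have dQ := card_eq_add_four_parts i j Q
  rw [hemp P subset_union_left, card_empty] at dP
  rw [hemp Q subset_union_right, card_empty] at dQ
  have hP2 := card_le_card (linkAt_linkAt_subset (i := i) (j := j) hP)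
  have hQ2 := card_le_card (linkAt_linkAt_subset (i := i) (j := j) hQ)
  rw [card_powersetCard, ← hW, hcW, Nat.choose_one_right] at hP2 hQ2
  obtain ⟨h1, h1'⟩ := card_pairs_le (W := W) (by omega) (crossInt_links hij hc)
    (avoidAt_linkAt_subset hP) (linkAt_avoidAt_subset hQ)
  obtain ⟨h2, h2'⟩ := card_pairs_le (W := W) (by omega) (crossInt_links hij hc.symm)
    (avoidAt_linkAt_subset hQ) (linkAt_avoidAt_subset hP)
  have hcontains : ∀ z ∈ V, ∀ A B : Finset (Finset ℕ), (A = ∅ → ∀ R ∈ P, z ∈ R) →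
      (B = ∅ → ∀ R ∈ Q, z ∈ R) → A.Nonempty ∨ B.Nonempty := by
    intro z hzV A B hA hB
    by_contra! hcon
    obtain ⟨R, hR, hzR⟩ := hz z hzV
    rcases mem_union.1 hR with h | h
    · exact hzR (hA hcon.1 R h)
    · exact hzR (hB hcon.2 R h)
  have hnoi : ∀ X ⊆ P ∪ Q, linkAt j (avoidAt i X) = ∅ → ∀ R ∈ X, i ∈ R := by
    intro X hX he R hR
    by_contra hiR
    have hjR := (hmeet R (hX hR)).resolve_left hiR
    have : R.erase j ∈ linkAt j (avoidAt i X) := by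
      rw [mem_linkAt_avoidAt hij, insert_erase hjR]
      exact ⟨hR, fun h => hiR (mem_of_mem_erase h), notMem_erase _ _⟩
    rw [he] at this
    exact notMem_empty _ this
  have hnoj : ∀ X ⊆ P ∪ Q, avoidAt j (linkAt i X) = ∅ → ∀ R ∈ X, j ∈ R := by
    intro X hX he R hR
    by_contra hjR
    have hiR := (hmeet R (hX hR)).resolve_right hjR
    have : R.erase i ∈ avoidAt j (linkAt i X) := by
      rw [mem_avoidAt_linkAt, insert_erase hiR]
      exact ⟨hR, notMem_erase _ _, fun h => hjR (mem_of_mem_erase h)⟩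
    rw [he] at this
    exact notMem_empty _ this
  have hI := hcontains i hi _ _ (hnoi P subset_union_left) (hnoi Q subset_union_right)
  have hJ := hcontains j hj _ _ (hnoj P subset_union_left) (hnoj Q subset_union_right)
  have hp : ((avoidAt j (linkAt i P)).card = 0 → (linkAt j (avoidAt i P)).card ≠ 0) := by omega
  have hq : ((avoidAt j (linkAt i Q)).card = 0 → (linkAt j (avoidAt i Q)).card ≠ 0) := by omega
  simp only [← card_pos] at hI hJ h1' h2'
  obtain ⟨a, rfl⟩ : ∃ a, m = a + 8 := ⟨m - 8, by omega⟩
  rw [show a + 8 - 2 = a + 6 by omega] at hcW hP2 hQ2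
  rw [hcW] at h1 h2 h1' h2'
  rw [show a + 6 - 2 = a + 4 by omega] at h1' h2'
  have e1 : ∑ t ∈ range 3, (a + 8 - 3 - t).choose (3 - t) =
      (a + 5).choose 3 + (a + 4).choose 2 + (a + 3) := by
    simp [sum_range_succ]
  have e2 : (a + 8).choose 3 = (a + 7).choose 2 + (a + 7).choose 3 := Nat.choose_succ_succ _ _
  have e3 : (a + 7).choose 3 = (a + 6).choose 2 + (a + 6).choose 3 := Nat.choose_succ_succ _ _
  have e4 : (a + 6).choose 3 = (a + 5).choose 2 + (a + 5).choose 3 := Nat.choose_succ_succ _ _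
  have e5 : (a + 7).choose 2 = (a + 6) + (a + 6).choose 2 := by
    rw [Nat.choose_succ_succ, Nat.choose_one_right]
  have e6 : (a + 5).choose 2 = (a + 4) + (a + 4).choose 2 := by
    rw [Nat.choose_succ_succ, Nat.choose_one_right]
  have e7 : (a + 4).choose 2 = (a + 3) + (a + 3).choose 2 := by
    rw [Nat.choose_succ_succ, Nat.choose_one_right]
  have e8 : (a + 3).choose 2 = (a + 2) + (a + 2).choose 2 := by
    rw [Nat.choose_succ_succ, Nat.choose_one_right]
  rw [e1, e2, e3, e4, e5]
  have hor : (0 < (avoidAt j (linkAt i P)).card ∧ 0 < (linkAt j (avoidAt i Q)).card) ∨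
      (0 < (avoidAt j (linkAt i Q)).card ∧ 0 < (linkAt j (avoidAt i P)).card) := by omega
  rcases hor with ⟨c1, c2⟩ | ⟨c1, c2⟩
  · have := h1' c1 c2; omega
  · have := h2' c1 c2; omega

theorem CrossInt.card_add_card_lt {m r : ℕ} {V : Finset ℕ} {P Q : Finset (Finset ℕ)}
    (hV : V.card = m) (hc : CrossInt P Q) (hP : P ⊆ powersetCard r V)
    (hQ : Q ⊆ powersetCard r V) (hr : 3 ≤ r) (hm : 3 * r - 1 ≤ m) (hPc : m - r + 2 ≤ P.card)
    (hQc : m - r + 2 ≤ Q.card) (hz : r = 3 → ∀ z ∈ V, ∃ R ∈ P ∪ Q, z ∉ R) :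
    P.card + Q.card + ∑ t ∈ range 3, (m - r - t).choose (r - t) < m.choose r + 3 := by
  by_cases hr4 : 4 ≤ r
  · obtain ⟨P', Q', h1, h2, h3, h4, h5, h6, h7⟩ := hc.exists_shifted hP hQ
    rw [hV] at *
    have hp := ShiftedPair.of_crossInt h1 h2 h3 h4 h5
    rw [← h6, ← h7, ← card_union_add_card_inter]
    have h8 := h4.mem_of_large h1 (by omega) (by omega) (by omega)
    have h9 := h5.mem_of_large h2 (by omega) (by omega) (by omega)
    exact hp.card_add_card_lt le_rfl (by omega) hr4 (mem_inter.2 ⟨h8.1, h9.1⟩)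
      (mem_inter.2 ⟨h8.2, h9.2⟩)
  obtain rfl : r = 3 := by omega
  obtain ⟨σ, hσ⟩ := exists_perm_image_eq_Icc V
  rw [hV] at hσ
  obtain ⟨P', Q', ⟨h1, h2, h3, h4, h5, h6⟩, hst⟩ := exists_shift_stable (fun P' Q' =>
    P' ⊆ powersetCard 3 (Icc 1 m) ∧ Q' ⊆ powersetCard 3 (Icc 1 m) ∧
      CrossInt P' Q' ∧ P'.card = P.card ∧ Q'.card = Q.card ∧
      ∀ z ∈ Icc 1 m, ∃ R ∈ P' ∪ Q', z ∉ R) (P := permute σ P) (Q := permute σ Q)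
    ⟨hσ ▸ permute_subset hP σ, hσ ▸ permute_subset hQ σ, crossInt_permute hc σ, card_permute _ _,
      card_permute _ _, fun z hzm => by
        rw [← hσ] at hzm
        obtain ⟨w, hw, rfl⟩ := mem_image.1 hzm
        obtain ⟨R, hR, hwR⟩ := hz rfl w hw
        refine ⟨R.image fun x => σ x, ?_, fun h => hwR ?_⟩
        · rw [mem_union, image_mem_permute, image_mem_permute, ← mem_union]; exact hR
        · exact σ.injective.mem_finset_image.1 h⟩
  rw [← h4, ← h5]
  by_cases hgood : ∀ i j, 1 ≤ i → i < j → j ≤ m →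
      ∀ z ∈ Icc 1 m, ∃ R ∈ shift i j P' ∪ shift i j Q', z ∉ R
  · have hst' : ∀ i j, 1 ≤ i → i < j → j ≤ m → shift i j P' = P' ∧ shift i j Q' = Q' :=
      fun i j hi hij hj => by
        have hiV : i ∈ Icc 1 m := mem_Icc.2 (by omega)
        exact hst i j hij ⟨shift_subset hiV h1, shift_subset hiV h2, crossInt_shift h3,
          by rw [card_shift, h4], by rw [card_shift, h5], hgood i j hi hij hj⟩
    have sP : ShiftedOn m P' := shiftedOn_of_shift_eq_self fun i j a b c => (hst' i j a b c).1
    have sQ : ShiftedOn m Q' := shiftedOn_of_shift_eq_self fun i j a b c => (hst' i j a b c).2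
    have hp := ShiftedPair.of_crossInt h1 h2 h3 sP sQ
    have h8 := sP.mem_of_large h1 (by omega) (by omega) (by omega)
    have h9 := sQ.mem_of_large h2 (by omega) (by omega) (by omega)
    obtain ⟨R, hR, h1R⟩ := h6 1 (mem_Icc.2 (by omega))
    have hR' := mem_powersetCard.1 (hp.subA hR)
    have hmem : ({3 - 1, 3, 3 + 1} : Finset ℕ) ∈ P' ∪ Q' := by
      refine hp.shA.mem_of_dominated hp.subA hR (mem_powersetCard.2 ⟨fun w hw => ?_, by rfl⟩)
        fun t => ?_
      · simp only [mem_insert, mem_singleton] at hw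
        rw [mem_Icc]; omega
      · have hle : (R.filter (· ≤ t)).card ≤ t - 1 := by
          calc _ ≤ (Icc 2 t).card := card_le_card fun w hw => by
                rw [mem_filter] at hw
                have hw1 := mem_Icc.1 (hR'.1 hw.1)
                have : w ≠ 1 := by rintro rfl; exact h1R hw.1
                exact mem_Icc.2 (by omega)
            _ = _ := by rw [Nat.card_Icc]; omega
        have hle3 : (R.filter (· ≤ t)).card ≤ 3 := hR'.2 ▸ card_filter_le _ _
        rcases (by omega : t = 0 ∨ t = 1 ∨ t = 2 ∨ t = 3 ∨ 4 ≤ t) with rfl | rfl | rfl | rfl | ht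
        · exact hle.trans (Nat.zero_le _)
        · exact hle.trans (Nat.zero_le _)
        · exact hle
        · exact hle
        · rw [(filter_eq_self (s := {3 - 1, 3, 3 + 1}) (p := (· ≤ t))).2]
          · exact hle3
          · intro w hw
            simp only [mem_insert, mem_singleton] at hw
            omega
    rw [← card_union_add_card_inter]
    have := hp.card_add_card_le_of_three le_rfl (by omega) (by omega)
      (mem_inter.2 ⟨h8.2, h9.2⟩) hmem
    omega
  · push Not at hgood
    obtain ⟨i, j, hi, hij, hj, z, -, hzall⟩ := hgood
    have hV' : (Icc 1 m).card = m := by simp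
    have hzP : ∀ A ∈ shift i j P', z ∈ A := fun A hA => hzall A (mem_union_left _ hA)
    have hzQ : ∀ A ∈ shift i j Q', z ∈ A := fun A hA => hzall A (mem_union_right _ hA)
    refine card_add_card_lt_of_meet_pair (i := i) (j := j) hV' h3 h1 h2 (by omega)
      (mem_Icc.2 (by omega)) (mem_Icc.2 (by omega)) hij.ne (by omega) (by omega) h6 ?_
    intro R hR
    by_contra! hcon
    have hRs : R ∈ shift i j P' ∪ shift i j Q' := by
      rcases mem_union.1 hR with h | h
      · exact mem_union_left _ (mem_shift_of_notMem h hcon.2)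
      · exact mem_union_right _ (mem_shift_of_notMem h hcon.2)
    have hzR := hzall R hRs
    have hzi : z ≠ i := by rintro rfl; exact hcon.1 hzR
    obtain ⟨S, hS, hzS⟩ := h6 z (by
      rcases mem_union.1 hR with h | h
      · exact (mem_powersetCard.1 (h1 h)).1 hzR
      · exact (mem_powersetCard.1 (h2 h)).1 hzR)
    rcases mem_union.1 hS with h | h
    · exact hzS (mem_of_forall_mem_shift hzi hzP h)
    · exact hzS (mem_of_forall_mem_shift hzi hzQ h)

lemma card_add_sum_between_le {V : Finset ℕ} {l : ℕ} {A : Finset (Finset ℕ)}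
    (hA : A ⊆ powersetCard l V) (L : List (Finset ℕ × Finset ℕ))
    (hL : ∀ p ∈ L, p.1 ⊆ V ∧ p.2 ⊆ V ∧ Disjoint p.1 p.2 ∧ p.2.card ≤ l ∧
      Disjoint A (between V l p.1 p.2))
    (hp : L.Pairwise fun p q => ¬ Disjoint p.1 q.2 ∨ ¬ Disjoint p.2 q.1) :
    A.card + (L.map fun p => (V.card - p.1.card - p.2.card).choose (l - p.2.card)).sum ≤
      V.card.choose l := by
  induction L generalizing A with
  | nil => simpa using card_le_card hA
  | cons p L ih =>
    rw [List.pairwise_cons] at hp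
    obtain ⟨h1, h2, h3, h4, h5⟩ := hL p List.mem_cons_self
    have := ih (A := A ∪ between V l p.1 p.2) (union_subset hA (between_subset _ _ _ _))
      (fun q hq => ?_) hp.2
    · rw [card_union_of_disjoint h5, card_between h1 h2 h3 h4] at this
      simpa [add_assoc] using this
    · obtain ⟨g1, g2, g3, g4, g5⟩ := hL q (List.mem_cons_of_mem _ hq)
      refine ⟨g1, g2, g3, g4, disjoint_union_left.2 ⟨g5, ?_⟩⟩
      rcases hp.1 q hq with h | h
      · obtain ⟨z, hz, hz'⟩ := not_disjoint_iff.1 h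
        exact (disjoint_between hz' hz).symm
      · obtain ⟨z, hz, hz'⟩ := not_disjoint_iff.1 h
        exact disjoint_between hz hz'

lemma le_choose {N j : ℕ} (h1 : 1 ≤ j) (h2 : j < N) : N ≤ N.choose j := by
  induction N generalizing j with
  | zero => omega
  | succ N ih =>
    obtain ⟨j, rfl⟩ := Nat.exists_eq_succ_of_ne_zero (by omega : j ≠ 0)
    rw [Nat.succ_eq_add_one, Nat.choose_succ_succ]
    by_cases h : j + 1 < N
    · have := ih h1 h
      have : 0 < N.choose j := Nat.choose_pos (by omega)
      omega
    · obtain rfl : N = j + 1 := by omega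
      have := Nat.choose_succ_self_right j
      simp at this ⊢

lemma choose_le_choose_succ {N j : ℕ} (h : 2 * j + 1 ≤ N) : N.choose j ≤ N.choose (j + 1) := by
  have h1 := Nat.choose_succ_right_eq N j
  have h2 : N.choose j * (j + 1) ≤ N.choose j * (N - j) := Nat.mul_le_mul_left _ (by omega)
  exact Nat.le_of_mul_le_mul_right (h1 ▸ h2) (by omega : 0 < j + 1)

/-- Two members of `B` at distance at least two: losses of `A`. -/
lemma card_add_le_of_far {V b₁ b₂ : Finset ℕ} {l a a' : ℕ} {A B : Finset (Finset ℕ)}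
    (hc : CrossInt A B) (hA : A ⊆ powersetCard l V) (hB : B ⊆ powersetCard (l + 1) V)
    (hl : 3 ≤ l) (hV : 3 * l ≤ V.card) (hb₁ : b₁ ∈ B) (hb₂ : b₂ ∈ B)
    (ha : a ∈ b₁) (ha' : a' ∈ b₁) (haa : a ≠ a') (ha2 : a ∉ b₂) (ha2' : a' ∉ b₂)
    (L : List (Finset ℕ × Finset ℕ))
    (hL : ∀ p ∈ L, p.1 ⊆ V ∧ p.2 ⊆ V ∧ Disjoint p.1 p.2 ∧ p.2.card ≤ l ∧ (∃ b ∈ B, b ⊆ p.1) ∧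
      ¬ Disjoint b₁ p.2 ∧ ¬ Disjoint b₂ p.2)
    (hp : L.Pairwise fun p q => ¬ Disjoint p.1 q.2 ∨ ¬ Disjoint p.2 q.1) :
    A.card + ∑ t ∈ range 3, (V.card - (l + 1) - t).choose (l - t) +
      (L.map fun p => (V.card - p.1.card - p.2.card).choose (l - p.2.card)).sum ≤
      V.card.choose l := by
  have h1 := mem_powersetCard.1 (hB hb₁)
  have h2 := mem_powersetCard.1 (hB hb₂)
  have := card_add_sum_between_le hA ((b₁, ∅) :: (b₂, {a}) :: (insert a b₂, {a'}) :: L) ?_ ?_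
  · simp only [List.map_cons, List.sum_cons, card_empty, card_singleton,
      card_insert_of_notMem ha2, h1.2, h2.2] at this
    simp only [sum_range_succ, sum_range_zero]
    have := choose_le_choose_succ (N := V.card - (l + 1) - 2) (j := l - 2) (by omega)
    rw [show l - 2 + 1 = l - 1 by omega] at this
    rw [show V.card - (l + 1 + 1) - 1 = V.card - (l + 1) - 2 by omega] at *
    simp only [Nat.sub_zero, zero_add] at *
    omega
  · have key : ∀ Y Z : Finset ℕ, (∃ b ∈ B, b ⊆ Y) → Disjoint A (between V l Y Z) := by
      rintro Y Z ⟨b, hb, hbY⟩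
      exact disjoint_between_of_meets (fun a ha => hc a ha b hb) hbY
    intro p hpm
    simp only [List.mem_cons] at hpm
    rcases hpm with rfl | rfl | rfl | hpm
    · exact ⟨h1.1, by simp, by simp, by simp, key _ _ ⟨b₁, hb₁, subset_rfl⟩⟩
    · exact ⟨h2.1, by simpa using h1.1 ha, by simpa using ha2, by simp; omega,
        key _ _ ⟨b₂, hb₂, subset_rfl⟩⟩
    · refine ⟨insert_subset (h1.1 ha) h2.1, by simpa using h1.1 ha', ?_, by simp; omega,
        key _ _ ⟨b₂, hb₂, subset_insert _ _⟩⟩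
      simp only [disjoint_singleton_right, mem_insert, not_or]
      exact ⟨haa.symm, ha2'⟩
    · obtain ⟨g1, g2, g3, g4, g5, -⟩ := hL p hpm
      exact ⟨g1, g2, g3, g4, key _ _ g5⟩
  · simp only [List.pairwise_cons, List.mem_cons]
    refine ⟨?_, ?_, ?_, hp⟩
    · rintro q (rfl | rfl | hq)
      · left; simpa using ha
      · left; simpa using ha'
      · left; exact (hL q hq).2.2.2.2.2.1
    · rintro q (rfl | hq)
      · right; simp
      · left; exact (hL q hq).2.2.2.2.2.2
    · intro q hq
      left
      exact fun h => (hL q hq).2.2.2.2.2.2 (h.mono_left (subset_insert _ _))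

lemma card_lt_of_far {V b₁ b₂ : Finset ℕ} {l a a' : ℕ} {A B : Finset (Finset ℕ)}
    (hc : CrossInt A B) (hA : A ⊆ powersetCard l V) (hB : B ⊆ powersetCard (l + 1) V)
    (hl : 3 ≤ l) (hV : 3 * l ≤ V.card) (hBc : B.card + l ≤ V.card)
    (hb₁ : b₁ ∈ B) (hb₂ : b₂ ∈ B)
    (ha : a ∈ b₁) (ha' : a' ∈ b₁) (haa : a ≠ a') (ha2 : a ∉ b₂) (ha2' : a' ∉ b₂) :
    A.card + B.card + ∑ t ∈ range 3, (V.card - (l + 1) - t).choose (l - t) <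
      V.card.choose l + 3 := by
  have base := card_add_le_of_far hc hA hB hl hV hb₁ hb₂ ha ha' haa ha2 ha2'
  have h1 := mem_powersetCard.1 (hB hb₁)
  have h2 := mem_powersetCard.1 (hB hb₂)
  by_contra! hcon
  set N3 := ∑ t ∈ range 3, (V.card - (l + 1) - t).choose (l - t) with hN3
  have hB2 : 3 ≤ B.card := by
    have := base [] (by simp) (by simp)
    simp at this
    omega
  have hI : ∀ b ∈ B, b₁ ∩ b₂ ⊆ b := by
    intro b hb z hz
    by_contra hzb
    rw [mem_inter] at hz
    have h3 := mem_powersetCard.1 (hB hb)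
    have := base [(b, {z})] (by
      simp only [List.mem_singleton, forall_eq]
      exact ⟨h3.1, by simpa using h1.1 hz.1, by simpa using hzb, by simp; omega, ⟨b, hb, subset_rfl⟩,
        by simpa using hz.1, by simpa using hz.2⟩) (by simp)
    have := le_choose (N := V.card - (l + 1) - 1) (j := l - 1) (by omega) (by omega)
    simp [h3.2] at *
    omega
  have hII : ∀ b ∈ B, ∀ z z' w, z ∈ V → z' ∈ V → w ∈ V → z ∉ b → z' ∉ b → w ∉ b → z ≠ z' →
      z ≠ w → z' ≠ w → ¬ (z ∈ b₁ ∧ z' ∈ b₁ ∧ w ∈ b₂ ∨ z ∈ b₂ ∧ z' ∈ b₂ ∧ w ∈ b₁) := by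
    intro b hb z z' w hz hz' hw hzb hzb' hwb hzz hzw hzw' hor
    have h3 := mem_powersetCard.1 (hB hb)
    have hd : ∀ u, (u = z ∨ u = z') → ¬ Disjoint b₁ {u, w} ∧ ¬ Disjoint b₂ {u, w} := by
      intro u hu
      simp only [not_disjoint_iff, mem_insert, mem_singleton]
      rcases hor with h | h
      · exact ⟨⟨u, by rcases hu with rfl | rfl <;> tauto, by simp⟩, ⟨w, h.2.2, by simp⟩⟩
      · exact ⟨⟨w, h.2.2, by simp⟩, ⟨u, by rcases hu with rfl | rfl <;> tauto, by simp⟩⟩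
    have := base [(b, {z, w}), (insert z b, {z', w})] (by
      simp only [List.mem_cons, List.not_mem_nil, or_false, forall_eq_or_imp, forall_eq]
      refine ⟨⟨h3.1, ?_, ?_, ?_, ⟨b, hb, subset_rfl⟩, hd z (Or.inl rfl)⟩,
        insert_subset hz h3.1, ?_, ?_, ?_, ⟨b, hb, subset_insert _ _⟩, hd z' (Or.inr rfl)⟩
      · simp [insert_subset_iff, hz, hw]
      · simp [hzb, hwb]
      · rw [card_pair hzw]; omega
      · simp [insert_subset_iff, hz', hw]
      · simp [hzb', hwb, hzz.symm, hzw.symm]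
      · rw [card_pair hzw']; omega) (by simp)
    have g1 := le_choose (N := V.card - (l + 1) - 2) (j := l - 2) (by omega) (by omega)
    have g2 := le_choose (N := V.card - (l + 1 + 1) - 2) (j := l - 2) (by omega) (by omega)
    simp only [List.map_cons, List.map_nil, List.sum_cons, List.sum_nil, h3.2, card_pair hzw,
      card_pair hzw', card_insert_of_notMem hzb] at this
    omega
  have hne : ∀ b ∈ B, ∀ c ∈ B, b ≠ c → ∃ z, z ∈ c ∧ z ∉ b := by
    intro b hb c hc' hbc
    by_contra! h
    exact hbc (eq_of_subset_of_card_le h (by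
      rw [(mem_powersetCard.1 (hB hb)).2, (mem_powersetCard.1 (hB hc')).2])).symm
  have hIII : ∀ b ∈ B, b ≠ b₁ → b ≠ b₂ → ∃ z₁ z₂, z₁ ∈ b₁ ∧ z₂ ∈ b₂ ∧ z₁ ∉ b ∧ z₂ ∉ b ∧ z₁ ≠ z₂ ∧
      (∀ u ∈ b₁, u ∉ b → u = z₁) ∧ (∀ u ∈ b₂, u ∉ b → u = z₂) := by
    intro b hb hn1 hn2
    obtain ⟨z₁, hz₁, hz₁'⟩ := hne b hb b₁ hb₁ hn1
    obtain ⟨z₂, hz₂, hz₂'⟩ := hne b hb b₂ hb₂ hn2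
    have hn : ∀ u ∈ b₁, ∀ w ∈ b₂, u ∉ b → u ≠ w := by
      rintro u hu w hw hub rfl
      exact hub (hI b hb (mem_inter.2 ⟨hu, hw⟩))
    refine ⟨z₁, z₂, hz₁, hz₂, hz₁', hz₂', hn _ hz₁ _ hz₂ hz₁', fun u hu hub => ?_,
      fun u hu hub => ?_⟩
    · by_contra hne'
      exact hII b hb u z₁ z₂ (h1.1 hu) (h1.1 hz₁) (h2.1 hz₂) hub hz₁' hz₂' hne'
        (hn _ hu _ hz₂ hub) (hn _ hz₁ _ hz₂ hz₁') (Or.inl ⟨hu, hz₁, hz₂⟩)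
    · by_contra hne'
      exact hII b hb u z₂ z₁ (h2.1 hu) (h2.1 hz₂) (h1.1 hz₁) hub hz₂' hz₁' hne'
        (hn _ hz₁ _ hu hz₁').symm (hn _ hz₁ _ hz₂ hz₁').symm (Or.inr ⟨hu, hz₂, hz₁⟩)
  have hb12 : b₁ ≠ b₂ := by rintro rfl; exact ha2 ha
  have hpair : ({b₁, b₂} : Finset (Finset ℕ)) ⊆ B := by
    simp [insert_subset_iff, hb₁, hb₂]
  have hpc := card_sdiff_add_card_eq_card hpair
  rw [card_pair hb12] at hpc
  have hmem : ∀ b ∈ B \ {b₁, b₂}, b ∈ B ∧ b ≠ b₁ ∧ b ≠ b₂ := fun b hb => by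
    simpa [not_or] using hb
  obtain ⟨b₃, hb₃⟩ : (B \ {b₁, b₂}).Nonempty := card_pos.1 (by omega)
  obtain ⟨hb₃, hb31, hb32⟩ := hmem _ hb₃
  have h3 := mem_powersetCard.1 (hB hb₃)
  obtain ⟨z₁, z₂, hz₁, hz₂, hz₁', hz₂', hzz, hu₁, hu₂⟩ := hIII _ hb₃ hb31 hb32
  have hvalid : ∀ b ∈ B, ∀ u w, u ∈ b₁ → w ∈ b₂ → u ∉ b → w ∉ b → u ≠ w →
      b ⊆ V ∧ ({u, w} : Finset ℕ) ⊆ V ∧ Disjoint b {u, w} ∧ ({u, w} : Finset ℕ).card ≤ l ∧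
      (∃ c ∈ B, c ⊆ b) ∧ ¬ Disjoint b₁ {u, w} ∧ ¬ Disjoint b₂ {u, w} := by
    intro b hb u w hu hw hub hwb huw
    refine ⟨(mem_powersetCard.1 (hB hb)).1, ?_, ?_, ?_, ⟨b, hb, subset_rfl⟩, ?_, ?_⟩
    · simp [insert_subset_iff, h1.1 hu, h2.1 hw]
    · simp [hub, hwb]
    · rw [card_pair huw]; omega
    · simp only [not_disjoint_iff]; exact ⟨u, hu, by simp⟩
    · simp only [not_disjoint_iff]; exact ⟨w, hw, by simp⟩
  have g1 := le_choose (N := V.card - (l + 1) - 2) (j := l - 2) (by omega) (by omega)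
  rcases hB2.eq_or_lt with hB3 | hB3
  · have := base [(b₃, {z₁, z₂})] (by
      simpa only [List.mem_singleton, forall_eq] using
        hvalid _ hb₃ _ _ hz₁ hz₂ hz₁' hz₂' hzz) (by simp)
    simp only [List.map_cons, List.map_nil, List.sum_cons, List.sum_nil, h3.2, card_pair hzz] at this
    omega
  · obtain ⟨b₄, hb₄, hb43⟩ := exists_mem_ne (by omega : 1 < (B \ {b₁, b₂}).card) b₃
    obtain ⟨hb₄, hb41, hb42⟩ := hmem _ hb₄
    have h4 := mem_powersetCard.1 (hB hb₄)
    obtain ⟨w₁, w₂, hw₁, hw₂, hw₁', hw₂', hww, hv₁, hv₂⟩ := hIII _ hb₄ hb41 hb42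
    have hneq : z₁ ≠ w₁ ∨ z₂ ≠ w₂ := by
      by_contra! h
      obtain ⟨rfl, rfl⟩ := h
      have hsub : ((b₁ ∪ b₂).erase z₁).erase z₂ ⊆ b₃ ∩ b₄ := by
        intro u hu
        simp only [mem_erase, mem_union, mem_inter] at hu ⊢
        constructor <;> by_contra hub
        · rcases hu.2.2 with h | h
          · exact hu.2.1 (hu₁ u h hub)
          · exact hu.1 (hu₂ u h hub)
        · rcases hu.2.2 with h | h
          · exact hu.2.1 (hv₁ u h hub)
          · exact hu.1 (hv₂ u h hub)
      have hcard := card_le_card hsub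
      rw [card_erase_of_mem (mem_erase.2 ⟨hzz.symm, mem_union_right _ hz₂⟩),
        card_erase_of_mem (mem_union_left _ hz₁)] at hcard
      have hbig : l + 3 ≤ (b₁ ∪ b₂).card := by
        rw [union_comm, ← union_sdiff_self_eq_union, card_union_of_disjoint disjoint_sdiff, h2.2]
        have : ({a, a'} : Finset ℕ) ⊆ b₁ \ b₂ := by
          simp [insert_subset_iff, ha, ha', ha2, ha2']
        have := card_le_card this
        rw [card_pair haa] at this
        omega
      have e3 : b₃ ∩ b₄ = b₃ := eq_of_subset_of_card_le inter_subset_left (by omega)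
      have e4 : b₃ ∩ b₄ = b₄ := eq_of_subset_of_card_le inter_subset_right (by omega)
      exact hb43 (e4.symm.trans e3)
    have := base [(b₃, {z₁, z₂}), (b₄, {w₁, w₂})] (by
      simp only [List.mem_cons, List.not_mem_nil, or_false, forall_eq_or_imp, forall_eq]
      exact ⟨hvalid _ hb₃ _ _ hz₁ hz₂ hz₁' hz₂' hzz, hvalid _ hb₄ _ _ hw₁ hw₂ hw₁' hw₂' hww⟩) (by
      simp only [List.pairwise_cons, List.mem_singleton, forall_eq, List.not_mem_nil,
        false_implies, implies_true, List.Pairwise.nil, and_true]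
      right
      rw [not_disjoint_iff]
      rcases hneq with h | h
      · refine ⟨z₁, by simp, ?_⟩
        by_contra hz
        exact h (hv₁ _ hz₁ hz)
      · refine ⟨z₂, by simp, ?_⟩
        by_contra hz
        exact h (hv₂ _ hz₂ hz))
    simp only [List.map_cons, List.map_nil, List.sum_cons, List.sum_nil, h3.2, h4.2, card_pair hzz,
      card_pair hww] at this
    omega

lemma card_lt_of_near {V b₁ b₂ b₃ : Finset ℕ} {l : ℕ} {A B : Finset (Finset ℕ)}
    (hc : CrossInt A B) (hA : A ⊆ powersetCard l V) (hB : B ⊆ powersetCard (l + 1) V)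
    (hl : 3 ≤ l) (hV : 3 * l ≤ V.card)
    (hnear : ∀ b ∈ B, ∀ c ∈ B, (b \ c).card ≤ 1)
    (hb₁ : b₁ ∈ B) (hb₂ : b₂ ∈ B) (hb₃ : b₃ ∈ B) (hne : b₁ ≠ b₂) (hsub : ¬ b₁ ∩ b₂ ⊆ b₃) :
    A.card + B.card + ∑ t ∈ range 3, (V.card - (l + 1) - t).choose (l - t) <
      V.card.choose l + 3 := by
  have h1 := mem_powersetCard.1 (hB hb₁)
  have h2 := mem_powersetCard.1 (hB hb₂)
  have h3 := mem_powersetCard.1 (hB hb₃)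
  obtain ⟨e, he, he3⟩ := not_subset.1 hsub
  rw [mem_inter] at he
  have hex : ∀ b ∈ B, ∀ c ∈ B, b ≠ c → ∃ z, z ∈ b ∧ z ∉ c := by
    intro b hb c hc' hbc
    by_contra! h
    exact hbc (eq_of_subset_of_card_le h (by
      rw [(mem_powersetCard.1 (hB hb)).2, (mem_powersetCard.1 (hB hc')).2]))
  have huniq : ∀ b ∈ B, ∀ c ∈ B, ∀ u w, u ∈ b → w ∈ b → u ∉ c → w ∉ c → u = w := by
    intro b hb c hc' u w hu hw huc hwc
    exact card_le_one.1 (hnear b hb c hc') _ (mem_sdiff.2 ⟨hu, huc⟩) _ (mem_sdiff.2 ⟨hw, hwc⟩)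
  obtain ⟨y, hy1, hy2⟩ := hex _ hb₁ _ hb₂ hne
  have hloss := card_add_sum_between_le hA [(b₁, ∅), (b₂, {y}), (b₃, {e})] ?_ ?_
  · have hBsub : B ⊆ powersetCard (l + 1) (b₁ ∪ b₂) := by
      intro b hb
      have hb' := mem_powersetCard.1 (hB hb)
      refine mem_powersetCard.2 ⟨fun w hw => ?_, hb'.2⟩
      by_contra hw12
      rw [mem_union, not_or] at hw12
      have hw3 : w ∉ b₃ := by
        intro hw3
        have h4 : b₃ \ {w} ⊆ b₁ ∩ b₂ := by
          intro u hu
          rw [mem_sdiff, mem_singleton] at hu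
          rw [mem_inter]
          constructor <;> by_contra hcon
          · exact hu.2 (huniq _ hb₃ _ hb₁ _ _ hu.1 hw3 hcon hw12.1)
          · exact hu.2 (huniq _ hb₃ _ hb₂ _ _ hu.1 hw3 hcon hw12.2)
        have h5 : insert e (b₃ \ {w}) ⊆ b₁.erase y := by
          refine insert_subset (mem_erase.2 ⟨?_, he.1⟩) fun u hu => mem_erase.2 ⟨?_, ?_⟩
          · rintro rfl; exact hy2 he.2
          · rintro rfl; exact hy2 (mem_inter.1 (h4 hu)).2
          · exact (mem_inter.1 (h4 hu)).1
        have := card_le_card h5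
        rw [card_insert_of_notMem (by simp [he3]), card_erase_of_mem hy1,
          card_sdiff_of_subset (by simpa using hw3), card_singleton] at this
        omega
      have h4 : insert e (b \ {w}) ⊆ b₁.erase y := by
        refine insert_subset (mem_erase.2 ⟨?_, he.1⟩) fun u hu => mem_erase.2 ⟨?_, ?_⟩
        · rintro rfl; exact hy2 he.2
        · rintro rfl
          rw [mem_sdiff, mem_singleton] at hu
          exact hu.2 (huniq _ hb _ hb₂ _ _ hu.1 hw hy2 hw12.2)
        · rw [mem_sdiff, mem_singleton] at hu
          by_contra hcon
          exact hu.2 (huniq _ hb _ hb₁ _ _ hu.1 hw hcon hw12.1)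
      have := card_le_card h4
      rw [card_insert_of_notMem, card_erase_of_mem hy1,
        card_sdiff_of_subset (by simpa using hw), card_singleton] at this
      · omega
      · rw [mem_sdiff, mem_singleton]
        rintro ⟨heb, hew⟩
        exact hew (huniq _ hb _ hb₃ _ _ heb hw he3 hw3)
    have hBc : B.card ≤ l + 2 := by
      have hu : (b₁ ∪ b₂).card ≤ l + 2 := by
        rw [union_comm, ← union_sdiff_self_eq_union, card_union_of_disjoint disjoint_sdiff, h2.2]
        have := hnear b₁ hb₁ b₂ hb₂
        omega
      calc B.card ≤ (powersetCard (l + 1) (b₁ ∪ b₂)).card := card_le_card hBsub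
        _ = (b₁ ∪ b₂).card.choose (l + 1) := card_powersetCard _ _
        _ ≤ (l + 2).choose (l + 1) := Nat.choose_le_choose _ hu
        _ = l + 2 := Nat.choose_succ_self_right _
    simp only [List.map_cons, List.map_nil, List.sum_cons, List.sum_nil, h1.2, h2.2, h3.2,
      card_empty, card_singleton] at hloss
    simp only [sum_range_succ, sum_range_zero]
    obtain ⟨p, hp⟩ : ∃ p, V.card - (l + 1) = p + 2 := ⟨V.card - (l + 1) - 2, by omega⟩
    obtain ⟨q, rfl⟩ : ∃ q, l = q + 2 := ⟨l - 2, by omega⟩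
    have hg := le_choose (N := p) (j := q + 1) (by omega) (by omega)
    rw [hp] at hloss ⊢
    have hch := Nat.choose_succ_succ p q
    simp only [Nat.succ_eq_add_one] at hch
    simp only [Nat.sub_zero, Nat.add_sub_cancel, zero_add,
      show p + 2 - 1 = p + 1 by omega, show q + 2 - 1 = q + 1 by omega] at *
    omega
  · have key : ∀ Y Z : Finset ℕ, Y ∈ B → Disjoint A (between V l Y Z) := fun Y Z hY =>
      disjoint_between_of_meets (fun a ha => hc a ha Y hY) subset_rfl
    simp only [List.mem_cons, List.not_mem_nil, or_false, forall_eq_or_imp, forall_eq]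
    refine ⟨⟨h1.1, by simp, by simp, by simp, key _ _ hb₁⟩,
      ⟨h2.1, by simpa using h1.1 hy1, by simpa using hy2, by simp; omega, key _ _ hb₂⟩,
      h3.1, by simpa using h1.1 he.1, by simpa using he3, by simp; omega, key _ _ hb₃⟩
  · simp only [List.pairwise_cons, List.mem_cons, List.not_mem_nil, or_false, forall_eq_or_imp,
      forall_eq, false_implies, implies_true, List.Pairwise.nil, and_true]
    exact ⟨⟨Or.inl (by simpa using hy1), Or.inl (by simpa using he.1)⟩,
      Or.inl (by simpa using he.2)⟩

/-- If `B` is small and its members do not share a common `l`-set, then `A` is small. -/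
theorem CrossInt.card_lt_of_not_common {V : Finset ℕ} {l : ℕ} {A B : Finset (Finset ℕ)}
    (hc : CrossInt A B) (hA : A ⊆ powersetCard l V) (hB : B ⊆ powersetCard (l + 1) V)
    (hl : 3 ≤ l) (hV : 3 * l ≤ V.card) (hBc : B.card + l ≤ V.card)
    (hE : ∀ E ∈ powersetCard l V, ∃ b ∈ B, ¬ E ⊆ b) :
    A.card + B.card + ∑ t ∈ range 3, (V.card - (l + 1) - t).choose (l - t) <
      V.card.choose l + 3 := by
  by_cases hnear : ∀ b ∈ B, ∀ c ∈ B, (b \ c).card ≤ 1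
  · obtain ⟨E₀, hE₀⟩ : (powersetCard l V).Nonempty := powersetCard_nonempty.2 (by omega)
    obtain ⟨b₁, hb₁, -⟩ := hE E₀ hE₀
    have h1 := mem_powersetCard.1 (hB hb₁)
    obtain ⟨E₁, hE₁⟩ : (powersetCard l b₁).Nonempty := powersetCard_nonempty.2 (by omega)
    have hE₁ := mem_powersetCard.1 hE₁
    obtain ⟨b₂, hb₂, hE₁b⟩ := hE E₁ (mem_powersetCard.2 ⟨hE₁.1.trans h1.1, hE₁.2⟩)
    have hne : b₁ ≠ b₂ := by rintro rfl; exact hE₁b hE₁.1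
    obtain ⟨b₃, hb₃, hs⟩ := hE (b₁ ∩ b₂) (by
      refine mem_powersetCard.2 ⟨inter_subset_left.trans h1.1, ?_⟩
      have := card_sdiff_add_card_inter b₁ b₂
      have := hnear b₁ hb₁ b₂ hb₂
      have : (b₁ ∩ b₂).card ≠ l + 1 := fun h => by
        have e1 : b₁ ∩ b₂ = b₁ := eq_of_subset_of_card_le inter_subset_left (by omega)
        have h2 := mem_powersetCard.1 (hB hb₂)
        have e2 : b₁ ∩ b₂ = b₂ := eq_of_subset_of_card_le inter_subset_right (by omega)
        exact hne (e1.symm.trans e2)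
      omega)
    exact card_lt_of_near hc hA hB hl hV hnear hb₁ hb₂ hb₃ hne hs
  · push Not at hnear
    obtain ⟨b₁, hb₁, b₂, hb₂, h⟩ := hnear
    obtain ⟨a, ha, a', ha', haa⟩ := one_lt_card.1 h
    rw [mem_sdiff] at ha ha'
    exact card_lt_of_far hc hA hB hl hV hBc hb₁ hb₂ ha.1 ha'.1 haa ha.2 ha'.2

/-- `c` is smaller than the size of `𝒥₃(n,k)`. -/
def BelowBound (n k c : ℕ) : Prop :=
  c + ∑ t ∈ range 3, (n - 1 - k - t).choose (k - 1 - t) < (n - 1).choose (k - 1) + 3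

/-- Every element of `V` is missed by many members of `F`. -/
def SpreadOn (V : Finset ℕ) (k : ℕ) (F : Finset (Finset ℕ)) : Prop :=
  ∀ x ∈ V, V.card - k + 1 ≤ (avoidAt x F).card

/-- No triple in `V` meets all members of `F` in at least two elements. -/
def NoHeavyTriple (V : Finset ℕ) (F : Finset (Finset ℕ)) : Prop :=
  ∀ T ⊆ V, T.card = 3 → ∃ A ∈ F, (A ∩ T).card ≤ 1

lemma crossInt_linkAt_avoidAt {x : ℕ} {F : Finset (Finset ℕ)} (h : CrossInt F F) :
    CrossInt (linkAt x F) (avoidAt x F) := by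
  intro a ha b hb
  rw [mem_linkAt] at ha
  rw [mem_avoidAt] at hb
  obtain ⟨z, hz⟩ := h _ ha.2 _ hb.1
  rw [mem_inter, mem_insert] at hz
  rcases hz with ⟨rfl | h1, h2⟩
  · exact absurd h2 hb.2
  · exact ⟨z, mem_inter.2 ⟨h1, h2⟩⟩

lemma exists_common_of_card_avoidAt_le {k x : ℕ} {V : Finset ℕ} {F : Finset (Finset ℕ)}
    (hk : 4 ≤ k) (hV : 3 * k - 2 ≤ V.card) (hF : F ⊆ powersetCard k V) (hint : CrossInt F F)
    (hx : x ∈ V) (hle : (avoidAt x F).card + k ≤ V.card) (hbig : ¬ BelowBound V.card k F.card) :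
    ∃ E ∈ powersetCard (k - 1) (V.erase x), ∀ b ∈ avoidAt x F, E ⊆ b := by
  by_contra! hcon
  apply hbig
  have hc := card_erase_of_mem hx
  have := (crossInt_linkAt_avoidAt (x := x) hint).card_lt_of_not_common
    (linkAt_subset hF) (by rw [show k - 1 + 1 = k by omega]; exact avoidAt_subset hF)
    (by omega) (by omega) (by omega) hcon
  rw [card_linkAt_add_card_avoidAt, hc, show k - 1 + 1 = k by omega] at this
  exact this

lemma choose_pascal {n k : ℕ} (hn : 1 ≤ n) (hk : 1 ≤ k) :
    n.choose k = (n - 1).choose (k - 1) + (n - 1).choose k := by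
  obtain ⟨n, rfl⟩ := Nat.exists_eq_add_of_le' hn
  obtain ⟨k, rfl⟩ := Nat.exists_eq_add_of_le' hk
  exact Nat.choose_succ_succ n k

/-- A pair of elements meeting all members of `F` forces `F` to be small. -/
lemma belowBound_of_pair_meets {k i j : ℕ} {V : Finset ℕ} {F : Finset (Finset ℕ)}
    (hk : 4 ≤ k) (hV : 3 * k - 2 ≤ V.card) (hF : F ⊆ powersetCard k V) (hint : CrossInt F F)
    (hs : SpreadOn V k F) (hT : k = 4 → NoHeavyTriple V F) (hi : i ∈ V) (hj : j ∈ V) (hij : i ≠ j)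
    (hmeet : ∀ A ∈ F, i ∈ A ∨ j ∈ A) : BelowBound V.card k F.card := by
  have hD : avoidAt j (avoidAt i F) = ∅ := by
    refine eq_empty_of_forall_notMem fun A hA => ?_
    rw [mem_avoidAt_avoidAt] at hA
    rcases hmeet A hA.1 with h | h
    · exact hA.2.1 h
    · exact hA.2.2 h
  have hc : ((V.erase i).erase j).card = V.card - 2 := by
    rw [card_erase_of_mem (mem_erase.2 ⟨hij.symm, hj⟩), card_erase_of_mem hi]; omega
  have hQ := card_linkAt_add_card_avoidAt j (avoidAt i F)
  rw [hD, card_empty] at hQ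
  have hP : avoidAt j (linkAt i F) = linkAt i (avoidAt j F) := by
    ext R
    rw [mem_avoidAt_linkAt, mem_linkAt_avoidAt hij.symm]
    tauto
  have hP' := card_linkAt_add_card_avoidAt i (avoidAt j F)
  have hD' : avoidAt i (avoidAt j F) = ∅ := by
    rw [← hD]; ext R; rw [mem_avoidAt_avoidAt, mem_avoidAt_avoidAt]; tauto
  rw [hD', card_empty] at hP'
  have h1 := hs i hi
  have h2 := hs j hj
  have hlt := (crossInt_links hij hint).card_add_card_lt hc (avoidAt_linkAt_subset hF)
    (linkAt_avoidAt_subset hF) (by omega) (by omega) (by rw [hP]; omega) (by omega) (by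
      intro hr z hz
      simp only [mem_erase] at hz
      obtain ⟨A, hA, hAc⟩ := hT (by omega) {i, j, z}
        (by simp [insert_subset_iff, hi, hj, hz.2.2])
        (by rw [card_eq_three]; exact ⟨i, j, z, hij, hz.2.1.symm, hz.1.symm, rfl⟩)
      have huniq := fun u hu w hw => card_le_one.1 hAc u hu w hw
      simp only [mem_inter, mem_insert, mem_singleton] at huniq
      rcases hmeet A hA with h | h
      · have hjA : j ∉ A := fun h' => hij (huniq i ⟨h, by simp⟩ j ⟨h', by simp⟩)
        refine ⟨A.erase i, mem_union_left _ ?_, fun h' => ?_⟩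
        · rw [mem_avoidAt_linkAt, insert_erase h]
          exact ⟨hA, by simp, fun h' => hjA (mem_of_mem_erase h')⟩
        · exact hz.2.1 (huniq z ⟨mem_of_mem_erase h', by simp⟩ i ⟨h, by simp⟩)
      · have hiA : i ∉ A := fun h' => hij (huniq i ⟨h', by simp⟩ j ⟨h, by simp⟩)
        refine ⟨A.erase j, mem_union_right _ ?_, fun h' => ?_⟩
        · rw [mem_linkAt_avoidAt hij, insert_erase h]
          exact ⟨hA, fun h' => hiA (mem_of_mem_erase h'), by simp⟩
        · exact hz.1 (huniq z ⟨mem_of_mem_erase h', by simp⟩ j ⟨h, by simp⟩))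
  have hC := card_le_card (linkAt_linkAt_subset (i := i) (j := j) hF)
  rw [card_powersetCard, hc] at hC
  have hpas := choose_pascal (n := V.card - 1) (k := k - 1) (by omega) (by omega)
  have hsum := card_eq_add_four_parts i j F
  rw [hD, card_empty] at hsum
  unfold BelowBound
  rw [show V.card - 1 - k = V.card - 2 - (k - 1) by omega, hpas,
    show V.card - 1 - 1 = V.card - 2 by omega, show k - 1 - 1 = k - 2 by omega]
  omega

lemma avoidAt_shift {i j x : ℕ} (hi : x ≠ i) (hj : x ≠ j) (F : Finset (Finset ℕ)) :
    avoidAt x (shift i j F) = shift i j (avoidAt x F) := by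
  ext A
  simp only [mem_avoidAt, mem_shift, mem_insert, mem_erase]
  tauto

lemma succ_le_choose {N j : ℕ} (h1 : 2 ≤ j) (h2 : j + 2 ≤ N) : N + 1 ≤ N.choose j := by
  have h3 := choose_pascal (n := N) (k := j) (by omega) (by omega)
  have h4 := le_choose (N := N - 1) (j := j - 1) (by omega) (by omega)
  have h5 := le_choose (N := N - 1) (j := j) (by omega) (by omega)
  omega

lemma spreadOn_shift {k i j : ℕ} {V : Finset ℕ} {F : Finset (Finset ℕ)}
    (hk : 4 ≤ k) (hV : 3 * k - 2 ≤ V.card) (hF : F ⊆ powersetCard k V) (hint : CrossInt F F)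
    (hs : SpreadOn V k F) (hT : k = 4 → NoHeavyTriple V F) (hi : i ∈ V) (hj : j ∈ V) (hij : i ≠ j)
    (hbig : ¬ BelowBound V.card k F.card) : SpreadOn V k (shift i j F) := by
  intro x hx
  by_cases hxi : x = i
  swap
  · refine (hs x hx).trans ?_
    by_cases hxj : x = j
    · subst hxj
      refine card_le_card fun A hA => ?_
      rw [mem_avoidAt] at hA ⊢
      exact ⟨mem_shift_of_notMem hA.1 hA.2, hA.2⟩
    · rw [avoidAt_shift hxi hxj, card_shift]
  subst hxi
  by_contra! hlt
  obtain ⟨E, hE, hEb⟩ := exists_common_of_card_avoidAt_le (F := shift x j F) hk hV (shift_subset hi hF)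
    (crossInt_shift hint) hi (by omega) (by rwa [card_shift])
  rw [mem_powersetCard] at hE
  set D := avoidAt j (avoidAt x F) with hD
  have hDE : ∀ d ∈ D, E ⊆ d := by
    intro d hd
    rw [hD, mem_avoidAt_avoidAt] at hd
    exact hEb d (mem_avoidAt.2 ⟨mem_shift_of_notMem hd.1 hd.2.2, hd.2.1⟩)
  rcases D.eq_empty_or_nonempty with h0 | h0
  · refine hbig (belowBound_of_pair_meets hk hV hF hint hs hT hi hj hij fun A hA => ?_)
    by_contra! hcon
    have : A ∈ D := mem_avoidAt_avoidAt.2 ⟨hA, hcon⟩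
    rw [h0] at this
    exact notMem_empty _ this
  set W := (V.erase x).erase j with hW
  have hc : W.card = V.card - 2 := by
    rw [card_erase_of_mem (mem_erase.2 ⟨hij.symm, hj⟩), card_erase_of_mem hi]; omega
  have hDsub : D ⊆ powersetCard k W := avoidAt_subset (avoidAt_subset hF)
  have hEW : E ⊆ W := by
    obtain ⟨d, hd⟩ := h0
    exact (hDE d hd).trans (mem_powersetCard.1 (hDsub hd)).1
  -- every member of `D` is `E` plus one element
  have hDform : ∀ d ∈ D, ∃ y ∈ W \ E, d = insert y E := by
    intro d hd
    have h1 := mem_powersetCard.1 (hDsub hd)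
    have h2 := card_sdiff_of_subset (hDE d hd)
    obtain ⟨y, hy⟩ := card_eq_one.1 (by omega : (d \ E).card = 1)
    have hyd : y ∈ d \ E := by rw [hy]; simp
    rw [mem_sdiff] at hyd
    refine ⟨y, mem_sdiff.2 ⟨h1.1 hyd.1, hyd.2⟩, ?_⟩
    rw [insert_eq, ← hy, sdiff_union_of_subset (hDE d hd)]
  have hDc : D.card ≤ V.card - k - 1 := by
    have : D ⊆ (W \ E).image fun y => insert y E := by
      intro d hd
      obtain ⟨y, hy, rfl⟩ := hDform d hd
      exact mem_image_of_mem _ hy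
    refine (card_le_card this).trans (card_image_le.trans ?_)
    rw [card_sdiff_of_subset hEW, hc]
    omega
  have hQ := card_linkAt_add_card_avoidAt j (avoidAt x F)
  have hP : avoidAt j (linkAt x F) = linkAt x (avoidAt j F) := by
    ext R
    rw [mem_avoidAt_linkAt, mem_linkAt_avoidAt hij.symm]
    tauto
  have hP' := card_linkAt_add_card_avoidAt x (avoidAt j F)
  have hD' : avoidAt x (avoidAt j F) = D := by
    ext R; rw [hD, mem_avoidAt_avoidAt, mem_avoidAt_avoidAt]; tauto
  rw [hD', ← hP] at hP'
  rw [← hD] at hQ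
  have h1 := hs x hi
  have h2 := hs j hj
  have hcr := (crossInt_links hij hint).card_add_card_le (s := 2) (avoidAt_linkAt_subset hF)
    (linkAt_avoidAt_subset hF) (by omega) (by rw [← hW, hc]; omega) (by omega) (by omega) (by omega)
  have hCmeet : ∀ a ∈ linkAt j (linkAt x F), ∀ d ∈ D, (a ∩ d).Nonempty := by
    intro a ha d hd
    rw [mem_linkAt, mem_linkAt] at ha
    rw [hD, mem_avoidAt_avoidAt] at hd
    obtain ⟨z, hz⟩ := hint _ ha.2.2 _ hd.1
    simp only [mem_inter, mem_insert] at hz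
    rcases hz with ⟨rfl | rfl | h, h'⟩
    · exact absurd h' hd.2.1
    · exact absurd h' hd.2.2
    · exact ⟨z, mem_inter.2 ⟨h, h'⟩⟩
  have hsum := card_eq_add_four_parts x j F
  rw [← hD] at hsum
  have hpas := choose_pascal (n := V.card - 1) (k := k - 1) (by omega) (by omega)
  have hpas2 := choose_pascal (n := V.card - 2 - k) (k := k - 2) (by omega) (by omega)
  rw [← hW, hc] at hcr
  apply hbig
  unfold BelowBound
  rw [hpas]
  simp only [sum_range_succ, sum_range_zero, zero_add, Nat.sub_zero] at hcr ⊢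
  rw [show V.card - 1 - k = V.card - 2 - (k - 1) by omega,
    show V.card - 1 - 1 = V.card - 2 by omega, show k - 1 - 1 = k - 2 by omega] at *
  by_cases hd1 : D.card = 1
  · obtain ⟨d, hd⟩ := h0
    obtain ⟨y, hy, rfl⟩ := hDform d hd
    rw [mem_sdiff] at hy
    have := card_add_sum_le (V := W) (E := E) (k := k) (l := k - 2) (s := 1) (y := fun _ => y) hEW
      (by omega) (fun _ _ => hy) (fun t ht u hu _ => by omega) (by omega)
      (linkAt_linkAt_subset hF) (fun a ha t ht => hCmeet a ha _ hd)
    simp only [sum_range_succ, sum_range_zero, zero_add, Nat.sub_zero, hc] at this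
    have hpos : 0 < (V.card - 2 - k - 1).choose (k - 2) := Nat.choose_pos (by omega)
    rw [show V.card - 2 - (k - 1) - 1 = V.card - 2 - k by omega,
      show V.card - 2 - (k - 1) - 2 = V.card - 2 - k - 1 by omega,
      show k - 1 - 2 = k - 2 - 1 by omega] at *
    omega
  · obtain ⟨d, hd, d', hd', hdd⟩ := one_lt_card.1 (by
      have := card_pos.2 h0; omega : 1 < D.card)
    obtain ⟨y, hy, rfl⟩ := hDform d hd
    obtain ⟨y', hy', rfl⟩ := hDform d' hd'
    rw [mem_sdiff] at hy hy'
    have hyy : y ≠ y' := by rintro rfl; exact hdd rfl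
    have := card_add_sum_le (V := W) (E := E) (k := k) (l := k - 2) (s := 2)
      (y := fun t => if t = 0 then y else y') hEW
      (by omega) (fun t _ => by split_ifs <;> assumption) (fun t ht u hu h => by
        split_ifs at h with h3 h4 h4
        · omega
        · exact absurd h hyy
        · exact absurd h.symm hyy
        · omega) (by omega)
      (linkAt_linkAt_subset hF) (fun a ha t ht => by
        split_ifs
        · exact hCmeet a ha _ hd
        · exact hCmeet a ha _ hd')
    simp only [sum_range_succ, sum_range_zero, zero_add, Nat.sub_zero, hc] at this
    have hge := succ_le_choose (N := V.card - 2 - k) (j := k - 2) (by omega) (by omega)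
    rw [show V.card - 2 - (k - 1) - 1 = V.card - 2 - k by omega,
      show V.card - 2 - (k - 1) - 2 = V.card - 2 - k - 1 by omega,
      show k - 1 - 2 = k - 2 - 1 by omega] at *
    omega

lemma noHeavyTriple_shift {k i j : ℕ} {V : Finset ℕ} {F : Finset (Finset ℕ)}
    (hk : 4 ≤ k) (hV : 3 * k - 2 ≤ V.card) (hF : F ⊆ powersetCard k V) (hint : CrossInt F F)
    (hs : SpreadOn V k F) (hT : NoHeavyTriple V F)
    (hbig : ¬ BelowBound V.card k F.card) : NoHeavyTriple V (shift i j F) := by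
  intro T hTV hTc
  by_contra! hcon
  obtain ⟨A, hA, hAT⟩ := hT T hTV hTc
  have hAS : A ∉ shift i j F := fun h => by have := hcon A h; omega
  have hout : ∀ B ∈ F, B ∉ shift i j F →
      j ∈ B ∧ i ∉ B ∧ insert i (B.erase j) ∈ shift i j F := by
    intro B hB hBS
    simp only [mem_shift, not_or, not_and] at hBS ⊢
    have h1 := hBS.1 hB
    push Not at h1
    refine ⟨h1.1, h1.2.1, Or.inr ⟨by simp, ?_, h1.2.2, ?_⟩⟩
    · have : i ≠ j := by rintro rfl; exact h1.2.1 h1.1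
      simp [this.symm]
    · rw [erase_insert (by simp [h1.2.1]), insert_erase h1.1]; exact hB
  obtain ⟨hjA, hiA, hA'⟩ := hout A hA hAS
  have h2 := hcon _ hA'
  have hiT : i ∈ T := by
    by_contra hiT
    have : insert i (A.erase j) ∩ T ⊆ A ∩ T := by
      intro z hz
      simp only [mem_inter, mem_insert, mem_erase] at hz ⊢
      rcases hz with ⟨rfl | h, h'⟩
      · exact absurd h' hiT
      · exact ⟨h.2, h'⟩
    have := card_le_card this
    omega
  have hT2 : (T.erase i).card = 2 := by rw [card_erase_of_mem hiT, hTc]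
  obtain ⟨b, c, hbc, hTbc⟩ := card_eq_two.1 hT2
  have hbV : b ∈ T ∧ b ≠ i := by
    have : b ∈ T.erase i := by rw [hTbc]; simp
    rw [mem_erase] at this; tauto
  have hcV : c ∈ T ∧ c ≠ i := by
    have : c ∈ T.erase i := by rw [hTbc]; simp
    rw [mem_erase] at this; tauto
  have hjT : ∀ B : Finset ℕ, 1 < (B ∩ T).card → b ∈ B ∨ c ∈ B := by
    intro B hB
    obtain ⟨z, hz, hzi⟩ := exists_mem_ne hB i
    rw [mem_inter] at hz
    have : z ∈ T.erase i := mem_erase.2 ⟨hzi, hz.2⟩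
    rw [hTbc, mem_insert, mem_singleton] at this
    rcases this with rfl | rfl
    · exact Or.inl hz.1
    · exact Or.inr hz.1
  refine hbig (belowBound_of_pair_meets hk hV hF hint hs (fun _ => hT) (hTV hbV.1) (hTV hcV.1) hbc
    fun B hB => ?_)
  by_cases hBS : B ∈ shift i j F
  · exact hjT B (hcon B hBS)
  · rcases hjT _ (hcon _ (hout B hB hBS).2.2) with h | h
    · exact Or.inl (mem_of_mem_erase (mem_of_mem_insert_of_ne h hbV.2))
    · exact Or.inr (mem_of_mem_erase (mem_of_mem_insert_of_ne h hcV.2))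

lemma shiftedPair_of_stable {m k : ℕ} {F : Finset (Finset ℕ)} (hk : 1 ≤ k)
    (hF : F ⊆ powersetCard k (range (m + 1))) (hint : CrossInt F F)
    (hst : ∀ i j, i < j → j ≤ m → shift i j F = F) :
    ShiftedPair m k (k - 1) (linkAt 0 F) (avoidAt 0 F) where
  subA := by
    have h : (range (m + 1)).erase 0 = Icc 1 m := by ext x; simp; omega
    exact h ▸ linkAt_subset hF
  subB := by
    have h : (range (m + 1)).erase 0 = Icc 1 m := by ext x; simp; omega
    exact h ▸ avoidAt_subset hF
  shA := by
    intro R hR i j hi hij hj hjR hiR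
    rw [mem_linkAt] at hR ⊢
    have := mem_of_shift_eq_self (hst i j hij hj) hR.2 (mem_insert_of_mem hjR)
      (by simp [hiR]; omega)
    refine ⟨by simp [hR.1]; omega, ?_⟩
    rwa [erase_insert_of_ne (by omega), insert_comm] at this
  shB := by
    intro R hR i j hi hij hj hjR hiR
    rw [mem_avoidAt] at hR ⊢
    refine ⟨mem_of_shift_eq_self (hst i j hij hj) hR.1 hjR hiR, ?_⟩
    simp [hR.2]; omega
  cross := crossInt_linkAt_avoidAt hint
  closed := by
    intro b hb a hab ha
    rw [mem_avoidAt] at hb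
    have hb' := mem_powersetCard.1 (hF hb.1)
    have h2 := card_sdiff_of_subset hab
    obtain ⟨y, hy⟩ := card_eq_one.1 (by omega : (b \ a).card = 1)
    have hyd : y ∈ b \ a := by rw [hy]; simp
    rw [mem_sdiff] at hyd
    have hbe : b.erase y = a := by
      rw [← sdiff_singleton_eq_erase, ← hy, Finset.sdiff_sdiff_eq_self hab]
    have hym := mem_range.1 (hb'.1 hyd.1)
    have hy0 : 0 < y := Nat.pos_of_ne_zero (by rintro rfl; exact hb.2 hyd.1)
    rw [mem_linkAt]
    refine ⟨fun h => hb.2 (hab h), ?_⟩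
    have := mem_of_shift_eq_self (hst 0 y hy0 (by omega)) hb.1 hyd.1 hb.2
    rwa [hbe] at this

lemma belowBound_of_stable {m k : ℕ} {F : Finset (Finset ℕ)} (hk : 4 ≤ k) (hm : 3 * k - 2 ≤ m + 1)
    (hF : F ⊆ powersetCard k (range (m + 1))) (hint : CrossInt F F)
    (hst : ∀ i j, i < j → j ≤ m → shift i j F = F) (hs : SpreadOn (range (m + 1)) k F)
    (hT : k = 4 → NoHeavyTriple (range (m + 1)) F) : BelowBound (m + 1) k F.card := by
  have hp := shiftedPair_of_stable (by omega) hF hint hst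
  have hB := hs 0 (by simp)
  rw [card_range] at hB
  have hlarge := hp.shB.mem_of_large hp.subB (by omega) (by omega) (by omega)
  unfold BelowBound
  rw [← card_linkAt_add_card_avoidAt 0 F, Nat.add_sub_cancel]
  by_cases hk4 : k = 4
  · subst hk4
    obtain ⟨R, hR, hRc⟩ := hT rfl {0, 1, 2} (by intro x; simp; omega) (by rfl)
    have hex : ∃ a ∈ linkAt 0 F, ∀ w ∈ a, 3 ≤ w := by
      have hR' := mem_powersetCard.1 (hF hR)
      have huniq := fun u hu w hw => card_le_one.1 hRc u hu w hw
      simp only [mem_inter, mem_insert, mem_singleton] at huniq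
      by_cases h0 : 0 ∈ R
      · refine ⟨R.erase 0, by rw [mem_linkAt, insert_erase h0]; simp [hR], fun w hw => ?_⟩
        rw [mem_erase] at hw
        by_contra hw3
        exact hw.1 (huniq w ⟨hw.2, by omega⟩ 0 ⟨h0, by simp⟩)
      · obtain ⟨y, hy, hy'⟩ : ∃ y ∈ R, ∀ w ∈ R.erase y, 3 ≤ w := by
          by_cases hy : ∃ y ∈ R, y < 3
          · obtain ⟨y, hy, hy3⟩ := hy
            refine ⟨y, hy, fun w hw => ?_⟩
            rw [mem_erase] at hw
            by_contra hw3
            exact hw.1 (huniq w ⟨hw.2, by omega⟩ y ⟨hy, by omega⟩)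
          · push Not at hy
            obtain ⟨y, hyR⟩ : R.Nonempty := card_pos.1 (by omega)
            exact ⟨y, hyR, fun w hw => hy w (mem_of_mem_erase hw)⟩
        exact ⟨R.erase y, hp.closed R (mem_avoidAt.2 ⟨hR, h0⟩) _ (erase_subset _ _)
          (by rw [card_erase_of_mem hy]; omega), hy'⟩
    obtain ⟨a, ha, ha3⟩ := hex
    have ha' := mem_powersetCard.1 (hp.subA ha)
    have hmem : ({4 - 1, 4, 4 + 1} : Finset ℕ) ∈ linkAt 0 F := by
      refine hp.shA.mem_of_dominated hp.subA ha (mem_powersetCard.2 ⟨fun w hw => ?_, by rfl⟩)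
        fun t => ?_
      · simp only [mem_insert, mem_singleton] at hw
        rw [mem_Icc]; omega
      · have hle : (a.filter (· ≤ t)).card ≤ t - 2 := by
          calc _ ≤ (Icc 3 t).card := card_le_card fun w hw => by
                rw [mem_filter] at hw
                exact mem_Icc.2 ⟨ha3 w hw.1, hw.2⟩
            _ = _ := by rw [Nat.card_Icc]; omega
        have hle3 : (a.filter (· ≤ t)).card ≤ 3 := (card_filter_le _ _).trans ha'.2.le
        rcases (by omega : t ≤ 2 ∨ t = 3 ∨ t = 4 ∨ 5 ≤ t) with ht | rfl | rfl | ht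
        · exact hle.trans (by omega)
        · exact hle
        · exact hle
        · rw [(filter_eq_self (s := {4 - 1, 4, 4 + 1}) (p := (· ≤ t))).2]
          · exact hle3
          · intro w hw
            simp only [mem_insert, mem_singleton] at hw
            omega
    have := hp.card_add_card_le_of_three (by omega) le_rfl (by omega) hlarge.2 hmem
    simp only [show 4 - 1 = 3 by rfl] at *
    omega
  · exact hp.card_add_card_lt (by omega) (by omega) (by omega) hlarge.1 hlarge.2

lemma belowBound_of_range {m k : ℕ} {F : Finset (Finset ℕ)} (hk : 4 ≤ k) (hm : 3 * k - 2 ≤ m + 1)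
    (hF : F ⊆ powersetCard k (range (m + 1))) (hint : CrossInt F F)
    (hs : SpreadOn (range (m + 1)) k F) (hT : k = 4 → NoHeavyTriple (range (m + 1)) F) :
    BelowBound (m + 1) k F.card := by
  by_contra hbig
  obtain ⟨F', G, ⟨hFG, h1, h2, h3, h4, h5⟩, hst⟩ := exists_shift_stable (fun F' G => F' = G ∧
    F' ⊆ powersetCard k (range (m + 1)) ∧ CrossInt F' F' ∧ F'.card = F.card ∧
    SpreadOn (range (m + 1)) k F' ∧ (k = 4 → NoHeavyTriple (range (m + 1)) F'))
    (P := F) (Q := F) ⟨rfl, hF, hint, rfl, hs, hT⟩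
  have hbig' : ¬ BelowBound (range (m + 1)).card k F'.card := by rwa [h3, card_range]
  have hm' : 3 * k - 2 ≤ (range (m + 1)).card := by rwa [card_range]
  have := belowBound_of_stable hk hm h1 h2 (fun i j hij hj => ?_) h4 h5
  · exact hbig (h3 ▸ this)
  · have hi : i ∈ range (m + 1) := mem_range.2 (by omega)
    have hj : j ∈ range (m + 1) := mem_range.2 (by omega)
    refine (hst i j hij ⟨by rw [hFG], shift_subset hi h1, crossInt_shift h2, by rw [card_shift, h3],
      spreadOn_shift hk hm' h1 h2 h4 h5 hi hj hij.ne hbig',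
      fun h => noHeavyTriple_shift hk hm' h1 h2 h4 (h5 h) hbig'⟩).1

/-- An intersecting family all of whose avoiding parts are non-degenerate is small. -/
theorem belowBound_of_nondegenerate {k : ℕ} {V : Finset ℕ} {F : Finset (Finset ℕ)}
    (hk : 4 ≤ k) (hV : 3 * k - 2 ≤ V.card) (hF : F ⊆ powersetCard k V) (hint : CrossInt F F)
    (hdeg : ∀ x ∈ V, ∀ E ∈ powersetCard (k - 1) (V.erase x), ∃ b ∈ avoidAt x F, ¬ E ⊆ b)
    (hT : k = 4 → NoHeavyTriple V F) : BelowBound V.card k F.card := by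
  by_contra hbig
  have hs : SpreadOn V k F := by
    intro x hx
    by_contra! hlt
    obtain ⟨E, hE, h⟩ := exists_common_of_card_avoidAt_le hk hV hF hint hx (by omega) hbig
    obtain ⟨b, hb, hn⟩ := hdeg x hx E hE
    exact hn (h b hb)
  obtain ⟨m, hm⟩ := Nat.exists_eq_add_of_le' (by omega : 1 ≤ V.card)
  obtain ⟨σ, hσ, -⟩ := exists_perm_image_eq (V ∪ range (m + 1)) V (range (m + 1))
    subset_union_left subset_union_right (by simpa using hm)
  refine hbig ?_
  rw [hm, ← card_permute σ]
  refine belowBound_of_range hk (by omega) (hσ ▸ permute_subset hF σ) (crossInt_permute hint σ)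
    ?_ fun hk4 => ?_
  · intro x hx
    rw [← hσ] at hx
    obtain ⟨y, hy, rfl⟩ := mem_image.1 hx
    have h := hs y hy
    rw [card_range, ← hm]
    refine h.trans ?_
    rw [← card_permute σ]
    refine card_le_card fun A hA => ?_
    obtain ⟨B, hB, rfl⟩ := mem_image.1 hA
    rw [mem_avoidAt] at hB ⊢
    refine ⟨mem_image_of_mem _ hB.1, ?_⟩
    simpa using hB.2
  · intro T hTV hTc
    obtain ⟨A, hA, hAT⟩ := hT hk4 (T.image fun x => σ.symm x) (fun z hz => by
      obtain ⟨w, hw, rfl⟩ := mem_image.1 hz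
      have := hTV hw
      rw [← hσ] at this
      obtain ⟨u, hu, rfl⟩ := mem_image.1 this
      simpa using hu) (by rw [card_image_of_injective _ σ.symm.injective, hTc])
    refine ⟨_, image_mem_permute.2 hA, ?_⟩
    have : (A.image fun x => σ x) ∩ T = (A ∩ T.image fun x => σ.symm x).image fun x => σ x := by
      rw [image_inter _ _ σ.injective, image_image]
      simp
    rw [this]
    exact card_image_le.trans hAT

lemma permute_mul (σ τ : Equiv.Perm ℕ) (F : Finset (Finset ℕ)) :
    permute (σ * τ) F = permute σ (permute τ F) := by
  simp only [permute, image_image]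
  refine image_congr fun s _ => ?_
  simp only [Function.comp_apply, image_image]
  rfl

lemma perm_mem_of_fixes {U : Finset ℕ} {σ : Equiv.Perm ℕ} (h : ∀ x ∉ U, σ x = x) {x : ℕ}
    (hx : x ∈ U) : σ x ∈ U := by
  by_contra hcon
  have := σ.injective (h _ hcon)
  exact hcon (this.symm ▸ hx)

lemma perm_mem_Icc_of_fixes {a n : ℕ} (ha : 1 ≤ a) {σ : Equiv.Perm ℕ}
    (h : ∀ x ∉ Icc a n, σ x = x) : ∀ x ∈ Icc 1 n, σ x ∈ Icc 1 n := by
  intro x hx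
  by_cases hxa : x ∈ Icc a n
  · exact Icc_subset_Icc_left ha (perm_mem_of_fixes h hxa)
  · rwa [h x hxa]

lemma image_eq_Icc_of_mem {n : ℕ} {σ : Equiv.Perm ℕ} (h : ∀ x ∈ Icc 1 n, σ x ∈ Icc 1 n) :
    ((Icc 1 n).image fun x => σ x) = Icc 1 n := by
  refine eq_of_subset_of_card_le (image_subset_iff.2 h) ?_
  rw [card_image_of_injective _ σ.injective]

lemma mem_avoidAt_permute {σ : Equiv.Perm ℕ} {x : ℕ} {F : Finset (Finset ℕ)} {b : Finset ℕ} :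
    b ∈ avoidAt (σ x) (permute σ F) ↔ ∃ a ∈ avoidAt x F, (a.image fun x => σ x) = b := by
  rw [mem_avoidAt, permute, mem_image]
  constructor
  · rintro ⟨⟨a, ha, rfl⟩, hx⟩
    exact ⟨a, mem_avoidAt.2 ⟨ha, fun h => hx (mem_image_of_mem _ h)⟩, rfl⟩
  · rintro ⟨a, ha, rfl⟩
    rw [mem_avoidAt] at ha
    exact ⟨⟨a, ha.1, rfl⟩, by simpa using ha.2⟩

lemma image_eq_self_of_fixes {σ : Equiv.Perm ℕ} {s : Finset ℕ} (h : ∀ x ∈ s, σ x = x) :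
    (s.image fun x => σ x) = s := by
  rw [image_congr (g := id) h, image_id]

lemma exists_permute_degenerate {n k x : ℕ} {E : Finset ℕ} {F : Finset (Finset ℕ)} (hk : 1 ≤ k)
    (hF : F ⊆ powersetCard k (Icc 1 n)) (hx : x ∈ Icc 1 n)
    (hE : E ∈ powersetCard (k - 1) ((Icc 1 n).erase x)) (hEb : ∀ b ∈ avoidAt x F, E ⊆ b) :
    ∃ σ : Equiv.Perm ℕ, (∀ x ∈ Icc 1 n, σ x ∈ Icc 1 n) ∧ ∃ s, k + s ≤ n ∧
      avoidAt 1 (permute σ F) = (Icc (k + 1) (k + s)).image fun j => insert j (Icc 2 k) := by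
  rw [mem_powersetCard] at hE
  have hx' := mem_Icc.1 hx
  have hkn : k ≤ n := by
    have := card_le_card hE.1
    rw [card_erase_of_mem hx, Nat.card_Icc, hE.2] at this
    omega
  obtain ⟨σ₁, h₁, f₁⟩ := exists_perm_image_eq (Icc 1 n) {x} {1} (by simpa using hx)
    (by simp; omega) rfl
  have hx1 : σ₁ x = 1 := by simpa using h₁
  have p₁ := perm_mem_Icc_of_fixes le_rfl f₁
  obtain ⟨σ₂, h₂, f₂⟩ := exists_perm_image_eq (Icc 2 n) (E.image fun x => σ₁ x) (Icc 2 k)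
    (fun z hz => by
      obtain ⟨w, hw, rfl⟩ := mem_image.1 hz
      have hw' := mem_erase.1 (hE.1 hw)
      have h1 := mem_Icc.1 (p₁ w hw'.2)
      have h2 : σ₁ w ≠ 1 := fun h => hw'.1 (σ₁.injective (h.trans hx1.symm))
      exact mem_Icc.2 (by omega))
    (Icc_subset_Icc_right hkn)
    (by rw [card_image_of_injective _ σ₁.injective, hE.2, Nat.card_Icc]; omega)
  have p₂ := perm_mem_Icc_of_fixes (by omega) f₂
  set G := permute σ₂ (permute σ₁ F) with hG
  have hGsub : G ⊆ powersetCard k (Icc 1 n) := by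
    have h1 := permute_subset hF σ₁
    rw [image_eq_Icc_of_mem p₁] at h1
    have h2 := permute_subset h1 σ₂
    rwa [image_eq_Icc_of_mem p₂] at h2
  have h21 : σ₂ 1 = 1 := f₂ 1 (by simp)
  have hform : ∀ b ∈ avoidAt 1 G, ∃ j ∈ Icc (k + 1) n, b = insert j (Icc 2 k) := by
    intro b hb
    have hb0 := mem_avoidAt.1 hb
    have hb' := mem_powersetCard.1 (hGsub hb0.1)
    rw [hG, ← h21, mem_avoidAt_permute] at hb
    obtain ⟨a, ha, rfl⟩ := hb
    rw [← hx1, mem_avoidAt_permute] at ha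
    obtain ⟨c, hc, rfl⟩ := ha
    have hsub : Icc 2 k ⊆ (c.image fun x => σ₁ x).image fun x => σ₂ x := by
      rw [← h₂]
      exact image_subset_image (image_subset_image (hEb c hc))
    generalize ((c.image fun x => σ₁ x).image fun x => σ₂ x) = b at *
    have h2 := card_sdiff_of_subset hsub
    rw [Nat.card_Icc] at h2
    obtain ⟨y, hy⟩ := card_eq_one.1 (by omega : (b \ Icc 2 k).card = 1)
    have hyd : y ∈ b \ Icc 2 k := by rw [hy]; simp
    rw [mem_sdiff, mem_Icc] at hyd
    have h3 := mem_Icc.1 (hb'.1 hyd.1)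
    have h4 : y ≠ 1 := by rintro rfl; exact hb0.2 hyd.1
    exact ⟨y, mem_Icc.2 (by omega), by rw [insert_eq, ← hy, sdiff_union_of_subset hsub]⟩
  set Y := (Icc (k + 1) n).filter fun j => insert j (Icc 2 k) ∈ G with hY
  have hYc : k + Y.card ≤ n := by
    have : Y.card ≤ (Icc (k + 1) n).card := card_filter_le _ _
    rw [Nat.card_Icc] at this
    omega
  obtain ⟨σ₃, h₃, f₃⟩ := exists_perm_image_eq (Icc (k + 1) n) Y (Icc (k + 1) (k + Y.card))
    (filter_subset _ _) (Icc_subset_Icc_right hYc) (by rw [Nat.card_Icc]; omega)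
  have p₃ := perm_mem_Icc_of_fixes (by omega) f₃
  refine ⟨σ₃ * (σ₂ * σ₁), fun z hz => p₃ _ (p₂ _ (p₁ _ hz)), Y.card, hYc, ?_⟩
  rw [permute_mul, permute_mul, ← hG, ← h₃, image_image]
  have h31 : σ₃ 1 = 1 := f₃ 1 (by simp; omega)
  have h3E : ((Icc 2 k).image fun x => σ₃ x) = Icc 2 k :=
    image_eq_self_of_fixes fun z hz => f₃ z (by simp at hz ⊢; omega)
  ext b
  nth_rewrite 1 [← h31]
  rw [mem_avoidAt_permute, mem_image]
  constructor
  · rintro ⟨a, ha, rfl⟩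
    obtain ⟨j, hj, rfl⟩ := hform a ha
    refine ⟨j, mem_filter.2 ⟨hj, (mem_avoidAt.1 ha).1⟩, ?_⟩
    simp only [Function.comp_apply, image_insert, h3E]
  · rintro ⟨j, hj, rfl⟩
    rw [mem_filter, mem_Icc] at hj
    refine ⟨insert j (Icc 2 k), mem_avoidAt.2 ⟨hj.2, by simp; omega⟩, ?_⟩
    simp only [Function.comp_apply, image_insert, h3E]

lemma card_Jfam_three {n k : ℕ} (hk : 3 ≤ k) (hn : k + 3 ≤ n) :
    (Jfam n k 3).card + ∑ t ∈ range 3, (n - 1 - k - t).choose (k - 1 - t) =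
      (n - 1).choose (k - 1) + 3 := by
  set E := Icc 2 k with hE
  have hEc : E.card = k - 1 := by rw [hE, Nat.card_Icc]; omega
  have hmemE : ∀ z, z ∈ E ↔ 2 ≤ z ∧ z ≤ k := fun z => mem_Icc
  set V := Icc 1 n with hV
  have hmemV : ∀ z, z ∈ V ↔ 1 ≤ z ∧ z ≤ n := fun z => mem_Icc
  have hVc : V.card = n := by simp [hV]
  have hEV : E ⊆ V := fun z hz => by rw [hmemE] at hz; rw [hmemV]; omega
  set S := (powersetCard k V).filter fun A =>
      1 ∈ A ∧ ∀ j ∈ Icc (k + 1) (k + 3), (A ∩ insert j E).Nonempty with hS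
  have hins : ∀ j, k < j → (insert j E).card = k := fun j hj => by
    rw [card_insert_of_notMem (by rw [hmemE]; omega), hEc]; omega
  have hdisj : Disjoint S ((Icc (k + 1) (k + 3)).image fun j => insert j E) := by
    refine disjoint_left.2 fun A hA hA' => ?_
    obtain ⟨j, hj, rfl⟩ := mem_image.1 hA'
    have := (mem_filter.1 hA).2.1
    rw [mem_insert, hmemE] at this
    rw [mem_Icc] at hj
    omega
  have himg : ((Icc (k + 1) (k + 3)).image fun j => insert j E).card = 3 := by
    rw [card_image_of_injOn]
    · rw [Nat.card_Icc]; omega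
    · intro a ha b hb hab
      rw [mem_coe, mem_Icc] at ha hb
      have : a ∈ insert b E := by
        rw [← show insert a E = insert b E from hab]; exact mem_insert_self _ _
      rw [mem_insert, hmemE] at this
      omega
  have hJ : (Jfam n k 3).card = S.card + 3 := by
    have := card_union_of_disjoint hdisj
    rw [himg] at this
    exact this
  have key : between V k ∅ {1} = ((S ∪ between V k (insert (k + 1) E) {1}) ∪
      between V k (insert (k + 2) E) {1, k + 1}) ∪
      between V k (insert (k + 3) E) {1, k + 1, k + 2} := by
    ext A
    have hE' : ∀ j z, z ∉ A → (A ∩ insert z E).Nonempty → (A ∩ insert j E).Nonempty := by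
      rintro j z hz ⟨w, hw⟩
      rw [mem_inter, mem_insert] at hw
      rcases hw with ⟨h1, rfl | h2⟩
      · exact absurd h1 hz
      · exact ⟨w, mem_inter.2 ⟨h1, mem_insert_of_mem h2⟩⟩
    have hIcc : (∀ j ∈ Icc (k + 1) (k + 3), (A ∩ insert j E).Nonempty) ↔
        (A ∩ insert (k + 1) E).Nonempty ∧ (A ∩ insert (k + 2) E).Nonempty ∧
          (A ∩ insert (k + 3) E).Nonempty := by
      simp only [mem_Icc]
      constructor
      · intro h
        exact ⟨h _ (by omega), h _ (by omega), h _ (by omega)⟩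
      · rintro ⟨h1, h2, h3⟩ j hj
        rcases (by omega : j = k + 1 ∨ j = k + 2 ∨ j = k + 3) with rfl | rfl | rfl <;> assumption
    have hdis : ∀ j, Disjoint A (insert j E) ↔ ¬ (A ∩ insert j E).Nonempty := fun j => by
      rw [← not_disjoint_iff_nonempty_inter, not_not]
    simp only [mem_union, mem_between, hS, mem_filter, hIcc, hdis, insert_subset_iff,
      singleton_subset_iff, disjoint_empty_right, and_true]
    have h3 := hE' (k + 2) (k + 1)
    have h4 := hE' (k + 3) (k + 1)
    have h5 := hE' (k + 3) (k + 2)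
    generalize (A ∩ insert (k + 1) E).Nonempty = p₁ at *
    generalize (A ∩ insert (k + 2) E).Nonempty = p₂ at *
    generalize (A ∩ insert (k + 3) E).Nonempty = p₃ at *
    generalize (k + 1 ∈ A) = q₁ at *
    generalize (k + 2 ∈ A) = q₂ at *
    generalize (1 ∈ A) = r at *
    generalize (A ∈ powersetCard k V) = m at *
    clear hdis hE' hIcc hdisj hJ hS himg
    grind
  have hcard := congrArg Finset.card key
  have hd : ∀ j Z, j ∈ Icc (k + 1) (k + 3) → Disjoint S (between V k (insert j E) Z) := by
    intro j Z hj
    refine disjoint_between_of_meets (fun A hA => ?_) subset_rfl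
    exact (mem_filter.1 hA).2.2 j hj
  rw [card_union_of_disjoint, card_union_of_disjoint, card_union_of_disjoint, card_between,
    card_between, card_between, card_between, hVc, hins _ (by omega), hins _ (by omega),
    hins _ (by omega), card_empty, card_singleton, card_pair (by omega),
    card_eq_three.2 ⟨1, k + 1, k + 2, by omega, by omega, by omega, rfl⟩] at hcard
  · rw [hJ]
    simp only [sum_range_succ, sum_range_zero, zero_add, Nat.sub_zero] at hcard ⊢
    rw [show n - k - 1 = n - 1 - k by omega, show n - k - 2 = n - 1 - k - 1 by omega,
      show n - k - 3 = n - 1 - k - 2 by omega, show k - 2 = k - 1 - 1 by omega,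
      show k - 3 = k - 1 - 2 by omega] at hcard
    omega
  all_goals try first
    | exact hd _ _ (by simp)
    | (simp only [insert_subset_iff, singleton_subset_iff, hmemV, hEV, and_true]; omega)
    | (simp only [disjoint_insert_right, disjoint_singleton_right, mem_insert, hmemE]; omega)
    | exact card_le_three.trans hk
    | exact card_le_two.trans (by omega)
    | (rw [card_singleton]; omega)
    | exact empty_subset _
    | exact disjoint_empty_left _
  · exact disjoint_union_left.2 ⟨hd _ _ (by simp),
      disjoint_between (z := k + 1) (by simp) (by simp) |>.symm⟩
  · exact disjoint_union_left.2 ⟨disjoint_union_left.2 ⟨hd _ _ (by simp),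
      (disjoint_between (z := k + 1) (by simp) (by simp)).symm⟩,
      (disjoint_between (z := k + 2) (by simp) (by simp)).symm⟩

lemma card_Gfam_five {n : ℕ} (hn : 13 ≤ n) :
    (Gfam n 5 4).card + ∑ t ∈ range 3, (n - 1 - 5 - t).choose (5 - 1 - t) =
      (n - 1).choose (5 - 1) + 3 := by
  set V := Icc 1 n with hV
  have hVc : V.card = n := by simp [hV]
  have hEV : Icc 1 4 ⊆ V := Icc_subset_Icc_right (by omega)
  have h5V : ({5} : Finset ℕ) ⊆ V := by simp [hV]; omega
  have key : Gfam n 5 4 ∪ between V 5 (Icc 1 4) {5} =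
      between V 5 {5} (Icc 1 4) ∪ between V 5 ∅ {5} := by
    ext A
    have hdis : Disjoint A (Icc 1 4) ↔ ¬ (A ∩ Icc 1 4).Nonempty := by
      rw [← not_disjoint_iff_nonempty_inter, not_not]
    simp only [Gfam, mem_union, mem_between, mem_filter, hdis, singleton_subset_iff,
      disjoint_empty_right, disjoint_singleton_right, and_true, Nat.reduceAdd, ← hV]
    tauto
  have hcard := congrArg Finset.card key
  rw [card_union_of_disjoint, card_union_of_disjoint, card_between h5V hEV (by simp) (by simp),
    card_between hEV h5V (by simp) (by simp),
    card_between (empty_subset _) h5V (by simp) (by simp), hVc] at hcard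
  · simp only [card_singleton, Nat.card_Icc, card_empty] at hcard
    norm_num at hcard
    have h1 := choose_pascal (n := n - 5) (k := 4) (by omega) (by omega)
    have h2 := choose_pascal (n := n - 6) (k := 3) (by omega) (by omega)
    have h3 := choose_pascal (n := n - 7) (k := 2) (by omega) (by omega)
    simp only [Nat.sub_sub, Nat.reduceAdd, Nat.reduceSub, Nat.choose_one_right] at h1 h2 h3 hcard
    simp only [sum_range_succ, sum_range_zero, Nat.sub_sub, Nat.reduceAdd, Nat.reduceSub]
    omega
  · exact (disjoint_between (z := 5) (by simp) (by simp)).symm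
  · refine disjoint_left.2 fun A hA hA' => ?_
    rw [mem_between, disjoint_iff_inter_eq_empty] at hA'
    rw [Gfam, mem_union, mem_filter, mem_filter] at hA
    rcases hA with ⟨_, h⟩ | ⟨_, _, h⟩
    · have h1 : (1 : ℕ) ∈ A ∩ Icc 1 4 := mem_inter.2 ⟨h (by simp), by simp⟩
      rw [hA'.2.2] at h1
      simp at h1
    · exact h.ne_empty hA'.2.2

section Degenerate

variable {n k s : ℕ} {G : Finset (Finset ℕ)}

lemma subset_Jfam_of_avoidAt_eq (hG : G ⊆ powersetCard k (Icc 1 n)) (hint : CrossInt G G)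
    (hav : avoidAt 1 G = (Icc (k + 1) (k + s)).image fun j => insert j (Icc 2 k)) :
    G ⊆ Jfam n k s := by
  intro A hA
  rw [Jfam, mem_union, ← hav, mem_filter, mem_avoidAt]
  by_cases h1 : 1 ∈ A
  · refine .inl ⟨hG hA, h1, fun j hj => hint A hA _ ?_⟩
    have : insert j (Icc 2 k) ∈ avoidAt 1 G := by
      rw [hav]
      exact mem_image_of_mem _ hj
    exact (mem_avoidAt.1 this).1
  · exact .inr ⟨hA, h1⟩

lemma permute_swap_subset_Gfam (hk : 3 ≤ k) (hkn : k ≤ n) (hs : k ≤ s)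
    (hG : G ⊆ powersetCard k (Icc 1 n)) (hGJ : G ⊆ Jfam n k s) :
    permute (Equiv.swap 1 k) G ⊆ Gfam n k (k - 1) := by
  have hp : ∀ x ∈ Icc 1 n, Equiv.swap 1 k x ∈ Icc 1 n := by
    intro x hx
    rw [mem_Icc] at hx ⊢
    rw [Equiv.swap_apply_def]
    split_ifs <;> omega
  have hsub := permute_subset hG (Equiv.swap 1 k)
  rw [image_eq_Icc_of_mem hp] at hsub
  intro B hB
  have hB' := hsub hB
  obtain ⟨A, hA, rfl⟩ := mem_image.1 hB
  have hmem : ∀ z ∈ Icc 2 k, Equiv.swap 1 k z ∈ Icc 1 (k - 1) := by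
    intro z hz
    rw [mem_Icc] at hz ⊢
    rw [Equiv.swap_apply_def]
    split_ifs <;> omega
  rw [Gfam, mem_union, mem_filter, mem_filter, Nat.sub_add_cancel (by omega)]
  rcases mem_union.1 (hGJ hA) with h | h
  · obtain ⟨hAp, h1, h2⟩ := mem_filter.1 h
    refine .inr ⟨hB', mem_image.2 ⟨1, h1, Equiv.swap_apply_left 1 k⟩, ?_⟩
    by_cases h3 : (A ∩ Icc 2 k).Nonempty
    · obtain ⟨z, hz⟩ := h3
      rw [mem_inter] at hz
      exact ⟨_, mem_inter.2 ⟨mem_image_of_mem _ hz.1, hmem z hz.2⟩⟩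
    · exfalso
      have h4 : insert 1 (Icc (k + 1) (k + s)) ⊆ A := by
        refine insert_subset h1 fun j hj => ?_
        obtain ⟨z, hz⟩ := h2 j hj
        rw [mem_inter, mem_insert] at hz
        rcases hz with ⟨hzA, rfl | hzE⟩
        · exact hzA
        · exact absurd ⟨z, mem_inter.2 ⟨hzA, hzE⟩⟩ h3
      have h5 := card_le_card h4
      rw [card_insert_of_notMem (by simp; omega), Nat.card_Icc, (mem_powersetCard.1 hAp).2] at h5
      omega
  · refine .inl ⟨hB', fun z hz => mem_image.2 ⟨Equiv.swap 1 k z, ?_, Equiv.swap_apply_self ..⟩⟩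
    obtain ⟨j, -, rfl⟩ := mem_image.1 h
    refine mem_insert_of_mem ?_
    rw [mem_Icc] at hz ⊢
    rw [Equiv.swap_apply_def]
    split_ifs <;> omega

lemma belowBound_of_avoidAt_eq (hk : 5 ≤ k) (hn : 3 * k - 2 ≤ n) (hs : 4 ≤ s) (hsn : k + s ≤ n)
    (hks : k = 5 → s = 4) (hG : G ⊆ powersetCard k (Icc 1 n)) (hint : CrossInt G G)
    (hav : avoidAt 1 G = (Icc (k + 1) (k + s)).image fun j => insert j (Icc 2 k)) :
    BelowBound n k G.card := by
  have hle : (avoidAt 1 G).card ≤ s := by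
    rw [hav]
    refine card_image_le.trans ?_
    rw [Nat.card_Icc]
    omega
  have hlink : linkAt 1 G ⊆ powersetCard (k - 1) ((Icc 1 n).erase 1) := linkAt_subset hG
  have hcard : ((Icc 1 n).erase 1).card = n - 1 := by
    rw [card_erase_of_mem (by simp; omega), Nat.card_Icc]
    omega
  have hbound : ∀ r ≤ s, r ≤ k →
      (linkAt 1 G).card + ∑ t ∈ range r, (n - 1 - k - t).choose (k - 1 - t) ≤
        (n - 1).choose (k - 1) := by
    intro r hr hrk
    have := card_add_sum_le (V := (Icc 1 n).erase 1) (E := Icc 2 k) (k := k) (l := k - 1)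
      (y := fun t => k + 1 + t) (s := r) (A := linkAt 1 G)
      (fun z hz => by rw [mem_Icc] at hz; rw [mem_erase, mem_Icc]; omega)
      (by rw [Nat.card_Icc]; omega)
      (fun t ht => by rw [mem_erase, mem_Icc, mem_Icc]; omega)
      (fun t _ u _ h => by simpa using h) (by omega) hlink
      (fun a ha t ht => by
        refine crossInt_linkAt_avoidAt hint a ha _ ?_
        rw [hav]
        exact mem_image_of_mem _ (mem_Icc.2 (by omega)))
    rwa [hcard] at this
  have hsplit := card_linkAt_add_card_avoidAt 1 G
  have h4 := hbound 4 hs (by omega)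
  rw [sum_range_succ] at h4
  rw [BelowBound]
  rcases hk.eq_or_lt with rfl | hk6
  · rw [Nat.choose_one_right] at h4
    have := hks rfl
    omega
  rcases hs.eq_or_lt with rfl | hs5
  · have := le_choose (j := k - 1 - 3) (N := n - 1 - k - 3) (by omega) (by omega)
    omega
  · have h5 := hbound 5 hs5 (by omega)
    rw [sum_range_succ, sum_range_succ] at h5
    have h6 := succ_le_choose (j := k - 1 - 3) (N := n - 1 - k - 3) (by omega) (by omega)
    have h7 : 0 < (n - 1 - k - 4).choose (k - 1 - 4) := Nat.choose_pos (by omega)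
    omega

end Degenerate

lemma belowBound_or_permute_subset {k n : ℕ} (hk : 4 ≤ k) (hn : 3 * k - 2 ≤ n)
    {F : Finset (Finset ℕ)} (hF : F ⊆ powersetCard k (Icc 1 n)) (hint : CrossInt F F)
    (hstar : ¬ ∃ x ∈ Icc 1 n, ∀ A ∈ F, x ∈ A)
    (hHM : ¬ SubIsoTo n F (HMfam n k))
    (hJ2 : ¬ SubIsoTo n F (Jfam n k 2))
    (hG4 : k = 4 → ¬ SubIsoTo n F (Gfam n 4 2) ∧ ¬ SubIsoTo n F (Gfam n 4 3)) :
    BelowBound n k F.card ∨ SubIsoTo n F (Jfam n k 3) ∨ (k = 5 ∧ SubIsoTo n F (Gfam n 5 4)) := by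
  have hVc : (Icc 1 n).card = n := by simp
  have hT : k = 4 → NoHeavyTriple (Icc 1 n) F := by
    rintro rfl T hTV hTc
    by_contra hcon
    push Not at hcon
    obtain ⟨σ, hσ, hfix⟩ := exists_perm_image_eq (Icc 1 n) T (Icc 1 3) hTV
      (Icc_subset_Icc_right (by omega)) (by rw [hTc, Nat.card_Icc])
    have hp := perm_mem_Icc_of_fixes le_rfl hfix
    have hsub := permute_subset hF σ
    rw [image_eq_Icc_of_mem hp] at hsub
    refine (hG4 rfl).1 ⟨σ, hp, fun B hB => ?_⟩
    have hB' := hsub hB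
    obtain ⟨A, hA, rfl⟩ := mem_image.1 hB
    have h2 : 1 < ((A.image fun x => σ x) ∩ Icc 1 3).card := by
      rw [← hσ, ← image_inter _ _ σ.injective, card_image_of_injective _ σ.injective]
      exact hcon A hA
    generalize (A.image fun x => σ x) = B at *
    obtain ⟨u, hu, v, hv, huv⟩ := one_lt_card.1 h2
    rw [mem_inter, mem_Icc] at hu hv
    rw [Gfam, mem_union, mem_filter, mem_filter]
    by_cases h3 : 3 ∈ B
    · refine .inr ⟨hB', h3, ?_⟩
      by_cases hu3 : u = 3
      · exact ⟨v, mem_inter.2 ⟨hv.1, mem_Icc.2 (by omega)⟩⟩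
      · exact ⟨u, mem_inter.2 ⟨hu.1, mem_Icc.2 (by omega)⟩⟩
    · refine .inl ⟨hB', fun z hz => ?_⟩
      rw [mem_Icc] at hz
      have hu3 : u ≠ 3 := by rintro rfl; exact h3 hu.1
      have hv3 : v ≠ 3 := by rintro rfl; exact h3 hv.1
      rcases (by omega : z = u ∨ z = v) with rfl | rfl
      · exact hu.1
      · exact hv.1
  by_cases hdeg : ∀ x ∈ Icc 1 n, ∀ E ∈ powersetCard (k - 1) ((Icc 1 n).erase x),
      ∃ b ∈ avoidAt x F, ¬ E ⊆ b
  · left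
    have := belowBound_of_nondegenerate hk (by rwa [hVc]) hF hint hdeg hT
    rwa [hVc] at this
  push Not at hdeg
  obtain ⟨x, hx, E, hE, hEb⟩ := hdeg
  obtain ⟨σ, hp, s, hsn, hav⟩ := exists_permute_degenerate (by omega) hF hx hE hEb
  have hsub := permute_subset hF σ
  rw [image_eq_Icc_of_mem hp] at hsub
  have hGint := crossInt_permute hint σ
  have hJ := subset_Jfam_of_avoidAt_eq hsub hGint hav
  have hswap : k ≤ s → SubIsoTo n F (Gfam n k (k - 1)) := by
    intro hks
    refine ⟨Equiv.swap 1 k * σ, fun z hz => ?_, ?_⟩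
    · have := mem_Icc.1 (hp z hz)
      rw [mem_Icc, Equiv.Perm.mul_apply, Equiv.swap_apply_def]
      split_ifs <;> omega
    · have := permute_swap_subset_Gfam (by omega) (by omega) hks hsub hJ
      rwa [← permute_mul] at this
  rcases lt_or_ge s 4 with hs | hs
  · interval_cases s
    · exfalso
      obtain ⟨x, hx, h1⟩ := mem_image.1 ((image_eq_Icc_of_mem hp).symm ▸
        (mem_Icc.2 ⟨le_rfl, by omega⟩ : 1 ∈ Icc 1 n))
      refine hstar ⟨x, hx, fun A hA => ?_⟩
      have h2 := hJ (image_mem_permute.2 hA)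
      rw [Jfam, mem_union] at h2
      rcases h2 with h2 | h2
      · have h3 := (mem_filter.1 h2).2.1
        rw [← h1] at h3
        obtain ⟨y, hy, hyx⟩ := mem_image.1 h3
        exact σ.injective hyx ▸ hy
      · simp at h2
    · exfalso
      refine hHM ⟨σ, hp, fun A hA => ?_⟩
      have hEk : insert (k + 1) (Icc 2 k) = Icc 2 (k + 1) := by
        ext z
        simp only [mem_insert, mem_Icc]
        omega
      have h2 := hJ hA
      rw [Jfam, Icc_self, image_singleton, mem_union, mem_singleton, mem_filter, hEk] at h2
      rw [HMfam, mem_insert, mem_filter]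
      rcases h2 with ⟨h2, h3, h4⟩ | h2
      · refine .inr ⟨h2, h3, ?_⟩
        rw [← hEk]
        exact h4 _ (mem_singleton_self _)
      · exact .inl h2
    · exact absurd ⟨σ, hp, hJ⟩ hJ2
    · exact .inr (.inl ⟨σ, hp, hJ⟩)
  rcases hk.eq_or_lt with rfl | hk5
  · exact absurd (hswap hs) (hG4 rfl).2
  by_cases h5 : k = 5 ∧ 5 ≤ s
  · obtain ⟨rfl, h5⟩ := h5
    exact .inr (.inr ⟨rfl, hswap h5⟩)
  · left
    rw [← card_permute σ F]
    exact belowBound_of_avoidAt_eq hk5 hn hs hsn (by omega) hsub hGint hav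

lemma IsoTo.card_eq {n : ℕ} {A B : Finset (Finset ℕ)} (h : IsoTo n A B) : A.card = B.card := by
  obtain ⟨σ, -, rfl⟩ := h
  exact (card_permute σ A).symm

lemma SubIsoTo.card_le {n : ℕ} {A B : Finset (Finset ℕ)} (h : SubIsoTo n A B) :
    A.card ≤ B.card := by
  obtain ⟨σ, -, h⟩ := h
  exact (card_permute σ A).symm.trans_le (card_le_card h)

lemma SubIsoTo.isoTo {n : ℕ} {A B : Finset (Finset ℕ)} (h : SubIsoTo n A B)
    (hc : B.card ≤ A.card) : IsoTo n A B := by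
  obtain ⟨σ, hp, h⟩ := h
  exact ⟨σ, hp, eq_of_subset_of_card_le h (hc.trans (card_permute σ A).ge)⟩

/-- Huang–Peng theorem, part (ii): `n ≥ 3k−2`. -/
theorem stmt_7 (k n : ℕ) (hk : 4 ≤ k) (hn : 3 * k - 2 ≤ n)
    (F : Finset (Finset ℕ)) (hF : F ⊆ powersetCard k (Icc 1 n))
    (hint : ∀ A ∈ F, ∀ B ∈ F, (A ∩ B).Nonempty)
    (hstar : ¬ ∃ x ∈ Icc 1 n, ∀ A ∈ F, x ∈ A)
    (hHM : ¬ SubIsoTo n F (HMfam n k))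
    (hJ2 : ¬ SubIsoTo n F (Jfam n k 2))
    (hG4 : k = 4 → ¬ SubIsoTo n F (Gfam n 4 2) ∧ ¬ SubIsoTo n F (Gfam n 4 3)) :
    ((F.card : ℤ) ≤ ((n - 1).choose (k - 1) : ℤ) - (n - k - 1).choose (k - 1)
        - (n - k - 2).choose (k - 2) - (n - k - 3).choose (k - 3) + 3) ∧
    ((k = 4 ∨ 6 ≤ k) →
      (((F.card : ℤ) = ((n - 1).choose (k - 1) : ℤ) - (n - k - 1).choose (k - 1)
          - (n - k - 2).choose (k - 2) - (n - k - 3).choose (k - 3) + 3) ↔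
        IsoTo n F (Jfam n k 3))) ∧
    (k = 5 →
      (((F.card : ℤ) = ((n - 1).choose (k - 1) : ℤ) - (n - k - 1).choose (k - 1)
          - (n - k - 2).choose (k - 2) - (n - k - 3).choose (k - 3) + 3) ↔
        (IsoTo n F (Jfam n 5 3) ∨ IsoTo n F (Gfam n 5 4)))) := by
  have hcases := belowBound_or_permute_subset hk hn hF hint hstar hHM hJ2 hG4
  have hJc := card_Jfam_three (n := n) (k := k) (by omega) (by omega)
  have hGc : k = 5 → (Gfam n 5 4).card = (Jfam n k 3).card := by
    rintro rfl
    have := card_Gfam_five (n := n) (by omega)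
    omega
  have hval : ((Jfam n k 3).card : ℤ) = ((n - 1).choose (k - 1) : ℤ) - (n - k - 1).choose (k - 1)
      - (n - k - 2).choose (k - 2) - (n - k - 3).choose (k - 3) + 3 := by
    rw [show n - k - 1 = n - 1 - k - 0 by omega, show n - k - 2 = n - 1 - k - 1 by omega,
      show n - k - 3 = n - 1 - k - 2 by omega, show k - 2 = k - 1 - 1 by omega,
      show k - 3 = k - 1 - 2 by omega]
    simp only [sum_range_succ, sum_range_zero, zero_add, Nat.sub_zero] at hJc ⊢
    omega
  rw [← hval, Nat.cast_le, Nat.cast_inj]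
  have hbelow : BelowBound n k F.card → F.card < (Jfam n k 3).card := by
    intro h
    rw [BelowBound] at h
    omega
  refine ⟨?_, fun hk' => ⟨fun hc => ?_, IsoTo.card_eq⟩, ?_⟩
  · rcases hcases with h | h | ⟨rfl, h⟩
    · exact (hbelow h).le
    · exact h.card_le
    · exact h.card_le.trans (hGc rfl).le
  · rcases hcases with h | h | ⟨rfl, -⟩
    · exact absurd hc (hbelow h).ne
    · exact h.isoTo hc.ge
    · omega
  · rintro rfl
    refine ⟨fun hc => ?_, ?_⟩
    · rcases hcases with h | h | ⟨-, h⟩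
      · exact absurd hc (hbelow h).ne
      · exact .inl (h.isoTo hc.ge)
      · exact .inr (h.isoTo (hc.trans (hGc rfl).symm).ge)
    · rintro (h | h)
      · exact h.card_eq
      · exact h.card_eq.trans (hGc rfl)
end

section
/- Let k ≥ 1 and t ≥ 0 be integers and let ℱ be a shifted (t+1)-intersecting family of subsets of [n]. Then the family ℱ(1̄) = {F ∈ ℱ : 1 ∉ F} is (t+2)-intersecting. -/
open Finset

/-- A family `ℱ` of subsets of `[n]` is shifted if for every `F ∈ ℱ` and every
`i < j` (with `i ∈ [n]`, i.e. `1 ≤ i`) such that `i ∉ F` and `j ∈ F`, the set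
`(F ∖ {j}) ∪ {i}` also belongs to `ℱ`. -/
def Shifted (F : Finset (Finset ℕ)) : Prop :=
  ∀ A ∈ F, ∀ i j : ℕ, 1 ≤ i → i < j → i ∉ A → j ∈ A → insert i (A.erase j) ∈ F

/-- If `ℱ` is a shifted `(t+1)`-intersecting family of subsets of `[n]`, then
`ℱ(1̄) = {F ∈ ℱ : 1 ∉ F}` is `(t+2)`-intersecting. -/
theorem stmt_8 (k t n : ℕ) (hk : 1 ≤ k)
    (F : Finset (Finset ℕ)) (hFsub : ∀ A ∈ F, A ⊆ Icc 1 n)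
    (hshift : Shifted F)
    (hint : ∀ A ∈ F, ∀ B ∈ F, t + 1 ≤ (A ∩ B).card) :
    ∀ A ∈ F.filter (fun A => 1 ∉ A), ∀ B ∈ F.filter (fun A => 1 ∉ A),
      t + 2 ≤ (A ∩ B).card := by
  intro A hA B hB
  obtain ⟨hA, h1A⟩ := mem_filter.mp hA
  obtain ⟨hB, h1B⟩ := mem_filter.mp hB
  obtain ⟨x, hx⟩ : (A ∩ B).Nonempty :=
    card_pos.mp (Nat.succ_pos t |>.trans_le (hint A hA B hB))
  have hxA : x ∈ A := (mem_inter.mp hx).1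
  have hx1 : 1 < x :=
    (mem_Icc.mp (hFsub A hA hxA)).1.lt_of_ne fun h => h1A (h ▸ hxA)
  have h := hint _ (hshift A hA 1 x le_rfl hx1 h1A hxA) B hB
  rw [insert_inter_of_notMem h1B, erase_inter, card_erase_of_mem hx] at h
  omega
end

section
/- Let k ≥ 1, t ≥ 0 and n ≥ 2k+t be integers and let ℱ ⊆ ([n] choose k+t) be a shifted (t+1)-intersecting family. Then the family ℱ(n) = {F ∖ {n} : F ∈ ℱ, n ∈ F} is (t+1)-intersecting. -/
open Finset

/-- If `ℱ ⊆ ([n] choose k+t)` is a shifted `(t+1)`-intersecting family and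
`n ≥ 2k+t`, then `ℱ(n) = {F ∖ {n} : F ∈ ℱ, n ∈ F}` is `(t+1)`-intersecting. -/
theorem stmt_9 (k t n : ℕ) (hk : 1 ≤ k) (hn : 2 * k + t ≤ n)
    (F : Finset (Finset ℕ)) (hF : F ⊆ powersetCard (k + t) (Icc 1 n))
    (hshift : Shifted F)
    (hint : ∀ A ∈ F, ∀ B ∈ F, t + 1 ≤ (A ∩ B).card) :
    ∀ A ∈ (F.filter (fun A => n ∈ A)).image (fun A => A.erase n),
      ∀ B ∈ (F.filter (fun A => n ∈ A)).image (fun A => A.erase n),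
        t + 1 ≤ (A ∩ B).card := by
  intro A' hA' B' hB'
  simp only [mem_image, mem_filter] at hA' hB'
  obtain ⟨A, ⟨hA, hnA⟩, rfl⟩ := hA'
  obtain ⟨B, ⟨hB, hnB⟩, rfl⟩ := hB'
  obtain ⟨hAn, hAc⟩ := mem_powersetCard.mp (hF hA)
  obtain ⟨hBn, hBc⟩ := mem_powersetCard.mp (hF hB)
  have hinter : A.erase n ∩ B.erase n = (A ∩ B).erase n := by
    ext x
    simp only [mem_inter, mem_erase]
    tauto
  by_contra! hlt
  rw [hinter, card_erase_of_mem (mem_inter.mpr ⟨hnA, hnB⟩)] at hlt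
  have hAB := hint A hA B hB
  have hunion : (A ∪ B).card < (Icc 1 n).card := by
    have := card_union_add_card_inter A B
    rw [Nat.card_Icc]
    omega
  obtain ⟨i, hi, hiAB⟩ := exists_mem_notMem_of_card_lt_card hunion
  rw [mem_union, not_or] at hiAB
  rw [mem_Icc] at hi
  have hin : i < n := lt_of_le_of_ne hi.2 fun h => hiAB.1 (h ▸ hnA)
  have hcard := hint _ (hshift A hA i n hi.1 hin hiAB.1 hnA) B hB
  rw [insert_inter_of_notMem hiAB.2, erase_inter,
    card_erase_of_mem (mem_inter.mpr ⟨hnA, hnB⟩)] at hcard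
  omega
end

section
/- Let t ≥ 0, k ≥ 1 and n ≥ 2k+t be integers. Let ℱ ⊆ ([n] choose k+t) and 𝒢 ⊆ ([n] choose k) be shifted cross-intersecting families. Then the families ℱ(n) = {F ∖ {n} : F ∈ ℱ, n ∈ F} and 𝒢(n) = {G ∖ {n} : G ∈ 𝒢, n ∈ G} are cross-intersecting. -/
open Finset

/-- If `ℱ ⊆ ([n] choose k+t)` and `𝒢 ⊆ ([n] choose k)` are shifted
cross-intersecting families and `n ≥ 2k+t`, then `ℱ(n)` and `𝒢(n)` are
cross-intersecting. -/
theorem stmt_11 (k t n : ℕ) (hk : 1 ≤ k) (hn : 2 * k + t ≤ n)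
    (F G : Finset (Finset ℕ))
    (hF : F ⊆ powersetCard (k + t) (Icc 1 n))
    (hG : G ⊆ powersetCard k (Icc 1 n))
    (hFshift : Shifted F) (hGshift : Shifted G)
    (hcross : ∀ A ∈ F, ∀ B ∈ G, (A ∩ B).Nonempty) :
    ∀ A ∈ (F.filter (fun A => n ∈ A)).image (fun A => A.erase n),
      ∀ B ∈ (G.filter (fun B => n ∈ B)).image (fun B => B.erase n),
        (A ∩ B).Nonempty := by
  simp only [mem_image, mem_filter]
  rintro _ ⟨A, ⟨hA, hnA⟩, rfl⟩ _ ⟨B, ⟨hB, hnB⟩, rfl⟩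
  by_contra hempty
  rw [not_nonempty_iff_eq_empty, erase_inter, inter_erase, erase_idem,
    erase_eq_empty_iff] at hempty
  have hinter : A ∩ B = {n} :=
    hempty.resolve_left (hcross A hA B hB).ne_empty
  have hcardA := (mem_powersetCard.mp (hF hA)).2
  have hcardB := (mem_powersetCard.mp (hG hB)).2
  have hunion := card_union_add_card_inter A B
  rw [hinter, card_singleton] at hunion
  obtain ⟨i, hi, hiAB⟩ : ∃ i ∈ Icc 1 n, i ∉ A ∪ B :=
    exists_mem_notMem_of_card_lt_card (by rw [Nat.card_Icc]; omega)
  rw [mem_union, not_or] at hiAB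
  obtain ⟨hi1, hin⟩ := mem_Icc.mp hi
  have hlt : i < n := lt_of_le_of_ne hin fun h => hiAB.1 (h ▸ hnA)
  obtain ⟨x, hx⟩ := hcross _ (hFshift A hA i n hi1 hlt hiAB.1 hnA) B hB
  obtain ⟨hxA, hxB⟩ := mem_inter.mp hx
  rcases mem_insert.mp hxA with rfl | hxA
  · exact hiAB.2 hxB
  · obtain ⟨hxn, hxA⟩ := mem_erase.mp hxA
    exact hxn (mem_singleton.mp (hinter ▸ mem_inter.mpr ⟨hxA, hxB⟩))
end
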